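/- Let n ≥ 2, 0 < E_min ≤ E_max, 1/2 < s ≤ 1, and let V : (0,∞) → ℝ be measurable, essentially bounded, and compactly supported with R₀ > 0. Fix R > sup_{E ∈ [E_min, E_max]} R₁(V,E). Then there exist C, h₀ > 0 such that for every ε > 0, every h ∈ (0, h₀], every E ∈ [E_min, E_max], and every smooth compactly supported u : ℝⁿ → ℂ for which the function f := −h² Δu + V(|x|) u − (E + iε) u vanishes almost everywhere on {|x| < R}, one has ‖⟨x⟩^{−s} u‖_{L²({x ∈ ℝⁿ : |x| ≥ R})} ≤ (C/h) ‖⟨x⟩^{s} f‖_{L²(ℝⁿ)}. (This is the a priori-estimate form of the exterior weighted resolvent bound ‖⟨x⟩^{−s} 𝟙_{≥R} (−h²Δ + V(|x|) − E − iε)^{−1} 𝟙_{≥R} ⟨x⟩^{−s}‖_{L²→L²} ≤ C/h.) -/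

import Mathlib

open MeasureTheory Set

/-- The Laplacian `Δu(x) = ∑ j ∂²u/∂x_j²` of a function on `ℝⁿ`. -/
noncomputable def lapl {n : ℕ} (u : EuclideanSpace ℝ (Fin n) → ℂ)
    (x : EuclideanSpace ℝ (Fin n)) : ℂ :=
  ∑ j : Fin n, iteratedFDeriv ℝ 2 u x
    ![EuclideanSpace.single j (1 : ℝ), EuclideanSpace.single j (1 : ℝ)]

/-- The Japanese-bracket weight `⟨t⟩^s = (1 + t²)^{s/2}`. -/
noncomputable def jbr (s t : ℝ) : ℝ := (1 + t ^ 2) ^ (s / 2)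

/-- `R₀(V)`: the supremum of the essential support of `V : (0,∞) → ℝ`,
realized as the infimum of the radii beyond which `V` vanishes a.e. -/
noncomputable def R0 (V : ℝ → ℝ) : ℝ :=
  sInf {R : ℝ | 0 ≤ R ∧ ∀ᵐ r ∂(volume.restrict (Ioi (0 : ℝ))), R < r → V r = 0}

/-- `M₀(V,E) = inf{ m > 0 : V(r) + m r⁻² - E ≥ 0 a.e. in a neighborhood of (0,R₀] }`. -/
noncomputable def M0 (V : ℝ → ℝ) (E : ℝ) : ℝ :=
  sInf {m : ℝ | 0 < m ∧ ∃ R' > R0 V,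
    ∀ᵐ r ∂(volume.restrict (Ioi (0 : ℝ))), r < R' → 0 ≤ V r + m * (r ^ 2)⁻¹ - E}

/-- `R₁(V,E) = (M₀(V,E)/E)^{1/2}`. -/
noncomputable def R1 (V : ℝ → ℝ) (E : ℝ) : ℝ := Real.sqrt (M0 V E / E)

section ResolventEstimates

open Filter Topology

/-- Pointwise algebra behind the weighted energy estimate. -/
theorem energy_pointwise {h ε E B m κ Kw w w1 z D r p q p1 q1 p2 q2 P Q Φ' : ℝ}
    (hh : 0 < h) (hh1 : h ≤ 1) (hε : 0 < ε) (hε1 : ε ≤ 1) (hκ : 0 < κ) (hB : E - m / r ^ 2 ≤ B)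
    (hB0 : 0 ≤ B)
    (hw0 : 0 ≤ w) (hw2 : w ≤ 2) (hz : 0 < z) (hw1 : κ * z ≤ w1) (hw1K : w1 ≤ Kw)
    (hp2 : h ^ 2 * p2 = (m / r ^ 2 - E) * p + ε * q - P)
    (hq2 : h ^ 2 * q2 = (m / r ^ 2 - E) * q - ε * p - Q)
    (hD : D = w1 * (E - m / r ^ 2) + 2 * w * m / r ^ 3)
    (hΦ : Φ' = h * (w1 * (h ^ 2 * (p1 ^ 2 + q1 ^ 2) + (E - m / r ^ 2) * (p ^ 2 + q ^ 2))
        + w * (h ^ 2 * (2 * p1 * p2 + 2 * q1 * q2) + (2 * m / r ^ 3) * (p ^ 2 + q ^ 2)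
          + (E - m / r ^ 2) * (2 * p * p1 + 2 * q * q1)))
      + 2 * ε * (2 * w * w1 * (h ^ 2 * (p1 * p + q1 * q))
        + w ^ 2 * (h ^ 2 * (p2 * p + p1 * p1 + (q2 * q + q1 * q1))))
      - (8 * B + 4 * Kw ^ 2 + 1) * (h ^ 2 * (q2 * p - p2 * q))) :
    h * κ * (z * (h ^ 2 * (p1 ^ 2 + q1 ^ 2))) + h * (D * (p ^ 2 + q ^ 2)) ≤
      Φ' + (h * κ / 2 * (z * (h ^ 2 * (p1 ^ 2 + q1 ^ 2))) + h * κ / 2 * (z * (p ^ 2 + q ^ 2))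
        + 4 * (20 + (8 * B + 4 * Kw ^ 2 + 1) ^ 2) / (h * κ) * (z⁻¹ * (P ^ 2 + Q ^ 2))) := by
  set K := 8 * B + 4 * Kw ^ 2 with hK
  have hK0 : 0 ≤ K := by positivity
  set g := E - m / r ^ 2 with hg
  have hp2' : h ^ 2 * p2 = -g * p + ε * q - P := by rw [hp2, hg]; ring
  have hq2' : h ^ 2 * q2 = -g * q - ε * p - Q := by rw [hq2, hg]; ring
  have e : Φ' = h * (w1 * (h ^ 2 * (p1 ^ 2 + q1 ^ 2))) + h * (D * (p ^ 2 + q ^ 2))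
      + 2 * h * w * (p1 * (ε * q - P) + q1 * (-ε * p - Q))
      + 2 * ε * (w ^ 2 * (h ^ 2 * (p1 ^ 2 + q1 ^ 2)) - w ^ 2 * g * (p ^ 2 + q ^ 2)
        - w ^ 2 * (P * p + Q * q) + 2 * h ^ 2 * w * w1 * (p1 * p + q1 * q))
      - (K + 1) * (-ε * (p ^ 2 + q ^ 2) - Q * p + P * q) := by
    rw [hΦ, hD]
    linear_combination (2 * h * w * p1 + 2 * ε * w ^ 2 * p + (K + 1) * q) * hp2'
      + (2 * h * w * q1 + 2 * ε * w ^ 2 * q - (K + 1) * p) * hq2'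
  have hw1' : 0 ≤ w1 := le_trans (by positivity) hw1
  have hKw : 0 ≤ Kw := hw1'.trans hw1K
  have i1 : h * κ * (z * (h ^ 2 * (p1 ^ 2 + q1 ^ 2))) ≤ h * (w1 * (h ^ 2 * (p1 ^ 2 + q1 ^ 2))) := by
    calc _ = h * ((κ * z) * (h ^ 2 * (p1 ^ 2 + q1 ^ 2))) := by ring
      _ ≤ _ := by gcongr
  -- cross term with `ε`
  have i2 : -(2 * h * w * (p1 * (ε * q) + q1 * (-ε * p))) ≤
      ε * (w ^ 2 * (h ^ 2 * (p1 ^ 2 + q1 ^ 2))) + ε * (p ^ 2 + q ^ 2) := by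
    have := mul_nonneg hε.le (add_nonneg (sq_nonneg (w * h * p1 + q)) (sq_nonneg (w * h * q1 - p)))
    linarith [this]
  have i3 : -(2 * h ^ 2 * w * w1 * (p1 * p + q1 * q)) ≤
      1 / 2 * (w ^ 2 * (h ^ 2 * (p1 ^ 2 + q1 ^ 2))) + 2 * Kw ^ 2 * (p ^ 2 + q ^ 2) := by
    have h1 : h ^ 2 * w1 ^ 2 ≤ Kw ^ 2 := by
      calc h ^ 2 * w1 ^ 2 ≤ 1 ^ 2 * Kw ^ 2 := by gcongr
        _ = _ := by ring
    have h2 := mul_le_mul_of_nonneg_right h1 (add_nonneg (sq_nonneg p) (sq_nonneg q))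
    linarith [sq_nonneg (w * h * p1 + 2 * (h * w1) * p), sq_nonneg (w * h * q1 + 2 * (h * w1) * q)]
  have i4 : w ^ 2 * g * (p ^ 2 + q ^ 2) ≤ 4 * B * (p ^ 2 + q ^ 2) := by
    have : w ^ 2 * g ≤ 2 ^ 2 * B := by
      calc w ^ 2 * g ≤ w ^ 2 * B := by gcongr
        _ ≤ 2 ^ 2 * B := by gcongr
    linarith [mul_le_mul_of_nonneg_right this (add_nonneg (sq_nonneg p) (sq_nonneg q))]
  set η := h * κ / 4 with hη
  have hη0 : 0 < η := by positivity
  have amgm : ∀ c x y : ℝ, c * (x * y) ≤ η * z * x ^ 2 + c ^ 2 / (4 * η) * (z⁻¹ * y ^ 2) := by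
    intro c x y
    have : 0 ≤ η * z * (x - c / (2 * η) * z⁻¹ * y) ^ 2 := by positivity
    have e : η * z * (x - c / (2 * η) * z⁻¹ * y) ^ 2
        = η * z * x ^ 2 + c ^ 2 / (4 * η) * (z⁻¹ * y ^ 2) - c * (x * y) := by
      field_simp; ring
    linarith
  have bd : ∀ c C y : ℝ, c ^ 2 ≤ C → c ^ 2 / (4 * η) * (z⁻¹ * y ^ 2) ≤ C / (4 * η) * (z⁻¹ * y ^ 2) := by
    intro c C y hc; gcongr
  have c1 : (2 * w) ^ 2 ≤ 16 := by
    calc (2 * w) ^ 2 ≤ (2 * 2) ^ 2 := by gcongr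
      _ = 16 := by norm_num
  have c2 : (2 * ε * w ^ 2) ^ 2 ≤ 64 := by
    calc (2 * ε * w ^ 2) ^ 2 ≤ (2 * 1 * 2 ^ 2) ^ 2 := by gcongr
      _ = 64 := by norm_num
  have j1 := amgm (2 * w) (h * p1) P
  have j2 := amgm (2 * w) (h * q1) Q
  have j3 := amgm (2 * ε * w ^ 2) p P
  have j4 := amgm (2 * ε * w ^ 2) q Q
  have j5 := amgm (K + 1) q P
  have j6 := amgm (-(K + 1)) p Q
  have k1 := bd _ _ P c1
  have k2 := bd _ _ Q c1
  have k3 := bd _ _ P c2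
  have k4 := bd _ _ Q c2
  have fin : 4 * (20 + (K + 1) ^ 2) / (h * κ) * (z⁻¹ * (P ^ 2 + Q ^ 2)) =
      (80 + 4 * (K + 1) ^ 2) / (4 * η) * (z⁻¹ * P ^ 2) + (80 + 4 * (K + 1) ^ 2) / (4 * η) * (z⁻¹ * Q ^ 2) := by
    rw [hη]; field_simp; ring
  have sp : ∀ y : ℝ, (80 + 4 * (K + 1) ^ 2) / (4 * η) * (z⁻¹ * y ^ 2) = 16 / (4 * η) * (z⁻¹ * y ^ 2)
     + 64 / (4 * η) * (z⁻¹ * y ^ 2) + (K + 1) ^ 2 / (4 * η) * (z⁻¹ * y ^ 2)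
     + 3 * ((K + 1) ^ 2 / (4 * η) * (z⁻¹ * y ^ 2)) := by
    intro y; ring
  have pos : ∀ y : ℝ, 0 ≤ (K + 1) ^ 2 / (4 * η) * (z⁻¹ * y ^ 2) := by intro y; positivity
  rw [fin, sp P, sp Q, e]
  have hκη : h * κ / 2 = 2 * η := by rw [hη]; ring
  rw [hκη]
  have i3' := mul_le_mul_of_nonneg_left i3 (by positivity : 0 ≤ 2 * ε)
  have i4' := mul_le_mul_of_nonneg_left i4 (by positivity : 0 ≤ 2 * ε)
  have hKB : ε * K * (p ^ 2 + q ^ 2) = 2 * ε * (4 * B * (p ^ 2 + q ^ 2)) + 2 * ε * (2 * Kw ^ 2 * (p ^ 2 + q ^ 2)) := by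
    rw [hK]; ring
  have z1 : 0 ≤ η * z * p1 ^ 2 * h ^ 2 := by positivity
  have z2 : 0 ≤ η * z * q1 ^ 2 * h ^ 2 := by positivity
  rw [neg_sq] at j6
  have posP := pos P
  have posQ := pos Q
  linarith only [posP, posQ, hκη, i1, i2, i3', i4', hKB, z1, z2, j1, j2, j3, j4, j5, j6, k1, k2, k3, k4]

/-- Weighted energy estimate for a radial Schrödinger equation on `[a, T]`. -/
theorem energy_estimate {a T h ε E B m κ Kw : ℝ} {w w1 z D p q p1 q1 p2 q2 P Q : ℝ → ℝ}
    (ha : 0 < a) (haT : a ≤ T)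
    (hh : 0 < h) (hh1 : h ≤ 1) (hε : 0 < ε) (hε1 : ε ≤ 1) (hκ : 0 < κ) (hB0 : 0 ≤ B)
    (hB : ∀ r ∈ Icc a T, E - m / r ^ 2 ≤ B)
    (hw : ∀ r ∈ Icc a T, HasDerivAt w (w1 r) r) (hw1c : ContinuousOn w1 (Icc a T))
    (hzc : ContinuousOn z (Icc a T)) (hwa : w a = 0)
    (hw0 : ∀ r ∈ Icc a T, 0 ≤ w r) (hw2 : ∀ r ∈ Icc a T, w r ≤ 2) (hz : ∀ r ∈ Icc a T, 0 < z r)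
    (hw1 : ∀ r ∈ Icc a T, κ * z r ≤ w1 r) (hw1K : ∀ r ∈ Icc a T, w1 r ≤ Kw)
    (hp : ∀ r ∈ Icc a T, HasDerivAt p (p1 r) r) (hq : ∀ r ∈ Icc a T, HasDerivAt q (q1 r) r)
    (hp1 : ∀ r ∈ Icc a T, HasDerivAt p1 (p2 r) r) (hq1 : ∀ r ∈ Icc a T, HasDerivAt q1 (q2 r) r)
    (hp2c : ContinuousOn p2 (Icc a T)) (hq2c : ContinuousOn q2 (Icc a T))
    (hPc : ContinuousOn P (Icc a T)) (hQc : ContinuousOn Q (Icc a T))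
    (hp2 : ∀ r ∈ Icc a T, h ^ 2 * p2 r = (m / r ^ 2 - E) * p r + ε * q r - P r)
    (hq2 : ∀ r ∈ Icc a T, h ^ 2 * q2 r = (m / r ^ 2 - E) * q r - ε * p r - Q r)
    (hD : ∀ r, D r = w1 r * (E - m / r ^ 2) + 2 * w r * m / r ^ 3)
    (hDz : κ * ∫ r in a..T, z r * (p r ^ 2 + q r ^ 2) ≤ ∫ r in a..T, D r * (p r ^ 2 + q r ^ 2))
    (hpT : p T = 0) (hqT : q T = 0) (hp1T : p1 T = 0) (hq1T : q1 T = 0)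
    (hflux : q1 a * p a - p1 a * q a ≤ 0) :
    ∫ r in a..T, z r * (p r ^ 2 + q r ^ 2) ≤
      8 * (20 + (8 * B + 4 * Kw ^ 2 + 1) ^ 2) / (h ^ 2 * κ ^ 2) *
        ∫ r in a..T, (z r)⁻¹ * (P r ^ 2 + Q r ^ 2) := by
  have r0 : ∀ r ∈ Icc a T, r ≠ 0 := fun r hr => (ha.trans_le hr.1).ne'
  set K := 8 * B + 4 * Kw ^ 2 + 1 with hK
  have hK0 : 0 ≤ K := by positivity
  set Φ : ℝ → ℝ := fun r => h * (w r * (h ^ 2 * (p1 r ^ 2 + q1 r ^ 2)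
      + (E - m / r ^ 2) * (p r ^ 2 + q r ^ 2)))
      + 2 * ε * (w r ^ 2 * (h ^ 2 * (p1 r * p r + q1 r * q r)))
      - K * (h ^ 2 * (q1 r * p r - p1 r * q r)) with hΦ
  set Φ' : ℝ → ℝ := fun r =>
      h * (w1 r * (h ^ 2 * (p1 r ^ 2 + q1 r ^ 2) + (E - m / r ^ 2) * (p r ^ 2 + q r ^ 2))
        + w r * (h ^ 2 * (2 * p1 r * p2 r + 2 * q1 r * q2 r) + (2 * m / r ^ 3) * (p r ^ 2 + q r ^ 2)
          + (E - m / r ^ 2) * (2 * p r * p1 r + 2 * q r * q1 r)))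
      + 2 * ε * (2 * w r * w1 r * (h ^ 2 * (p1 r * p r + q1 r * q r))
        + w r ^ 2 * (h ^ 2 * (p2 r * p r + p1 r * p1 r + (q2 r * q r + q1 r * q1 r))))
      - K * (h ^ 2 * (q2 r * p r - p2 r * q r)) with hΦ'
  have hder : ∀ r ∈ Icc a T, HasDerivAt Φ (Φ' r) r := by
    intro r hr
    have hr0 := r0 r hr
    have dp := hp r hr
    have dq := hq r hr
    have dp1 := hp1 r hr
    have dq1 := hq1 r hr
    have dw := hw r hr
    have dm : HasDerivAt (fun r => E - m / r ^ 2) (2 * m / r ^ 3) r := by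
      have := ((hasDerivAt_const r m).div (hasDerivAt_pow 2 r) (pow_ne_zero 2 hr0)).const_sub E
      refine this.congr_deriv ?_
      norm_num
      field_simp
    have A1 := ((dw.mul ((((dp1.pow 2).add (dq1.pow 2)).const_mul (h ^ 2)).add
      (dm.mul ((dp.pow 2).add (dq.pow 2))))).const_mul h)
    have A2 := (((dw.pow 2).mul (((dp1.mul dp).add (dq1.mul dq)).const_mul (h ^ 2))).const_mul (2 * ε))
    have A3 := ((((dq1.mul dp).sub (dp1.mul dq)).const_mul (h ^ 2)).const_mul K)
    refine ((A1.add A2).sub A3).congr_deriv ?_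
    simp only [Pi.add_apply, Pi.mul_apply, Pi.pow_apply, hΦ']
    push_cast
    ring
  have cp : ContinuousOn p (Icc a T) := fun r hr => (hp r hr).continuousAt.continuousWithinAt
  have cq : ContinuousOn q (Icc a T) := fun r hr => (hq r hr).continuousAt.continuousWithinAt
  have cp1 : ContinuousOn p1 (Icc a T) := fun r hr => (hp1 r hr).continuousAt.continuousWithinAt
  have cq1 : ContinuousOn q1 (Icc a T) := fun r hr => (hq1 r hr).continuousAt.continuousWithinAt
  have cw : ContinuousOn w (Icc a T) := fun r hr => (hw r hr).continuousAt.continuousWithinAt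
  have cm : ContinuousOn (fun r : ℝ => m / r ^ 2) (Icc a T) :=
    continuousOn_const.div (by fun_prop) fun r hr => pow_ne_zero 2 (r0 r hr)
  have cm3 : ∀ c : ℝ, ContinuousOn (fun r : ℝ => c / r ^ 3) (Icc a T) := fun c =>
    continuousOn_const.div (by fun_prop) fun r hr => pow_ne_zero 3 (r0 r hr)
  have cm3' : ContinuousOn (fun r : ℝ => 2 * w r * m / r ^ 3) (Icc a T) :=
    ContinuousOn.div (by fun_prop) (by fun_prop) fun r hr => pow_ne_zero 3 (r0 r hr)
  have cD : ContinuousOn D (Icc a T) := by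
    rw [show D = _ from funext hD]
    fun_prop
  have czi : ContinuousOn (fun r => (z r)⁻¹) (Icc a T) := hzc.inv₀ fun r hr => (hz r hr).ne'
  have cm3'' := cm3 (2 * m)
  have cΦ' : ContinuousOn Φ' (Icc a T) := by
    rw [hΦ']; fun_prop
  have ii : ∀ {f : ℝ → ℝ}, ContinuousOn f (Icc a T) → IntervalIntegrable f volume a T :=
    fun hf => (hf.mono (by rw [uIcc_of_le haT])).intervalIntegrable
  have ftc : ∫ r in a..T, Φ' r = Φ T - Φ a :=
    intervalIntegral.integral_eq_sub_of_hasDerivAt (fun r hr => hder r (by rwa [uIcc_of_le haT] at hr))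
      (ii cΦ')
  have ΦT : Φ T = 0 := by simp [hΦ, hpT, hqT, hp1T, hq1T]
  have Φa : 0 ≤ Φ a := by
    have : Φ a = K * h ^ 2 * (-(q1 a * p a - p1 a * q a)) := by simp only [hΦ, hwa]; ring
    rw [this]
    have : 0 ≤ -(q1 a * p a - p1 a * q a) := by linarith
    positivity
  have mono := intervalIntegral.integral_mono_on (μ := volume) haT
    (f := fun r => h * κ * (z r * (h ^ 2 * (p1 r ^ 2 + q1 r ^ 2))) + h * (D r * (p r ^ 2 + q r ^ 2)))
    (g := fun r => Φ' r + (h * κ / 2 * (z r * (h ^ 2 * (p1 r ^ 2 + q1 r ^ 2)))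
        + h * κ / 2 * (z r * (p r ^ 2 + q r ^ 2))
        + 4 * (20 + K ^ 2) / (h * κ) * ((z r)⁻¹ * (P r ^ 2 + Q r ^ 2))))
    (ii (by fun_prop)) (ii (by fun_prop)) (fun r hr =>
      energy_pointwise hh hh1 hε hε1 hκ (hB r hr) hB0 (hw0 r hr) (hw2 r hr) (hz r hr) (hw1 r hr)
        (hw1K r hr) (hp2 r hr) (hq2 r hr) (hD r) rfl)
  have i1 : IntervalIntegrable (fun r => z r * (h ^ 2 * (p1 r ^ 2 + q1 r ^ 2))) volume a T :=
    ii (by fun_prop)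
  have i2 : IntervalIntegrable (fun r => z r * (p r ^ 2 + q r ^ 2)) volume a T := ii (by fun_prop)
  have i3 : IntervalIntegrable (fun r => (z r)⁻¹ * (P r ^ 2 + Q r ^ 2)) volume a T :=
    ii (by fun_prop)
  have i4 : IntervalIntegrable (fun r => D r * (p r ^ 2 + q r ^ 2)) volume a T := ii (by fun_prop)
  rw [intervalIntegral.integral_add (i1.const_mul _) (i4.const_mul _),
    intervalIntegral.integral_add (ii cΦ') (((i1.const_mul _).add (i2.const_mul _)).add
      (i3.const_mul _)), intervalIntegral.integral_add ((i1.const_mul _).add (i2.const_mul _))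
      (i3.const_mul _), intervalIntegral.integral_add (i1.const_mul _) (i2.const_mul _),
    intervalIntegral.integral_const_mul, intervalIntegral.integral_const_mul,
    intervalIntegral.integral_const_mul, intervalIntegral.integral_const_mul,
    intervalIntegral.integral_const_mul, ftc, ΦT] at mono
  have J1 : 0 ≤ ∫ r in a..T, z r * (h ^ 2 * (p1 r ^ 2 + q1 r ^ 2)) :=
    intervalIntegral.integral_nonneg haT fun r hr => by have := hz r hr; positivity
  have hDz' := mul_le_mul_of_nonneg_left hDz hh.le
  set J := ∫ r in a..T, z r * (p r ^ 2 + q r ^ 2)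
  set G := ∫ r in a..T, (z r)⁻¹ * (P r ^ 2 + Q r ^ 2)
  have hJ1 : 0 ≤ h * κ / 2 * ∫ r in a..T, z r * (h ^ 2 * (p1 r ^ 2 + q1 r ^ 2)) := by positivity
  have key : h * κ / 2 * J ≤ 4 * (20 + K ^ 2) / (h * κ) * G := by linarith
  have e : 8 * (20 + K ^ 2) / (h ^ 2 * κ ^ 2) * G = (2 / (h * κ)) * (4 * (20 + K ^ 2) / (h * κ) * G) := by
    field_simp; ring
  rw [e]
  calc J = (2 / (h * κ)) * (h * κ / 2 * J) := by field_simp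
    _ ≤ _ := by gcongr

/-- A continuous function on an open set which is a.e. nonnegative is nonnegative. -/
theorem nonneg_of_ae_nonneg_of_continuousOn {f : ℝ → ℝ} {c d : ℝ} (hf : ContinuousOn f (Ioo c d))
    (h : ∀ᵐ r ∂(volume : Measure ℝ), r ∈ Ioo c d → 0 ≤ f r) : ∀ r ∈ Ioo c d, 0 ≤ f r := by
  by_contra! hcon
  obtain ⟨r, hr, hfr⟩ := hcon
  have ho : IsOpen (Ioo c d ∩ f ⁻¹' Iio 0) := hf.isOpen_inter_preimage isOpen_Ioo isOpen_Iio
  have hpos := ho.measure_pos volume ⟨r, hr, hfr⟩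
  refine hpos.ne' (measure_mono_null ?_ (ae_iff.1 h))
  rintro x ⟨hx, hfx⟩ hc
  exact absurd (hc hx) (not_le.2 hfx)

theorem nonneg_of_tendsto_zero_of_deriv_nonneg {f f' : ℝ → ℝ} {b : ℝ}
    (hf : ∀ r ∈ Ioo 0 b, HasDerivAt f (f' r) r) (hf' : ∀ r ∈ Ioo 0 b, 0 ≤ f' r)
    (h0 : Tendsto f (𝓝[>] 0) (𝓝 0)) {a : ℝ} (ha : a ∈ Ioo 0 b) : 0 ≤ f a := by
  have mono : MonotoneOn f (Ioo 0 b) := by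
    refine monotoneOn_of_deriv_nonneg (convex_Ioo 0 b)
      (fun r hr => (hf r hr).continuousAt.continuousWithinAt) ?_ ?_
    · rw [interior_Ioo]
      exact fun r hr => (hf r hr).differentiableAt.differentiableWithinAt
    · rw [interior_Ioo]
      exact fun r hr => by rw [(hf r hr).deriv]; exact hf' r hr
  refine le_of_tendsto h0 ?_
  filter_upwards [Ioo_mem_nhdsGT ha.1] with r hr
  exact mono ⟨hr.1, hr.2.trans ha.2⟩ ha hr.2.le

/-- Elliptic estimate in a classically forbidden region `(0, c)`. -/
theorem forbidden_region_estimate {a b c h k : ℝ} {p q p1 q1 p2 q2 : ℝ → ℝ}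
    (ha : 0 < a) (hab : a < b) (hbc : b < c) (hh : 0 < h) (hk : 2 * c ^ 2 * h ^ 2 ≤ k * (c - b) ^ 2)
    (hp : ∀ r ∈ Ioc 0 c, HasDerivAt p (p1 r) r) (hq : ∀ r ∈ Ioc 0 c, HasDerivAt q (q1 r) r)
    (hp1 : ∀ r ∈ Ioc 0 c, HasDerivAt p1 (p2 r) r) (hq1 : ∀ r ∈ Ioc 0 c, HasDerivAt q1 (q2 r) r)
    (hp2c : ContinuousOn p2 (Ioc 0 c)) (hq2c : ContinuousOn q2 (Ioc 0 c))
    (hW : ∀ r ∈ Ioo 0 c, k / r ^ 2 * (p r ^ 2 + q r ^ 2) ≤ h ^ 2 * (p2 r * p r + q2 r * q r))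
    (ht1 : Tendsto (fun r => r ^ 2 * (p1 r * p r + q1 r * q r)) (𝓝[>] 0) (𝓝 0))
    (ht0 : Tendsto (fun r => r * (p r ^ 2 + q r ^ 2)) (𝓝[>] 0) (𝓝 0)) :
    k * (c - b) ^ 2 * ∫ r in a..b, (p r ^ 2 + q r ^ 2) ≤
      2 * c ^ 2 * h ^ 2 * ∫ r in b..c, (p r ^ 2 + q r ^ 2) := by
  have hc : 0 < c := by linarith
  have hk0 : 0 ≤ k := by
    by_contra! hneg
    have : k * (c - b) ^ 2 ≤ 0 := mul_nonpos_of_nonpos_of_nonneg hneg.le (sq_nonneg _)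
    have : 0 < 2 * c ^ 2 * h ^ 2 := by positivity
    linarith
  set Ψ : ℝ → ℝ := fun r => r ^ 2 * (c - r) ^ 2 * (p1 r * p r + q1 r * q r)
    - r * (c - r) * (c - 2 * r) * (p r ^ 2 + q r ^ 2) with hΨ
  set Ψ' : ℝ → ℝ := fun r => r ^ 2 * (c - r) ^ 2 * (p1 r ^ 2 + q1 r ^ 2 + (p2 r * p r + q2 r * q r))
    - (c ^ 2 - 6 * c * r + 6 * r ^ 2) * (p r ^ 2 + q r ^ 2) with hΨ'
  have hder : ∀ r ∈ Ioc 0 c, HasDerivAt Ψ (Ψ' r) r := by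
    intro r hr
    have dp := hp r hr
    have dq := hq r hr
    have dp1 := hp1 r hr
    have dq1 := hq1 r hr
    have did := hasDerivAt_id' r
    have A1 := ((did.pow 2).mul ((did.const_sub c).pow 2)).mul ((dp1.mul dp).add (dq1.mul dq))
    have A2 := ((did.mul (did.const_sub c)).mul ((did.const_mul 2).const_sub c)).mul
      ((dp.pow 2).add (dq.pow 2))
    refine (A1.sub A2).congr_deriv ?_
    simp only [Pi.add_apply, Pi.mul_apply, Pi.pow_apply, hΨ']
    push_cast
    ring
  have hlow : ∀ r ∈ Ioo 0 c, ((c - r) ^ 2 * k / h ^ 2 - c ^ 2) * (p r ^ 2 + q r ^ 2) ≤ Ψ' r := by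
    intro r hr
    have hr0 : 0 < r := hr.1
    have hn : 0 ≤ p r ^ 2 + q r ^ 2 := by positivity
    have h1 : (c - r) ^ 2 * k / h ^ 2 * (p r ^ 2 + q r ^ 2) ≤
        r ^ 2 * (c - r) ^ 2 * (p2 r * p r + q2 r * q r) := by
      have := mul_le_mul_of_nonneg_left (hW r hr)
        (by positivity : 0 ≤ r ^ 2 * (c - r) ^ 2 / h ^ 2)
      calc _ = r ^ 2 * (c - r) ^ 2 / h ^ 2 * (k / r ^ 2 * (p r ^ 2 + q r ^ 2)) := by field_simp
        _ ≤ _ := this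
        _ = _ := by field_simp
    have h2 : (c ^ 2 - 6 * c * r + 6 * r ^ 2) * (p r ^ 2 + q r ^ 2) ≤ c ^ 2 * (p r ^ 2 + q r ^ 2) := by
      refine mul_le_mul_of_nonneg_right ?_ hn
      nlinarith [hr.1, hr.2]
    have h3 : 0 ≤ r ^ 2 * (c - r) ^ 2 * (p1 r ^ 2 + q1 r ^ 2) := by positivity
    simp only [hΨ']
    linarith
  have hlow1 : ∀ r ∈ Ioc 0 b, k * (c - b) ^ 2 / (2 * h ^ 2) * (p r ^ 2 + q r ^ 2) ≤ Ψ' r := by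
    intro r hr
    refine le_trans (mul_le_mul_of_nonneg_right ?_ (by positivity)) (hlow r ⟨hr.1, hr.2.trans_lt hbc⟩)
    have : (c - b) ^ 2 * k / h ^ 2 ≤ (c - r) ^ 2 * k / h ^ 2 := by
      have := hr.2
      gcongr
    have h2 : c ^ 2 ≤ k * (c - b) ^ 2 / (2 * h ^ 2) := by
      rw [le_div_iff₀ (by positivity)]; linarith
    have h3 : (c - b) ^ 2 * k / h ^ 2 = k * (c - b) ^ 2 / (2 * h ^ 2) + k * (c - b) ^ 2 / (2 * h ^ 2) := by
      field_simp; ring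
    linarith
  have hΨ0 : Tendsto Ψ (𝓝[>] 0) (𝓝 0) := by
    have c1 : Tendsto (fun r : ℝ => (c - r) ^ 2) (𝓝[>] 0) (𝓝 ((c - 0) ^ 2)) :=
      ((by fun_prop : Continuous fun r : ℝ => (c - r) ^ 2).tendsto 0).mono_left nhdsWithin_le_nhds
    have c2 : Tendsto (fun r : ℝ => (c - r) * (c - 2 * r)) (𝓝[>] 0) (𝓝 ((c - 0) * (c - 2 * 0))) :=
      ((by fun_prop : Continuous fun r : ℝ => (c - r) * (c - 2 * r)).tendsto 0).mono_left
        nhdsWithin_le_nhds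
    have := (c1.mul ht1).sub (c2.mul ht0)
    simp only [mul_zero, sub_zero] at this
    refine this.congr fun r => ?_
    simp only [hΨ]; ring
  have hΨa : 0 ≤ Ψ a := nonneg_of_tendsto_zero_of_deriv_nonneg (b := b)
    (fun r hr => hder r ⟨hr.1, (hr.2.trans hbc).le⟩)
    (fun r hr => le_trans (by positivity) (hlow1 r ⟨hr.1, hr.2.le⟩)) hΨ0 ⟨ha, hab⟩
  have cp : ContinuousOn p (Ioc 0 c) := fun r hr => (hp r hr).continuousAt.continuousWithinAt
  have cq : ContinuousOn q (Ioc 0 c) := fun r hr => (hq r hr).continuousAt.continuousWithinAt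
  have cp1 : ContinuousOn p1 (Ioc 0 c) := fun r hr => (hp1 r hr).continuousAt.continuousWithinAt
  have cq1 : ContinuousOn q1 (Ioc 0 c) := fun r hr => (hq1 r hr).continuousAt.continuousWithinAt
  have cΨ' : ContinuousOn Ψ' (Ioc 0 c) := by
    rw [hΨ']; fun_prop
  have cy : ContinuousOn (fun r => p r ^ 2 + q r ^ 2) (Ioc 0 c) := by fun_prop
  have ii : ∀ {f : ℝ → ℝ} {s t : ℝ}, s ≤ t → 0 < s → t ≤ c → ContinuousOn f (Ioc 0 c) →
      IntervalIntegrable f volume s t := fun hst hs ht hf =>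
    (hf.mono (by rw [uIcc_of_le hst]; exact fun x hx => ⟨hs.trans_le hx.1, hx.2.trans ht⟩)).intervalIntegrable
  have ftc1 : ∫ r in a..b, Ψ' r = Ψ b - Ψ a :=
    intervalIntegral.integral_eq_sub_of_hasDerivAt (fun r hr => hder r (by
      rw [uIcc_of_le hab.le] at hr; exact ⟨ha.trans_le hr.1, hr.2.trans hbc.le⟩))
      (ii hab.le ha hbc.le cΨ')
  have ftc2 : ∫ r in b..c, Ψ' r = Ψ c - Ψ b :=
    intervalIntegral.integral_eq_sub_of_hasDerivAt (fun r hr => hder r (by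
      rw [uIcc_of_le hbc.le] at hr; exact ⟨(ha.trans hab).trans_le hr.1, hr.2⟩))
      (ii hbc.le (ha.trans hab) le_rfl cΨ')
  have hΨc : Ψ c = 0 := by simp [hΨ]
  have m1 := intervalIntegral.integral_mono_on (μ := volume) hab.le
    ((ii hab.le ha hbc.le cy).const_mul (k * (c - b) ^ 2 / (2 * h ^ 2))) (ii hab.le ha hbc.le cΨ')
    (fun r hr => hlow1 r ⟨ha.trans_le hr.1, hr.2⟩)
  have m2 := intervalIntegral.integral_mono_on_of_le_Ioo (μ := volume) hbc.le
    ((ii hbc.le (ha.trans hab) le_rfl cy).const_mul (-c ^ 2)) (ii hbc.le (ha.trans hab) le_rfl cΨ')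
    (fun r hr => by
      refine le_trans (mul_le_mul_of_nonneg_right ?_ (by positivity))
        (hlow r ⟨(ha.trans hab).trans hr.1, hr.2⟩)
      have : 0 ≤ (c - r) ^ 2 * k / h ^ 2 := by positivity
      linarith)
  rw [intervalIntegral.integral_const_mul] at m1 m2
  have : k * (c - b) ^ 2 / (2 * h ^ 2) * (∫ r in a..b, (p r ^ 2 + q r ^ 2)) ≤
      c ^ 2 * ∫ r in b..c, (p r ^ 2 + q r ^ 2) := by linarith
  have := mul_le_mul_of_nonneg_left this (by positivity : 0 ≤ 2 * h ^ 2)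
  calc _ = 2 * h ^ 2 * (k * (c - b) ^ 2 / (2 * h ^ 2) * (∫ r in a..b, (p r ^ 2 + q r ^ 2))) := by
        field_simp
    _ ≤ _ := this
    _ = _ := by ring

theorem exists_radial_weight {s a b : ℝ} (hs1 : 1 / 2 < s) (hs2 : s ≤ 1) (ha : 0 < a) (hab : a < b) :
    ∃ κ > 0, ∃ Kw > 0, ∃ w w1 : ℝ → ℝ, (∀ r, a ≤ r → HasDerivAt w (w1 r) r) ∧
      ContinuousOn w1 (Ici a) ∧ w a = 0 ∧ (∀ r, a ≤ r → 0 ≤ w r) ∧ (∀ r, a ≤ r → w r ≤ 2) ∧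
      (∀ r, a ≤ r → κ * r ^ (-(2 * s)) ≤ w1 r) ∧ (∀ r, a ≤ r → w1 r ≤ Kw) ∧
      ∀ r, b ≤ r → w1 r * r ≤ 2 * w r := by
  set e := 2 * s - 1 with he
  have he0 : 0 < e := by linarith
  have he1 : e ≤ 1 := by linarith
  have hb : 0 < b := ha.trans hab
  set t := a / b with ht
  have ht0 : 0 < t := by positivity
  have ht1 : t < 1 := by rw [ht, div_lt_one hb]; exact hab
  obtain ⟨N, hN⟩ : ∃ N : ℕ, ((N : ℝ) + 2) * t ^ N ≤ 1 := by
    have h1 := tendsto_self_mul_const_pow_of_lt_one ht0.le ht1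
    have h2 := (tendsto_pow_atTop_nhds_zero_of_lt_one ht0.le ht1).const_mul 2
    have h3 := h1.add h2
    simp only [mul_zero, add_zero] at h3
    obtain ⟨N, hN⟩ := (h3.eventually (gt_mem_nhds zero_lt_one)).exists
    exact ⟨N, by linarith⟩
  have hx0 : ∀ r, a ≤ r → 0 < a / r := fun r hr => div_pos ha (ha.trans_le hr)
  have hx1 : ∀ r, a ≤ r → a / r ≤ 1 := fun r hr => (div_le_one (ha.trans_le hr)).2 hr
  have hN1 : ∀ r, a ≤ r → (a / r) ^ N ≤ 1 := fun r hr => pow_le_one₀ (hx0 r hr).le (hx1 r hr)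
  have hp1 : ∀ r, a ≤ r → (a / r) ^ e ≤ 1 := fun r hr =>
    Real.rpow_le_one (hx0 r hr).le (hx1 r hr) he0.le
  have hp0 : ∀ r, a ≤ r → 0 < (a / r) ^ e := fun r hr => Real.rpow_pos_of_pos (hx0 r hr) e
  refine ⟨e * a ^ e, by positivity, (N + e) / a, by positivity,
    fun r => 2 - (a / r) ^ N - (a / r) ^ e,
    fun r => (N * (a / r) ^ N + e * (a / r) ^ e) / r, ?_, ?_, ?_, ?_, ?_, ?_, ?_, ?_⟩
  · intro r hr
    have hr0 : 0 < r := ha.trans_le hr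
    have hx := hx0 r hr
    have d : HasDerivAt (fun r : ℝ => a / r) (-(a / r) / r) r := by
      refine ((hasDerivAt_const r a).div (hasDerivAt_id' r) hr0.ne').congr_deriv ?_
      field_simp; ring
    refine (((d.pow N).const_sub 2).sub (d.rpow_const (p := e) (Or.inl hx.ne'))).congr_deriv ?_
    rw [Real.rpow_sub_one hx.ne']
    rcases N with _ | N
    · simp; field_simp
    · simp only [Nat.add_sub_cancel, pow_succ]
      field_simp
      ring
  · have : ContinuousOn (fun r : ℝ => a / r) (Ici a) :=
      continuousOn_const.div continuousOn_id fun r hr => (ha.trans_le hr).ne'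
    refine ContinuousOn.div (((this.pow N).const_smul (N : ℝ)).add
      ((this.rpow_const fun r hr => Or.inl (hx0 r hr).ne').const_smul e)) continuousOn_id
      fun r hr => (ha.trans_le hr).ne'
  · simp [div_self ha.ne']; norm_num
  · intro r hr
    linarith [hN1 r hr, hp1 r hr]
  · intro r hr
    linarith [pow_nonneg (hx0 r hr).le N, hp0 r hr]
  · intro r hr
    have hr0 : 0 < r := ha.trans_le hr
    have : e * a ^ e * r ^ (-(2 * s)) = e * (a / r) ^ e / r := by
      rw [Real.div_rpow ha.le hr0.le, show -(2 * s) = -e - 1 by ring, Real.rpow_sub_one hr0.ne',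
        Real.rpow_neg hr0.le]
      field_simp
    rw [this]
    beta_reduce
    gcongr
    have := pow_nonneg (hx0 r hr).le N
    have : 0 ≤ (N : ℝ) * (a / r) ^ N := by positivity
    linarith
  · intro r hr
    have hr0 : 0 < r := ha.trans_le hr
    have h1 := hN1 r hr
    have h2 := hp1 r hr
    have h3 := hp0 r hr
    beta_reduce
    calc _ ≤ ((N : ℝ) * 1 + e * 1) / a := by gcongr
      _ = _ := by ring
  · intro r hr
    have hra : a ≤ r := hab.le.trans hr
    have hr0 : 0 < r := ha.trans_le hra
    rw [div_mul_cancel₀ _ hr0.ne']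
    have h1 : ((N : ℝ) + 2) * (a / r) ^ N ≤ 1 := by
      refine le_trans ?_ hN
      have := (hx0 r hra).le
      rw [ht]
      gcongr
    have h2 := hp1 r hra
    have h3 := hp0 r hra
    nlinarith

/-- A solution pair `(p, q)` (real and imaginary part) of the radial equation
`-h² y'' + (V + m r⁻² - E - iε) y = 0` on `(0, R)`, vanishing to second order at `T` and regular
at the origin. -/
structure IsRadialMode (V : ℝ → ℝ) (R T h ε E m : ℝ) (p q p1 q1 p2 q2 : ℝ → ℝ) : Prop where
  hp : ∀ r, 0 < r → HasDerivAt p (p1 r) r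
  hq : ∀ r, 0 < r → HasDerivAt q (q1 r) r
  hp1 : ∀ r, 0 < r → HasDerivAt p1 (p2 r) r
  hq1 : ∀ r, 0 < r → HasDerivAt q1 (q2 r) r
  hp2 : ContinuousOn p2 (Ioi 0)
  hq2 : ContinuousOn q2 (Ioi 0)
  pT : p T = 0
  qT : q T = 0
  p1T : p1 T = 0
  q1T : q1 T = 0
  flux : Tendsto (fun r => q1 r * p r - p1 r * q r) (𝓝[>] 0) (𝓝 0)
  t1 : Tendsto (fun r => r ^ 2 * (p1 r * p r + q1 r * q r)) (𝓝[>] 0) (𝓝 0)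
  t0 : Tendsto (fun r => r * (p r ^ 2 + q r ^ 2)) (𝓝[>] 0) (𝓝 0)
  eqp : ∀ᵐ r ∂(volume : Measure ℝ), 0 < r → r < R →
    h ^ 2 * p2 r = (V r + m / r ^ 2 - E) * p r + ε * q r
  eqq : ∀ᵐ r ∂(volume : Measure ℝ), 0 < r → r < R →
    h ^ 2 * q2 r = (V r + m / r ^ 2 - E) * q r - ε * p r

/-- Real part of the free radial operator applied to `p + iq`; the imaginary part is obtained by
exchanging `p` and `q` and the sign of `ε`. -/
noncomputable def radialSource (h ε E m : ℝ) (p q p2 : ℝ → ℝ) (r : ℝ) : ℝ :=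
  -h ^ 2 * p2 r + (m / r ^ 2 - E) * p r + ε * q r

namespace IsRadialMode

variable {V : ℝ → ℝ} {R T h ε E m : ℝ} {p q p1 q1 p2 q2 : ℝ → ℝ}

theorem cp (H : IsRadialMode V R T h ε E m p q p1 q1 p2 q2) : ContinuousOn p (Ioi 0) :=
  fun r hr => (H.hp r hr).continuousAt.continuousWithinAt

theorem cq (H : IsRadialMode V R T h ε E m p q p1 q1 p2 q2) : ContinuousOn q (Ioi 0) :=
  fun r hr => (H.hq r hr).continuousAt.continuousWithinAt

theorem cp1 (H : IsRadialMode V R T h ε E m p q p1 q1 p2 q2) : ContinuousOn p1 (Ioi 0) :=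
  fun r hr => (H.hp1 r hr).continuousAt.continuousWithinAt

theorem cq1 (H : IsRadialMode V R T h ε E m p q p1 q1 p2 q2) : ContinuousOn q1 (Ioi 0) :=
  fun r hr => (H.hq1 r hr).continuousAt.continuousWithinAt

theorem continuousOn_source_re (H : IsRadialMode V R T h ε E m p q p1 q1 p2 q2) :
    ContinuousOn (radialSource h ε E m p q p2) (Ioi 0) := by
  have hd : ContinuousOn (fun r : ℝ => m / r ^ 2) (Ioi 0) :=
    continuousOn_const.div (continuousOn_id.pow 2) fun r hr => pow_ne_zero 2 (ne_of_gt hr)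
  exact ((H.hp2.const_mul _).add ((hd.sub continuousOn_const).mul H.cp)).add (H.cq.const_mul _)

theorem continuousOn_source_im (H : IsRadialMode V R T h ε E m p q p1 q1 p2 q2) :
    ContinuousOn (radialSource h (-ε) E m q p q2) (Ioi 0) := by
  have hd : ContinuousOn (fun r : ℝ => m / r ^ 2) (Ioi 0) :=
    continuousOn_const.div (continuousOn_id.pow 2) fun r hr => pow_ne_zero 2 (ne_of_gt hr)
  exact ((H.hq2.const_mul _).add ((hd.sub continuousOn_const).mul H.cq)).add (H.cp.const_mul _)

theorem source_eq_zero (H : IsRadialMode V R T h ε E m p q p1 q1 p2 q2) {a : ℝ} (ha : 0 < a)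
    (hV : ∀ᵐ r ∂(volume : Measure ℝ), 0 < r → a < r → V r = 0) :
    ∀ r ∈ Ioo a R, radialSource h ε E m p q p2 r = 0 ∧ radialSource h (-ε) E m q p q2 r = 0 := by
  have hsub : Ioo a R ⊆ Ioi 0 := fun r hr => ha.trans hr.1
  have key : ∀ f : ℝ → ℝ, ContinuousOn f (Ioi 0) →
      (∀ᵐ r ∂(volume : Measure ℝ), r ∈ Ioo a R → f r = 0) → ∀ r ∈ Ioo a R, f r = 0 := by
    intro f hf h0 r hr
    refine le_antisymm ?_ ?_
    · have := nonneg_of_ae_nonneg_of_continuousOn (hf.mono hsub).neg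
        (h0.mono fun r h hr => by simp [h hr]) r hr
      simpa using this
    · exact nonneg_of_ae_nonneg_of_continuousOn (hf.mono hsub)
        (h0.mono fun r h hr => by simp [h hr]) r hr
  intro r hr
  refine ⟨key _ H.continuousOn_source_re ?_ r hr, key _ H.continuousOn_source_im ?_ r hr⟩
  · filter_upwards [H.eqp, hV] with r h1 h2 hr
    have := h1 (ha.trans hr.1) hr.2
    rw [h2 (ha.trans hr.1) hr.1] at this
    simp only [radialSource]
    linarith
  · filter_upwards [H.eqq, hV] with r h1 h2 hr
    have := h1 (ha.trans hr.1) hr.2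
    rw [h2 (ha.trans hr.1) hr.1] at this
    simp only [radialSource]
    linarith

theorem flux_nonpos (H : IsRadialMode V R T h ε E m p q p1 q1 p2 q2) (hh : 0 < h) (hε : 0 < ε)
    {a : ℝ} (ha : a ∈ Ioo 0 R) : q1 a * p a - p1 a * q a ≤ 0 := by
  have hsub : Ioo 0 R ⊆ Ioi 0 := fun r hr => hr.1
  have h1 : ∀ r ∈ Ioo 0 R, HasDerivAt (fun r => p1 r * q r - q1 r * p r)
      (p2 r * q r - q2 r * p r) r := fun r hr => by
    refine (((H.hp1 r hr.1).mul (H.hq r hr.1)).sub ((H.hq1 r hr.1).mul (H.hp r hr.1))).congr_deriv ?_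
    ring
  have h2 : ∀ r ∈ Ioo 0 R, 0 ≤ p2 r * q r - q2 r * p r := by
    refine nonneg_of_ae_nonneg_of_continuousOn
      (((H.hp2.mul H.cq).sub (H.hq2.mul H.cp)).mono hsub) ?_
    filter_upwards [H.eqp, H.eqq] with r e1 e2 hr
    have e1 := e1 hr.1 hr.2
    have e2 := e2 hr.1 hr.2
    have : h ^ 2 * (p2 r * q r - q2 r * p r) = ε * (p r ^ 2 + q r ^ 2) := by
      linear_combination q r * e1 - p r * e2
    have h3 : 0 ≤ h ^ 2 * (p2 r * q r - q2 r * p r) := by rw [this]; positivity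
    exact nonneg_of_mul_nonneg_right h3 (by positivity)
  have h3 := nonneg_of_tendsto_zero_of_deriv_nonneg h1 h2
    (by simpa using H.flux.neg) ha
  linarith

/-- The estimate for `ε ≥ 1` coming from the imaginary part of the equation. -/
theorem integral_le_of_one_le (H : IsRadialMode V R T h ε E m p q p1 q1 p2 q2) (hh : 0 < h)
    (hε : 1 ≤ ε) {a : ℝ} (ha : a ∈ Ioo 0 R) (hRT : R ≤ T) :
    ∫ r in a..T, (p r ^ 2 + q r ^ 2) ≤ ∫ r in a..T,
      (radialSource h ε E m p q p2 r ^ 2 + radialSource h (-ε) E m q p q2 r ^ 2) := by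
  have haT : a ≤ T := ha.2.le.trans hRT
  have hsub : uIcc a T ⊆ Ioi 0 := by
    rw [uIcc_of_le haT]; exact fun r hr => ha.1.trans_le hr.1
  have hflux := H.flux_nonpos hh (by linarith) ha
  have cP := H.continuousOn_source_re.mono hsub
  have cQ := H.continuousOn_source_im.mono hsub
  have cp := H.cp.mono hsub
  have cq := H.cq.mono hsub
  have cp2 := H.hp2.mono hsub
  have cq2 := H.hq2.mono hsub
  have e1 : ∫ r in a..T, (q2 r * p r - p2 r * q r) =
      (q1 T * p T - p1 T * q T) - (q1 a * p a - p1 a * q a) := by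
    refine intervalIntegral.integral_eq_sub_of_hasDerivAt
      (f := fun r => q1 r * p r - p1 r * q r) (fun r hr => ?_)
      (((cq2.mul cp).sub (cp2.mul cq)).intervalIntegrable)
    refine (((H.hq1 r (hsub hr)).mul (H.hp r (hsub hr))).sub
      ((H.hp1 r (hsub hr)).mul (H.hq r (hsub hr)))).congr_deriv ?_
    ring
  rw [H.pT, H.qT] at e1
  have e2 : 0 ≤ ∫ r in a..T, h ^ 2 * (q2 r * p r - p2 r * q r) := by
    rw [intervalIntegral.integral_const_mul, e1]
    have : 0 < h ^ 2 := by positivity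
    nlinarith
  have i1 : IntervalIntegrable (fun r => p r ^ 2 + q r ^ 2) volume a T :=
    ((cp.pow 2).add (cq.pow 2)).intervalIntegrable
  have i2 : IntervalIntegrable (fun r => h ^ 2 * (q2 r * p r - p2 r * q r)) volume a T :=
    (((cq2.mul cp).sub (cp2.mul cq)).const_mul _).intervalIntegrable
  have i3 : IntervalIntegrable (fun r => radialSource h ε E m p q p2 r ^ 2 +
      radialSource h (-ε) E m q p q2 r ^ 2) volume a T :=
    ((cP.pow 2).add (cQ.pow 2)).intervalIntegrable
  have e3 : ∫ r in a..T, (2 * (h ^ 2 * (q2 r * p r - p2 r * q r)) + (p r ^ 2 + q r ^ 2)) ≤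
      ∫ r in a..T, (radialSource h ε E m p q p2 r ^ 2 + radialSource h (-ε) E m q p q2 r ^ 2) := by
    refine intervalIntegral.integral_mono_on haT ((i2.const_mul 2).add i1) i3 fun r hr => ?_
    have : radialSource h ε E m p q p2 r * q r - radialSource h (-ε) E m q p q2 r * p r =
        h ^ 2 * (q2 r * p r - p2 r * q r) + ε * (p r ^ 2 + q r ^ 2) := by
      simp only [radialSource]; ring
    have h4 : p r ^ 2 + q r ^ 2 ≤ ε * (p r ^ 2 + q r ^ 2) :=
      le_mul_of_one_le_left (by positivity) hε
    linarith [sq_nonneg (radialSource h ε E m p q p2 r - q r),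
      sq_nonneg (radialSource h (-ε) E m q p q2 r + p r)]
  rw [intervalIntegral.integral_add (i2.const_mul 2) i1, intervalIntegral.integral_const_mul] at e3
  linarith

theorem integral_source_eq (H : IsRadialMode V R T h ε E m p q p1 q1 p2 q2) {a : ℝ}
    (ha : a ∈ Ioo 0 R) (hRT : R ≤ T) (hV : ∀ᵐ r ∂(volume : Measure ℝ), 0 < r → a < r → V r = 0)
    {g : ℝ → ℝ} (hg : ContinuousOn g (Ioi 0)) :
    ∫ r in a..T, g r *
      (radialSource h ε E m p q p2 r ^ 2 + radialSource h (-ε) E m q p q2 r ^ 2) =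
    ∫ r in R..T, g r *
      (radialSource h ε E m p q p2 r ^ 2 + radialSource h (-ε) E m q p q2 r ^ 2) := by
  have hc : ContinuousOn (fun r => g r *
      (radialSource h ε E m p q p2 r ^ 2 + radialSource h (-ε) E m q p q2 r ^ 2)) (Ioi 0) :=
    hg.mul ((H.continuousOn_source_re.pow 2).add (H.continuousOn_source_im.pow 2))
  rw [← intervalIntegral.integral_add_adjacent_intervals (b := R)
    (hc.mono ?_).intervalIntegrable (hc.mono ?_).intervalIntegrable]
  · rw [intervalIntegral.integral_of_le ha.2.le, integral_Ioc_eq_integral_Ioo,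
      setIntegral_eq_zero_of_forall_eq_zero, zero_add]
    intro r hr
    obtain ⟨h1, h2⟩ := H.source_eq_zero ha.1 hV r hr
    simp [h1, h2]
  · rw [uIcc_of_le ha.2.le]; exact fun r hr => ha.1.trans_le hr.1
  · rw [uIcc_of_le hRT]; exact fun r hr => (ha.1.trans ha.2).trans_le hr.1

theorem weighted_le_of_one_le (H : IsRadialMode V R T h ε E m p q p1 q1 p2 q2) (hh : 0 < h)
    (hε : 1 ≤ ε) {a s : ℝ} (hs : 0 ≤ s) (ha : a ∈ Ioo 0 R) (hRT : R ≤ T)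
    (hV : ∀ᵐ r ∂(volume : Measure ℝ), 0 < r → a < r → V r = 0) :
    ∫ r in R..T, r ^ (-(2 * s)) * (p r ^ 2 + q r ^ 2) ≤
      (R ^ (-(2 * s))) ^ 2 * ∫ r in R..T, r ^ (2 * s) *
        (radialSource h ε E m p q p2 r ^ 2 + radialSource h (-ε) E m q p q2 r ^ 2) := by
  have hR : 0 < R := ha.1.trans ha.2
  have hsub : uIcc R T ⊆ Ioi 0 := by
    rw [uIcc_of_le hRT]; exact fun r hr => hR.trans_le hr.1
  have hsub' : uIcc a R ⊆ Ioi 0 := by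
    rw [uIcc_of_le ha.2.le]; exact fun r hr => ha.1.trans_le hr.1
  have cw : ∀ t : ℝ, ContinuousOn (fun r : ℝ => r ^ t) (Ioi 0) := fun t =>
    ContinuousOn.rpow_const continuousOn_id fun r hr => Or.inl (ne_of_gt hr)
  have cy : ContinuousOn (fun r => p r ^ 2 + q r ^ 2) (Ioi 0) := (H.cp.pow 2).add (H.cq.pow 2)
  have cG := (H.continuousOn_source_re.pow 2).add (H.continuousOn_source_im.pow 2)
  have h1 := H.integral_le_of_one_le hh hε ha hRT
  have h2 := H.integral_source_eq ha hRT hV (g := fun _ => 1) continuousOn_const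
  simp only [one_mul] at h2
  rw [h2] at h1
  have h3 : ∫ r in R..T, (p r ^ 2 + q r ^ 2) ≤ ∫ r in a..T, (p r ^ 2 + q r ^ 2) := by
    rw [← intervalIntegral.integral_add_adjacent_intervals (b := R)
      (cy.mono hsub').intervalIntegrable (cy.mono hsub).intervalIntegrable]
    have : 0 ≤ ∫ r in a..R, (p r ^ 2 + q r ^ 2) :=
      intervalIntegral.integral_nonneg ha.2.le fun r _ => by positivity
    linarith
  have hRp : 0 < R ^ (-(2 * s)) := Real.rpow_pos_of_pos hR _
  have h4 : ∫ r in R..T, r ^ (-(2 * s)) * (p r ^ 2 + q r ^ 2) ≤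
      ∫ r in R..T, R ^ (-(2 * s)) * (p r ^ 2 + q r ^ 2) := by
    refine intervalIntegral.integral_mono_on hRT (((cw _).mul cy).mono hsub).intervalIntegrable
      ((cy.const_mul _).mono hsub).intervalIntegrable fun r hr => ?_
    exact mul_le_mul_of_nonneg_right (Real.rpow_le_rpow_of_nonpos hR hr.1 (by linarith))
      (by positivity)
  have h5 : ∫ r in R..T, (radialSource h ε E m p q p2 r ^ 2 + radialSource h (-ε) E m q p q2 r ^ 2) ≤
      ∫ r in R..T, R ^ (-(2 * s)) * (r ^ (2 * s) *
        (radialSource h ε E m p q p2 r ^ 2 + radialSource h (-ε) E m q p q2 r ^ 2)) := by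
    refine intervalIntegral.integral_mono_on hRT (cG.mono hsub).intervalIntegrable
      ((((cw _).mul cG).const_mul _).mono hsub).intervalIntegrable fun r hr => ?_
    rw [← mul_assoc]
    refine le_mul_of_one_le_left (by positivity) ?_
    calc (1 : ℝ) = R ^ (-(2 * s)) * R ^ (2 * s) := by rw [← Real.rpow_add hR]; simp
      _ ≤ R ^ (-(2 * s)) * r ^ (2 * s) := by
        gcongr
        exact hr.1
  rw [intervalIntegral.integral_const_mul] at h4 h5
  calc _ ≤ _ := h4
    _ ≤ R ^ (-(2 * s)) * (R ^ (-(2 * s)) * ∫ r in R..T, r ^ (2 * s) *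
        (radialSource h ε E m p q p2 r ^ 2 + radialSource h (-ε) E m q p q2 r ^ 2)) := by
      gcongr
      linarith
    _ = _ := by ring

theorem weighted_le_of_le_one (H : IsRadialMode V R T h ε E m p q p1 q1 p2 q2) (hh : 0 < h)
    (hh1 : h ≤ 1) (hε0 : 0 < ε) (hε : ε ≤ 1) {a s κ Kw B : ℝ} {w w1 : ℝ → ℝ}
    (ha : a ∈ Ioo 0 R) (hRT : R ≤ T)
    (hV : ∀ᵐ r ∂(volume : Measure ℝ), 0 < r → a < r → V r = 0)
    (hκ : 0 < κ) (hB0 : 0 ≤ B) (hB : ∀ r, a ≤ r → E - m / r ^ 2 ≤ B)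
    (hw : ∀ r, a ≤ r → HasDerivAt w (w1 r) r) (hw1c : ContinuousOn w1 (Ici a)) (hwa : w a = 0)
    (hw0 : ∀ r, a ≤ r → 0 ≤ w r) (hw2 : ∀ r, a ≤ r → w r ≤ 2)
    (hw1 : ∀ r, a ≤ r → κ * r ^ (-(2 * s)) ≤ w1 r) (hw1K : ∀ r, a ≤ r → w1 r ≤ Kw)
    (hDz : κ * ∫ r in a..T, r ^ (-(2 * s)) * (p r ^ 2 + q r ^ 2) ≤
      ∫ r in a..T, (w1 r * (E - m / r ^ 2) + 2 * w r * m / r ^ 3) * (p r ^ 2 + q r ^ 2)) :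
    ∫ r in R..T, r ^ (-(2 * s)) * (p r ^ 2 + q r ^ 2) ≤
      8 * (20 + (8 * B + 4 * Kw ^ 2 + 1) ^ 2) / (h ^ 2 * κ ^ 2) * ∫ r in R..T, r ^ (2 * s) *
        (radialSource h ε E m p q p2 r ^ 2 + radialSource h (-ε) E m q p q2 r ^ 2) := by
  have haT : a ≤ T := ha.2.le.trans hRT
  have hsub : Icc a T ⊆ Ioi 0 := fun r hr => ha.1.trans_le hr.1
  have cw : ∀ t : ℝ, ContinuousOn (fun r : ℝ => r ^ t) (Ioi 0) := fun t =>
    ContinuousOn.rpow_const continuousOn_id fun r hr => Or.inl (ne_of_gt hr)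
  have cy : ContinuousOn (fun r => r ^ (-(2 * s)) * (p r ^ 2 + q r ^ 2)) (Ioi 0) :=
    (cw _).mul ((H.cp.pow 2).add (H.cq.pow 2))
  have key := energy_estimate (a := a) (T := T) (h := h) (ε := ε) (E := E) (B := B) (m := m)
    (κ := κ) (Kw := Kw) (w := w) (w1 := w1) (z := fun r => r ^ (-(2 * s)))
    (D := fun r => w1 r * (E - m / r ^ 2) + 2 * w r * m / r ^ 3)
    (P := radialSource h ε E m p q p2) (Q := radialSource h (-ε) E m q p q2)
    ha.1 haT hh hh1 hε0 hε hκ hB0 (fun r hr => hB r hr.1) (fun r hr => hw r hr.1)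
    (hw1c.mono fun r hr => hr.1) ((cw _).mono hsub) hwa (fun r hr => hw0 r hr.1)
    (fun r hr => hw2 r hr.1) (fun r hr => Real.rpow_pos_of_pos (hsub hr) _)
    (fun r hr => hw1 r hr.1) (fun r hr => hw1K r hr.1)
    (fun r hr => H.hp r (hsub hr)) (fun r hr => H.hq r (hsub hr))
    (fun r hr => H.hp1 r (hsub hr)) (fun r hr => H.hq1 r (hsub hr))
    (H.hp2.mono hsub) (H.hq2.mono hsub)
    (H.continuousOn_source_re.mono hsub) (H.continuousOn_source_im.mono hsub)
    (fun r _ => by simp only [radialSource]; ring) (fun r _ => by simp only [radialSource]; ring)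
    (fun _ => rfl) hDz H.pT H.qT H.p1T H.q1T (H.flux_nonpos hh hε0 ha)
  have e1 : ∫ r in a..T, (r ^ (-(2 * s)))⁻¹ *
      (radialSource h ε E m p q p2 r ^ 2 + radialSource h (-ε) E m q p q2 r ^ 2) =
      ∫ r in a..T, r ^ (2 * s) *
      (radialSource h ε E m p q p2 r ^ 2 + radialSource h (-ε) E m q p q2 r ^ 2) := by
    refine intervalIntegral.integral_congr fun r hr => ?_
    rw [uIcc_of_le haT] at hr
    have : (0 : ℝ) < r := hsub hr
    rw [Real.rpow_neg this.le, inv_inv]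
  rw [e1, H.integral_source_eq ha hRT hV (cw _)] at key
  refine le_trans ?_ key
  rw [← intervalIntegral.integral_add_adjacent_intervals (a := a) (b := R) (c := T)
      (cy.mono ?_).intervalIntegrable (cy.mono ?_).intervalIntegrable]
  · have : 0 ≤ ∫ r in a..R, r ^ (-(2 * s)) * (p r ^ 2 + q r ^ 2) :=
      intervalIntegral.integral_nonneg ha.2.le fun r hr => by
        have := Real.rpow_nonneg (ha.1.le.trans hr.1) (-(2 * s))
        positivity
    linarith
  · rw [uIcc_of_le ha.2.le]; exact fun r hr => ha.1.trans_le hr.1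
  · rw [uIcc_of_le hRT]; exact fun r hr => (ha.1.trans ha.2).trans_le hr.1

end IsRadialMode

namespace IsRadialMode

/-- Exterior estimate for modes whose turning point lies inside the ball of radius `Rm < R`. -/
theorem exists_bound_of_le {Rm R Emin Emax s : ℝ} (hRm : 0 < Rm) (hRmR : Rm < R)
    (hEmin : 0 < Emin) (hE : Emin ≤ Emax) (hs1 : 1 / 2 < s) (hs2 : s ≤ 1) :
    ∃ C > 0, ∃ h₀ > 0, ∀ (V : ℝ → ℝ) (T h ε E m : ℝ) (p q p1 q1 p2 q2 : ℝ → ℝ),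
      IsRadialMode V R T h ε E m p q p1 q1 p2 q2 → h ∈ Ioc 0 h₀ → ε ∈ Ioc 0 1 →
      E ∈ Icc Emin Emax → -h ^ 2 / 4 ≤ m → m ≤ E * Rm ^ 2 → R ≤ T →
      (∀ᵐ r ∂(volume : Measure ℝ), 0 < r → Rm < r → V r = 0) →
      ∫ r in R..T, r ^ (-(2 * s)) * (p r ^ 2 + q r ^ 2) ≤
        C / h ^ 2 * ∫ r in R..T, r ^ (2 * s) *
        (radialSource h ε E m p q p2 r ^ 2 + radialSource h (-ε) E m q p q2 r ^ 2) := by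
  set a := (Rm + R) / 2 with ha
  have haRm : Rm < a := by linarith
  have haR : a < R := by linarith
  have ha0 : 0 < a := by linarith
  obtain ⟨κ, hκ, Kw, hKw, w, w1, hw, hw1c, hwa, hw0, hw2, hw1, hw1K, -⟩ :=
    exists_radial_weight hs1 hs2 ha0 haR
  set c := 1 - Rm ^ 2 / a ^ 2 with hc
  have hc0 : 0 < c := by
    rw [hc, sub_pos, div_lt_one (by positivity)]
    gcongr
  set κ' := min κ (κ * c * Emin / 2) with hκ'
  have hκ'0 : 0 < κ' := by positivity
  have hκ'1 : κ' ≤ κ := min_le_left _ _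
  have hκ'2 : κ' ≤ κ * c * Emin / 2 := min_le_right _ _
  have hap : 0 < a ^ (2 * s - 3) := Real.rpow_pos_of_pos ha0 _
  set h₀ := min (min 1 a) (κ' / a ^ (2 * s - 3)) with hh₀
  refine ⟨8 * (20 + (8 * (Emax + 1) + 4 * Kw ^ 2 + 1) ^ 2) / κ' ^ 2, by positivity, h₀,
    by positivity, ?_⟩
  intro V T h ε E m p q p1 q1 p2 q2 H hh hε hEE hm hm2 hRT hV
  have hh1 : h ≤ 1 := hh.2.trans ((min_le_left _ _).trans (min_le_left _ _))
  have hha : h ≤ a := hh.2.trans ((min_le_left _ _).trans (min_le_right _ _))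
  have hh2 : h ^ 2 * a ^ (2 * s - 3) ≤ κ' := by
    rw [← le_div_iff₀ hap]
    calc h ^ 2 ≤ h := by nlinarith [hh.1]
      _ ≤ _ := hh.2.trans (min_le_right _ _)
  have hE0 : 0 < E := hEmin.trans_le hEE.1
  have hD : ∀ r, a ≤ r → κ' * r ^ (-(2 * s)) ≤
      w1 r * (E - m / r ^ 2) + 2 * w r * m / r ^ 3 := by
    intro r hr
    have hr0 : 0 < r := ha0.trans_le hr
    have hz : 0 < r ^ (-(2 * s)) := Real.rpow_pos_of_pos hr0 _
    have h1 : c * E ≤ E - m / r ^ 2 := by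
      have : m / r ^ 2 ≤ E * (Rm ^ 2 / a ^ 2) := by
        calc m / r ^ 2 ≤ E * Rm ^ 2 / r ^ 2 := by gcongr
          _ ≤ E * Rm ^ 2 / a ^ 2 := by gcongr
          _ = _ := by ring
      rw [hc]; linarith
    have h2 : κ * r ^ (-(2 * s)) * (c * Emin) ≤ w1 r * (E - m / r ^ 2) := by
      refine mul_le_mul (hw1 r hr) (le_trans ?_ h1) (by positivity)
        (le_trans (by positivity) (hw1 r hr))
      exact mul_le_mul_of_nonneg_left hEE.1 hc0.le
    have h3 : -(h ^ 2 * a ^ (2 * s - 3)) * r ^ (-(2 * s)) ≤ 2 * w r * m / r ^ 3 := by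
      have e1 : (1 : ℝ) / r ^ 3 = r ^ (2 * s - 3) * r ^ (-(2 * s)) := by
        rw [← Real.rpow_add hr0, show 2 * s - 3 + -(2 * s) = -(3 : ℝ) by ring,
          Real.rpow_neg hr0.le, one_div]
        norm_cast
      have e2 : r ^ (2 * s - 3) ≤ a ^ (2 * s - 3) :=
        Real.rpow_le_rpow_of_nonpos ha0 hr (by linarith)
      have e3 : -h ^ 2 ≤ 2 * w r * m := by nlinarith [hw0 r hr, hw2 r hr, sq_nonneg h]
      calc -(h ^ 2 * a ^ (2 * s - 3)) * r ^ (-(2 * s)) =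
          -(h ^ 2 * (a ^ (2 * s - 3) * r ^ (-(2 * s)))) := by ring
        _ ≤ -(h ^ 2 * (r ^ (2 * s - 3) * r ^ (-(2 * s)))) := by gcongr
        _ = -h ^ 2 * (1 / r ^ 3) := by rw [e1]; ring
        _ ≤ 2 * w r * m * (1 / r ^ 3) := by gcongr
        _ = _ := by ring
    have h4 : h ^ 2 * a ^ (2 * s - 3) * r ^ (-(2 * s)) ≤ κ' * r ^ (-(2 * s)) := by gcongr
    have h5 : κ' * r ^ (-(2 * s)) ≤ κ * c * Emin / 2 * r ^ (-(2 * s)) := by gcongr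
    linarith
  have hsub : uIcc a T ⊆ Ioi 0 := by
    rw [uIcc_of_le (haR.le.trans hRT)]; exact fun r hr => ha0.trans_le hr.1
  have hsub2 : uIcc a T ⊆ Ici a := by
    rw [uIcc_of_le (haR.le.trans hRT)]; exact fun r hr => hr.1
  have cw : ContinuousOn (fun r : ℝ => r ^ (-(2 * s))) (Ioi 0) :=
    ContinuousOn.rpow_const continuousOn_id fun r hr => Or.inl (ne_of_gt hr)
  have cy : ContinuousOn (fun r => p r ^ 2 + q r ^ 2) (Ioi 0) := (H.cp.pow 2).add (H.cq.pow 2)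
  have cW : ContinuousOn w (Ici a) := fun r hr => (hw r hr).continuousAt.continuousWithinAt
  have cD : ContinuousOn (fun r => w1 r * (E - m / r ^ 2) + 2 * w r * m / r ^ 3) (Ici a) := by
    refine (hw1c.mul (continuousOn_const.sub (continuousOn_const.div (continuousOn_id.pow 2) ?_))).add
      (((continuousOn_const.mul cW).mul continuousOn_const).div (continuousOn_id.pow 3) ?_)
    · exact fun r hr => pow_ne_zero 2 (ha0.trans_le hr).ne'
    · exact fun r hr => pow_ne_zero 3 (ha0.trans_le hr).ne'
  have key := H.weighted_le_of_le_one (s := s) (B := Emax + 1) (Kw := Kw) (κ := κ' ) (w := w)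
    (w1 := w1) hh.1 hh1 hε.1 hε.2 ⟨ha0, haR⟩ hRT
    (hV.mono fun r h1 h2 h3 => h1 h2 (haRm.trans h3)) hκ'0 (by linarith)
    (fun r hr => ?_) hw hw1c hwa hw0 hw2 (fun r hr => ?_) hw1K ?_
  · refine key.trans_eq ?_
    congr 1
    field_simp
  · have : -1 ≤ m / r ^ 2 := by
      have hr0 : 0 < r := ha0.trans_le hr
      rw [le_div_iff₀ (by positivity)]
      have : h ^ 2 ≤ r ^ 2 := by
        have := hh.1
        gcongr
        linarith
      nlinarith [sq_nonneg h]
    linarith [hEE.2]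
  · have : 0 < r ^ (-(2 * s)) := Real.rpow_pos_of_pos (ha0.trans_le hr) _
    exact le_trans (by gcongr) (hw1 r hr)
  · rw [← intervalIntegral.integral_const_mul]
    refine intervalIntegral.integral_mono_on (haR.le.trans hRT)
      (((cw.mul cy).const_mul _).mono hsub).intervalIntegrable
      ((cD.mono hsub2).mul (cy.mono hsub)).intervalIntegrable fun r hr => ?_
    rw [← mul_assoc]
    exact mul_le_mul_of_nonneg_right (hD r hr.1) (by positivity)

/-- Exterior estimate for modes whose forbidden region reaches beyond `c`. -/
theorem exists_bound_of_ge {a b c Rm R Emin Emax s : ℝ} (ha0 : 0 < a) (hab : a < b) (hbc : b < c)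
    (hcR : c < Rm) (hRmR : Rm < R) (hEmin : 0 < Emin) (hE : Emin ≤ Emax)
    (hs1 : 1 / 2 < s) (hs2 : s ≤ 1) :
    ∃ C > 0, ∃ h₀ > 0, ∀ (V : ℝ → ℝ) (T h ε E m : ℝ) (p q p1 q1 p2 q2 : ℝ → ℝ),
      IsRadialMode V R T h ε E m p q p1 q1 p2 q2 → h ∈ Ioc 0 h₀ → ε ∈ Ioc 0 1 →
      E ∈ Icc Emin Emax → E * Rm ^ 2 ≤ m → R ≤ T →
      (∀ᵐ r ∂(volume : Measure ℝ), 0 < r → a < r → V r = 0) →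
      (∀ᵐ r ∂(volume : Measure ℝ), 0 < r → r < c → 0 ≤ V r + E * c ^ 2 / r ^ 2 - E) →
      ∫ r in R..T, r ^ (-(2 * s)) * (p r ^ 2 + q r ^ 2) ≤
        C / h ^ 2 * ∫ r in R..T, r ^ (2 * s) *
        (radialSource h ε E m p q p2 r ^ 2 + radialSource h (-ε) E m q p q2 r ^ 2) := by
  have haR : a < R := by linarith
  have hb0 : 0 < b := ha0.trans hab
  have hc0 : 0 < c := hb0.trans hbc
  have hRm0 : 0 < Rm := hc0.trans hcR
  obtain ⟨κ, hκ, Kw, hKw, w, w1, hw, hw1c, hwa, hw0, hw2, hw1, hw1K, hwb⟩ :=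
    exists_radial_weight hs1 hs2 ha0 hab
  set θ := 1 - c ^ 2 / Rm ^ 2 with hθ
  have hθ0 : 0 < θ := by
    rw [hθ, sub_pos, div_lt_one (by positivity)]
    gcongr
  have hcb : 0 < c - b := by linarith
  set κ' := min κ (κ * Emin / 2) with hκ'
  have hκ'0 : 0 < κ' := by positivity
  have hκ'1 : κ' ≤ κ := min_le_left _ _
  have hκ'2 : κ' ≤ κ * Emin / 2 := min_le_right _ _
  have hcp : 0 < c ^ (2 * s) := Real.rpow_pos_of_pos hc0 _
  set M := Kw * (2 * c ^ 2) * c ^ (2 * s) / (a ^ 2 * θ * (c - b) ^ 2) with hM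
  have hM0 : 0 < M := by positivity
  set N := θ * (Emin * Rm ^ 2) * (c - b) ^ 2 / (2 * c ^ 2) with hN
  have hN0 : 0 < N := by positivity
  set h₀ := min (min 1 N) (κ * Emin / 2 / M) with hh₀
  refine ⟨8 * (20 + (8 * (Emax + 1) + 4 * Kw ^ 2 + 1) ^ 2) / κ' ^ 2, by positivity, h₀,
    by positivity, ?_⟩
  intro V T h ε E m p q p1 q1 p2 q2 H hh hε hEE hm hRT hV hforb
  have hh1 : h ≤ 1 := hh.2.trans ((min_le_left _ _).trans (min_le_left _ _))
  have hhh : h ^ 2 ≤ h := by nlinarith [hh.1]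
  have hhN : h ^ 2 ≤ N := hhh.trans (hh.2.trans ((min_le_left _ _).trans (min_le_right _ _)))
  have hhM : h ^ 2 * M ≤ κ * Emin / 2 := by
    rw [← le_div_iff₀ hM0]
    exact hhh.trans (hh.2.trans (min_le_right _ _))
  have hE0 : 0 < E := hEmin.trans_le hEE.1
  have hmE : Emin * Rm ^ 2 ≤ m := le_trans (by have := hEE.1; gcongr) hm
  have hm0 : 0 < m := lt_of_lt_of_le (by positivity) hmE
  have hsub : uIcc a T ⊆ Ioi 0 := by
    rw [uIcc_of_le (haR.le.trans hRT)]; exact fun r hr => ha0.trans_le hr.1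
  have hsub2 : uIcc a T ⊆ Ici a := by
    rw [uIcc_of_le (haR.le.trans hRT)]; exact fun r hr => hr.1
  have cw : ContinuousOn (fun r : ℝ => r ^ (-(2 * s))) (Ioi 0) :=
    ContinuousOn.rpow_const continuousOn_id fun r hr => Or.inl (ne_of_gt hr)
  have cy : ContinuousOn (fun r => p r ^ 2 + q r ^ 2) (Ioi 0) := (H.cp.pow 2).add (H.cq.pow 2)
  have cW : ContinuousOn w (Ici a) := fun r hr => (hw r hr).continuousAt.continuousWithinAt
  have cD : ContinuousOn (fun r => w1 r * (E - m / r ^ 2) + 2 * w r * m / r ^ 3) (Ici a) := by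
    refine (hw1c.mul (continuousOn_const.sub (continuousOn_const.div (continuousOn_id.pow 2) ?_))).add
      (((continuousOn_const.mul cW).mul continuousOn_const).div (continuousOn_id.pow 3) ?_)
    · exact fun r hr => pow_ne_zero 2 (ha0.trans_le hr).ne'
    · exact fun r hr => pow_ne_zero 3 (ha0.trans_le hr).ne'
  have hW : ∀ r ∈ Ioo 0 c, θ * m / r ^ 2 * (p r ^ 2 + q r ^ 2) ≤
      h ^ 2 * (p2 r * p r + q2 r * q r) := by
    have hsub3 : Ioo 0 c ⊆ Ioi 0 := fun r hr => hr.1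
    intro r hr
    refine sub_nonneg.1 (nonneg_of_ae_nonneg_of_continuousOn (f := fun r =>
      h ^ 2 * (p2 r * p r + q2 r * q r) - θ * m / r ^ 2 * (p r ^ 2 + q r ^ 2)) ?_ ?_ r hr)
    · refine ContinuousOn.mono ((((H.hp2.mul H.cp).add (H.hq2.mul H.cq)).const_mul _).sub
        ((continuousOn_const.div (continuousOn_id.pow 2) ?_).mul cy)) hsub3
      exact fun r hr => pow_ne_zero 2 (ne_of_gt hr)
    · filter_upwards [H.eqp, H.eqq, hforb] with r e1 e2 e3 hr
      have hrR : r < R := by linarith [hr.2]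
      have e1 := e1 hr.1 hrR
      have e2 := e2 hr.1 hrR
      have e3 := e3 hr.1 hr.2
      have e4 : h ^ 2 * (p2 r * p r + q2 r * q r) =
          (V r + m / r ^ 2 - E) * (p r ^ 2 + q r ^ 2) := by
        linear_combination p r * e1 + q r * e2
      rw [e4, ← sub_mul]
      refine mul_nonneg ?_ (by positivity)
      have hr0 := hr.1
      have e5 : E * c ^ 2 ≤ m * (c ^ 2 / Rm ^ 2) := by
        calc E * c ^ 2 = E * Rm ^ 2 * (c ^ 2 / Rm ^ 2) := by field_simp
          _ ≤ _ := by gcongr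
      have e6 : E * c ^ 2 / r ^ 2 ≤ m * (c ^ 2 / Rm ^ 2) / r ^ 2 := by gcongr
      have e7 : θ * m / r ^ 2 = m / r ^ 2 - m * (c ^ 2 / Rm ^ 2) / r ^ 2 := by rw [hθ]; ring
      linarith
  have hforbid := forbidden_region_estimate (a := a) (b := b) (c := c) (h := h) (k := θ * m)
    ha0 hab hbc hh.1 ?_ (fun r hr => H.hp r hr.1) (fun r hr => H.hq r hr.1)
    (fun r hr => H.hp1 r hr.1) (fun r hr => H.hq1 r hr.1) (H.hp2.mono fun r hr => hr.1)
    (H.hq2.mono fun r hr => hr.1) hW H.t1 H.t0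
  swap
  · rw [hN, le_div_iff₀ (by positivity)] at hhN
    calc 2 * c ^ 2 * h ^ 2 = h ^ 2 * (2 * c ^ 2) := by ring
      _ ≤ _ := hhN
      _ ≤ _ := by gcongr
  have key := H.weighted_le_of_le_one (s := s) (B := Emax + 1) (Kw := Kw) (κ := κ' ) (w := w)
    (w1 := w1) hh.1 hh1 hε.1 hε.2 ⟨ha0, haR⟩ hRT hV hκ'0 (by linarith)
    (fun r hr => ?_) hw hw1c hwa hw0 hw2 (fun r hr => ?_) hw1K ?_
  · refine key.trans_eq ?_
    congr 1
    field_simp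
  · have : 0 ≤ m / r ^ 2 := by positivity
    linarith [hEE.2]
  · have : 0 < r ^ (-(2 * s)) := Real.rpow_pos_of_pos (ha0.trans_le hr) _
    exact le_trans (by gcongr) (hw1 r hr)
  set I := ∫ r in a..T, r ^ (-(2 * s)) * (p r ^ 2 + q r ^ 2) with hI
  have hbT : b ≤ T := by linarith
  have sub1 : uIcc a b ⊆ uIcc a T := by
    rw [uIcc_of_le hab.le, uIcc_of_le (hab.le.trans hbT)]; exact Icc_subset_Icc le_rfl hbT
  have sub2 : uIcc b T ⊆ uIcc a T := by
    rw [uIcc_of_le hbT, uIcc_of_le (hab.le.trans hbT)]; exact Icc_subset_Icc hab.le le_rfl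
  have cz : ContinuousOn (fun r => r ^ (-(2 * s)) * (p r ^ 2 + q r ^ 2)) (Ioi 0) := cw.mul cy
  have cDy : ContinuousOn (fun r => (w1 r * (E - m / r ^ 2) + 2 * w r * m / r ^ 3) *
      (p r ^ 2 + q r ^ 2)) (uIcc a T) := (cD.mono hsub2).mul (cy.mono hsub)
  have czM : ContinuousOn (fun r => κ * Emin * (r ^ (-(2 * s)) * (p r ^ 2 + q r ^ 2))) (Ioi 0) :=
    cz.const_mul _
  have cyM : ContinuousOn (fun r => Kw * m / a ^ 2 * (p r ^ 2 + q r ^ 2)) (Ioi 0) :=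
    cy.const_mul _
  have hIbc : ∫ r in b..c, (p r ^ 2 + q r ^ 2) ≤ c ^ (2 * s) * I := by
    have hnn : ∀ r ∈ Ioi (0 : ℝ), 0 ≤ r ^ (-(2 * s)) * (p r ^ 2 + q r ^ 2) := fun r hr => by
      have := Real.rpow_nonneg (le_of_lt hr) (-(2 * s))
      positivity
    have g1 : ∫ r in b..c, r ^ (-(2 * s)) * (p r ^ 2 + q r ^ 2) ≤ I := by
      refine intervalIntegral.integral_mono_interval hab.le hbc.le (by linarith) ?_
        (cz.mono hsub).intervalIntegrable
      filter_upwards [ae_restrict_mem measurableSet_Ioc] with r hr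
      exact hnn r (ha0.trans hr.1)
    have hsub4 : uIcc b c ⊆ Ioi 0 := by
      rw [uIcc_of_le hbc.le]; exact fun r hr => hb0.trans_le hr.1
    calc ∫ r in b..c, (p r ^ 2 + q r ^ 2) ≤
        ∫ r in b..c, c ^ (2 * s) * (r ^ (-(2 * s)) * (p r ^ 2 + q r ^ 2)) := by
          refine intervalIntegral.integral_mono_on hbc.le (cy.mono hsub4).intervalIntegrable
            ((cz.const_mul _).mono hsub4).intervalIntegrable fun r hr => ?_
          have hr0 : 0 < r := hb0.trans_le hr.1
          rw [← mul_assoc]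
          refine le_mul_of_one_le_left (by positivity) ?_
          calc (1 : ℝ) = r ^ (2 * s) * r ^ (-(2 * s)) := by rw [← Real.rpow_add hr0]; simp
            _ ≤ c ^ (2 * s) * r ^ (-(2 * s)) := by
              gcongr
              exact hr.2
      _ = c ^ (2 * s) * ∫ r in b..c, r ^ (-(2 * s)) * (p r ^ 2 + q r ^ 2) :=
          intervalIntegral.integral_const_mul _ _
      _ ≤ _ := by gcongr
  have hI0 : 0 ≤ I := intervalIntegral.integral_nonneg (by linarith) fun r hr => by
    have := Real.rpow_nonneg (ha0.le.trans hr.1) (-(2 * s))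
    positivity
  set J := ∫ r in a..b, (p r ^ 2 + q r ^ 2) with hJ
  have hJ1 : Kw * m / a ^ 2 * J ≤ κ * Emin / 2 * I := by
    have g1 : θ * m * (c - b) ^ 2 * J ≤ 2 * c ^ 2 * h ^ 2 * (c ^ (2 * s) * I) :=
      hforbid.trans (by gcongr)
    calc Kw * m / a ^ 2 * J = Kw / (a ^ 2 * θ * (c - b) ^ 2) * (θ * m * (c - b) ^ 2 * J) := by
          field_simp
      _ ≤ Kw / (a ^ 2 * θ * (c - b) ^ 2) * (2 * c ^ 2 * h ^ 2 * (c ^ (2 * s) * I)) := by gcongr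
      _ = h ^ 2 * M * I := by rw [hM]; ring
      _ ≤ _ := by gcongr
  have hD1 : ∫ r in a..b, (κ * Emin * (r ^ (-(2 * s)) * (p r ^ 2 + q r ^ 2)) -
      Kw * m / a ^ 2 * (p r ^ 2 + q r ^ 2)) ≤
      ∫ r in a..b, (w1 r * (E - m / r ^ 2) + 2 * w r * m / r ^ 3) * (p r ^ 2 + q r ^ 2) := by
    refine intervalIntegral.integral_mono_on hab.le
      (((cz.const_mul _).sub (cy.const_mul _)).mono (sub1.trans hsub)).intervalIntegrable
      (cDy.mono sub1).intervalIntegrable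
      fun r hr => ?_
    have hr0 : 0 < r := ha0.trans_le hr.1
    have hz : 0 < r ^ (-(2 * s)) := Real.rpow_pos_of_pos hr0 _
    rw [← mul_assoc, ← sub_mul]
    refine mul_le_mul_of_nonneg_right ?_ (by positivity)
    have g1 : κ * Emin * r ^ (-(2 * s)) ≤ w1 r * E := by
      calc κ * Emin * r ^ (-(2 * s)) = κ * r ^ (-(2 * s)) * Emin := by ring
        _ ≤ w1 r * E := mul_le_mul (hw1 r hr.1) hEE.1 hEmin.le
          (le_trans (by positivity) (hw1 r hr.1))
    have g2 : w1 r * (m / r ^ 2) ≤ Kw * (m / a ^ 2) := by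
      have := hw1K r hr.1
      have := hr.1
      gcongr
    have g3 : 0 ≤ 2 * w r * m / r ^ 3 := by
      have := hw0 r hr.1
      positivity
    have g4 : Kw * m / a ^ 2 = Kw * (m / a ^ 2) := by ring
    rw [g4]
    linarith
  have hD2 : ∫ r in b..T, κ * Emin * (r ^ (-(2 * s)) * (p r ^ 2 + q r ^ 2)) ≤
      ∫ r in b..T, (w1 r * (E - m / r ^ 2) + 2 * w r * m / r ^ 3) * (p r ^ 2 + q r ^ 2) := by
    refine intervalIntegral.integral_mono_on hbT
      ((cz.const_mul _).mono (sub2.trans hsub)).intervalIntegrable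
      (cDy.mono sub2).intervalIntegrable
      fun r hr => ?_
    have har : a ≤ r := hab.le.trans hr.1
    have hr0 : 0 < r := ha0.trans_le har
    have hz : 0 < r ^ (-(2 * s)) := Real.rpow_pos_of_pos hr0 _
    rw [← mul_assoc]
    refine mul_le_mul_of_nonneg_right ?_ (by positivity)
    have g1 : κ * Emin * r ^ (-(2 * s)) ≤ w1 r * E := by
      calc κ * Emin * r ^ (-(2 * s)) = κ * r ^ (-(2 * s)) * Emin := by ring
        _ ≤ w1 r * E := mul_le_mul (hw1 r har) hEE.1 hEmin.le
          (le_trans (by positivity) (hw1 r har))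
    have g2 : w1 r * (E - m / r ^ 2) + 2 * w r * m / r ^ 3 =
        w1 r * E + m / r ^ 3 * (2 * w r - w1 r * r) := by
      field_simp
      ring
    have g3 : 0 ≤ m / r ^ 3 * (2 * w r - w1 r * r) :=
      mul_nonneg (by positivity) (sub_nonneg.2 (hwb r hr.1))
    linarith
  rw [intervalIntegral.integral_sub (czM.mono (sub1.trans hsub)).intervalIntegrable
    (cyM.mono (sub1.trans hsub)).intervalIntegrable,
    intervalIntegral.integral_const_mul, intervalIntegral.integral_const_mul] at hD1
  rw [intervalIntegral.integral_const_mul] at hD2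
  have hsum := intervalIntegral.integral_add_adjacent_intervals (μ := volume) (a := a) (b := b)
    (c := T)
    (cz.mono (sub1.trans hsub)).intervalIntegrable (cz.mono (sub2.trans hsub)).intervalIntegrable
  rw [← intervalIntegral.integral_add_adjacent_intervals (a := a) (b := b) (c := T)
      (cDy.mono sub1).intervalIntegrable
      (cDy.mono sub2).intervalIntegrable]
  have hlast : κ' * I ≤ κ * Emin / 2 * I := by gcongr
  have hI2 : κ * Emin * I = κ * Emin * (∫ r in a..b, r ^ (-(2 * s)) * (p r ^ 2 + q r ^ 2)) +
      κ * Emin * ∫ r in b..T, r ^ (-(2 * s)) * (p r ^ 2 + q r ^ 2) := by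
    rw [hI, ← mul_add]
    exact congrArg _ hsum.symm
  linarith

end IsRadialMode

theorem exists_radii {Emin Emax R : ℝ} {V : ℝ → ℝ} (hEmin : 0 < Emin) (hE : Emin ≤ Emax)
    (hVbdd : ∃ Cv : ℝ, ∀ᵐ r ∂(volume.restrict (Ioi (0 : ℝ))), |V r| ≤ Cv)
    (hVsupp : HasCompactSupport V) (hR0 : 0 < R0 V)
    (hR : sSup ((fun E => R1 V E) '' Icc Emin Emax) < R) :
    ∃ a b c Rm, 0 < a ∧ a < b ∧ b < c ∧ c < Rm ∧ Rm < R ∧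
      (∀ᵐ r ∂(volume : Measure ℝ), 0 < r → a < r → V r = 0) ∧
      ∀ E ∈ Icc Emin Emax, ∀ᵐ r ∂(volume : Measure ℝ), 0 < r → r < c →
        0 ≤ V r + E * c ^ 2 / r ^ 2 - E := by
  obtain ⟨Cv, hCv⟩ := hVbdd
  have hCv' := (ae_restrict_iff' measurableSet_Ioi).1 hCv
  have hbeyond : ∀ t, R0 V < t → ∃ ρ < t, R0 V ≤ ρ ∧
      ∀ᵐ r ∂(volume : Measure ℝ), 0 < r → ρ < r → V r = 0 := by
    intro t ht
    have hne : {R : ℝ | 0 ≤ R ∧ ∀ᵐ r ∂(volume.restrict (Ioi (0 : ℝ))), R < r → V r = 0}.Nonempty := by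
      obtain ⟨B, hB⟩ := hVsupp.isBounded.subset_closedBall 0
      refine ⟨max B 0, le_max_right _ _, Eventually.of_forall fun r hr => ?_⟩
      by_contra hne
      have h1 := hB (subset_tsupport V hne)
      rw [Metric.mem_closedBall, dist_zero_right, Real.norm_eq_abs] at h1
      linarith [le_abs_self r, le_max_left B 0]
    obtain ⟨ρ, hρ, hρt⟩ := exists_lt_of_csInf_lt hne ht
    exact ⟨ρ, hρt, csInf_le ⟨0, fun x hx => hx.1⟩ hρ, (ae_restrict_iff' measurableSet_Ioi).1 hρ.2⟩
  set S : ℝ → Set ℝ := fun E => {m : ℝ | 0 < m ∧ ∃ R' > R0 V,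
    ∀ᵐ r ∂(volume.restrict (Ioi (0 : ℝ))), r < R' → 0 ≤ V r + m * (r ^ 2)⁻¹ - E} with hS
  have hlow : ∀ E, 0 < E → ∀ m ∈ S E, E * R0 V ^ 2 ≤ m := by
    rintro E hE0 m ⟨hm0, R', hR', hae⟩
    obtain ⟨ρ, hρ1, hρ2, hρ3⟩ := hbeyond R' hR'
    have hae' := (ae_restrict_iff' measurableSet_Ioi).1 hae
    obtain ⟨r, hr, h1, h2⟩ : ∃ r ∈ Ioo ρ R', (0 < r → ρ < r → V r = 0) ∧
        (r ∈ Ioi 0 → r < R' → 0 ≤ V r + m * (r ^ 2)⁻¹ - E) := by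
      have hpos : (volume : Measure ℝ) (Ioo ρ R') ≠ 0 := by
        rw [Real.volume_Ioo]; simpa using hρ1
      by_contra! hcon
      refine hpos (measure_mono_null (fun r hr => ?_) (ae_iff.1 (hρ3.and hae')))
      simp only [mem_ofPred_eq, not_and, not_forall]
      intro h1
      obtain ⟨h2, h3, h4⟩ := hcon r hr h1
      exact ⟨h2, h3, not_le.2 h4⟩
    have hr0 : 0 < r := by linarith [hr.1]
    have h3 := h2 hr0 hr.2
    rw [h1 hr0 hr.1] at h3
    have h4 : E ≤ m / r ^ 2 := by rw [div_eq_mul_inv]; linarith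
    rw [le_div_iff₀ (by positivity)] at h4
    refine le_trans ?_ h4
    have : R0 V ≤ r := by linarith [hr.1]
    gcongr
  have hmem : ∀ E, 0 < E → (|Cv| + E) * (R0 V + 1) ^ 2 ∈ S E := by
    intro E hE0
    refine ⟨by positivity, R0 V + 1, by linarith, (ae_restrict_iff' measurableSet_Ioi).2 ?_⟩
    filter_upwards [hCv'] with r h1 hr0 hr
    have hr0' : 0 < r := hr0
    have h2 := abs_le.1 ((h1 hr0).trans (le_abs_self Cv))
    have h3 : |Cv| + E ≤ (|Cv| + E) * (R0 V + 1) ^ 2 * (r ^ 2)⁻¹ := by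
      rw [mul_assoc]
      refine le_mul_of_one_le_right (by positivity) ?_
      rw [← div_eq_mul_inv, one_le_div (by positivity)]
      gcongr
    linarith
  have hbdd : ∀ E, 0 < E → BddBelow (S E) := fun E hE0 => ⟨0, fun x hx => hx.1.le⟩
  have hM0 : ∀ E, M0 V E = sInf (S E) := fun E => rfl
  have hMlow : ∀ E, 0 < E → E * R0 V ^ 2 ≤ M0 V E := fun E hE0 =>
    le_csInf ⟨_, hmem E hE0⟩ (hlow E hE0)
  have hMup : ∀ E, 0 < E → M0 V E ≤ (|Cv| + E) * (R0 V + 1) ^ 2 := fun E hE0 =>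
    csInf_le (hbdd E hE0) (hmem E hE0)
  have hR1low : ∀ E, 0 < E → R0 V ≤ R1 V E := fun E hE0 => by
    refine Real.le_sqrt_of_sq_le ?_
    rw [le_div_iff₀ hE0]
    linarith [hMlow E hE0]
  have hR1sq : ∀ E, 0 < E → E * R1 V E ^ 2 = M0 V E := fun E hE0 => by
    have : 0 ≤ M0 V E := le_trans (by positivity) (hMlow E hE0)
    rw [R1, Real.sq_sqrt (by positivity)]
    field_simp
  have hbddA : BddAbove ((fun E => R1 V E) '' Icc Emin Emax) := by
    refine ⟨Real.sqrt ((|Cv| + Emax) * (R0 V + 1) ^ 2 / Emin), ?_⟩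
    rintro _ ⟨E, hEE, rfl⟩
    have hE0 : 0 < E := hEmin.trans_le hEE.1
    refine Real.sqrt_le_sqrt ?_
    have h1 := hMup E hE0
    have h2 := hEE.2
    have h3 : M0 V E ≤ (|Cv| + Emax) * (R0 V + 1) ^ 2 := h1.trans (by gcongr)
    have hEmax : 0 < Emax := hEmin.trans_le hE
    exact div_le_div₀ (by positivity) h3 hEmin hEE.1
  set Rb := sSup ((fun E => R1 V E) '' Icc Emin Emax) with hRb
  have hle : ∀ E ∈ Icc Emin Emax, R1 V E ≤ Rb := fun E hEE => le_csSup hbddA ⟨E, hEE, rfl⟩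
  have hRbR0 : R0 V ≤ Rb := (hR1low Emin hEmin).trans (hle Emin ⟨le_rfl, hE⟩)
  set δ := (R - Rb) / 5 with hδ
  have hδ0 : 0 < δ := by rw [hδ]; linarith
  refine ⟨Rb + δ, Rb + 2 * δ, Rb + 3 * δ, Rb + 4 * δ, by linarith, by linarith, by linarith,
    by linarith, by rw [hδ]; linarith, ?_, ?_⟩
  · obtain ⟨ρ, hρ1, -, hρ3⟩ := hbeyond (Rb + δ) (by linarith)
    exact hρ3.mono fun r h1 h2 h3 => h1 h2 (hρ1.trans h3)
  intro E hEE
  have hE0 : 0 < E := hEmin.trans_le hEE.1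
  have hlt : sInf (S E) < E * (Rb + 3 * δ) ^ 2 := by
    rw [← hM0, ← hR1sq E hE0]
    have h0 : 0 ≤ R1 V E := Real.sqrt_nonneg _
    have h1 : R1 V E < Rb + 3 * δ := by linarith [hle E hEE]
    gcongr
  obtain ⟨m, ⟨hm0, R', hR', hae⟩, hm⟩ := exists_lt_of_csInf_lt ⟨_, hmem E hE0⟩ hlt
  obtain ⟨ρ, hρ1, -, hρ3⟩ := hbeyond R' hR'
  filter_upwards [hρ3, (ae_restrict_iff' measurableSet_Ioi).1 hae] with r h1 h2 hr0 hrc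
  rcases lt_or_ge r R' with hr | hr
  · have h3 := h2 hr0 hr
    have h4 : m * (r ^ 2)⁻¹ ≤ E * (Rb + 3 * δ) ^ 2 / r ^ 2 := by
      rw [← div_eq_mul_inv]; gcongr
    linarith
  · rw [h1 hr0 (hρ1.trans_le hr)]
    have h4 : E ≤ E * (Rb + 3 * δ) ^ 2 / r ^ 2 := by
      rw [le_div_iff₀ (by positivity)]
      gcongr
    linarith

/-- The exterior weighted estimate for every separated mode, uniformly in all parameters. -/
theorem exists_mode_bound {Emin Emax R s : ℝ} {V : ℝ → ℝ} (hEmin : 0 < Emin) (hE : Emin ≤ Emax)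
    (hs1 : 1 / 2 < s) (hs2 : s ≤ 1)
    (hVbdd : ∃ Cv : ℝ, ∀ᵐ r ∂(volume.restrict (Ioi (0 : ℝ))), |V r| ≤ Cv)
    (hVsupp : HasCompactSupport V) (hR0 : 0 < R0 V)
    (hR : sSup ((fun E => R1 V E) '' Icc Emin Emax) < R) :
    0 < R ∧ (∀ᵐ r ∂(volume : Measure ℝ), 0 < r → R < r → V r = 0) ∧
    ∃ C > 0, ∃ h₀ > 0, ∀ (T h ε E m : ℝ) (p q p1 q1 p2 q2 : ℝ → ℝ),
      IsRadialMode V R T h ε E m p q p1 q1 p2 q2 → h ∈ Ioc 0 h₀ → 0 < ε →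
      E ∈ Icc Emin Emax → -h ^ 2 / 4 ≤ m → R ≤ T →
      ∫ r in R..T, r ^ (-(2 * s)) * (p r ^ 2 + q r ^ 2) ≤
        C / h ^ 2 * ∫ r in R..T, r ^ (2 * s) *
        (radialSource h ε E m p q p2 r ^ 2 + radialSource h (-ε) E m q p q2 r ^ 2) := by
  obtain ⟨a, b, c, Rm, ha, hab, hbc, hcRm, hRmR, hV, hforb⟩ :=
    exists_radii hEmin hE hVbdd hVsupp hR0 hR
  have hRm : 0 < Rm := by linarith
  have haR : a < R := by linarith
  have hR' : 0 < R := ha.trans haR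
  refine ⟨hR', hV.mono fun r h1 h2 h3 => h1 h2 (haR.trans h3), ?_⟩
  obtain ⟨C1, hC1, h1, hh1, H1⟩ := IsRadialMode.exists_bound_of_le hRm hRmR hEmin hE hs1 hs2
  obtain ⟨C2, hC2, h2, hh2, H2⟩ :=
    IsRadialMode.exists_bound_of_ge ha hab hbc hcRm hRmR hEmin hE hs1 hs2
  refine ⟨C1 + C2 + (R ^ (-(2 * s))) ^ 2, by positivity, min 1 (min h1 h2), by positivity, ?_⟩
  intro T h ε E m p q p1 q1 p2 q2 H hh hε hEE hm hRT
  have hh0 := hh.1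
  have hle1 : h ≤ 1 := hh.2.trans (min_le_left _ _)
  have hle2 : h ≤ h1 := hh.2.trans ((min_le_right _ _).trans (min_le_left _ _))
  have hle3 : h ≤ h2 := hh.2.trans ((min_le_right _ _).trans (min_le_right _ _))
  have hnn : 0 ≤ ∫ r in R..T, r ^ (2 * s) *
      (radialSource h ε E m p q p2 r ^ 2 + radialSource h (-ε) E m q p q2 r ^ 2) :=
    intervalIntegral.integral_nonneg hRT fun r hr => by
      have := Real.rpow_nonneg (hR'.le.trans hr.1) (2 * s)
      positivity
  have hsq := sq_nonneg (R ^ (-(2 * s)))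
  have up : ∀ c, c ≤ (C1 + C2 + (R ^ (-(2 * s))) ^ 2) / h ^ 2 →
      c * (∫ r in R..T, r ^ (2 * s) *
      (radialSource h ε E m p q p2 r ^ 2 + radialSource h (-ε) E m q p q2 r ^ 2)) ≤
      (C1 + C2 + (R ^ (-(2 * s))) ^ 2) / h ^ 2 * ∫ r in R..T, r ^ (2 * s) *
      (radialSource h ε E m p q p2 r ^ 2 + radialSource h (-ε) E m q p q2 r ^ 2) :=
    fun c hc => mul_le_mul_of_nonneg_right hc hnn
  rcases le_or_gt ε 1 with hε1 | hε1
  · rcases le_or_gt m (E * Rm ^ 2) with hmE | hmE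
    · refine (H1 V T h ε E m p q p1 q1 p2 q2 H ⟨hh0, hle2⟩ ⟨hε, hε1⟩ hEE hm hmE hRT
        (hV.mono fun r g1 g2 g3 => g1 g2 (by linarith))).trans (up _ ?_)
      gcongr
      linarith
    · refine (H2 V T h ε E m p q p1 q1 p2 q2 H ⟨hh0, hle3⟩ ⟨hε, hε1⟩ hEE hmE.le hRT hV
        (hforb E hEE)).trans (up _ ?_)
      gcongr
      linarith
  · refine (H.weighted_le_of_one_le hh0 hε1.le (by linarith) ⟨ha, haR⟩ hRT hV).trans (up _ ?_)
    rw [le_div_iff₀ (by positivity)]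
    calc (R ^ (-(2 * s))) ^ 2 * h ^ 2 ≤ (R ^ (-(2 * s))) ^ 2 * 1 :=
          mul_le_mul_of_nonneg_left (pow_le_one₀ hh0.le hle1) hsq
      _ ≤ _ := by linarith

theorem homeomorphUnitSphereProd_smul {F : Type*} [NormedAddCommGroup F] [NormedSpace ℝ F]
    (x : ({0}ᶜ : Set F)) :
    ((homeomorphUnitSphereProd F x).2 : ℝ) • ((homeomorphUnitSphereProd F x).1 : F) = x := by
  have : (x : F) ≠ 0 := x.2
  simp [smul_smul, this]

section Polar

variable {F : Type*} [NormedAddCommGroup F] [NormedSpace ℝ F] [Nontrivial F]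
  [FiniteDimensional ℝ F] [MeasurableSpace F] [BorelSpace F] (μ : Measure F) [μ.IsAddHaarMeasure]

/-- Polar coordinates for the lower Lebesgue integral. -/
theorem lintegral_eq_lintegral_sphere {g : F → ENNReal} (hg : Measurable g) :
    ∫⁻ x, g x ∂μ = ∫⁻ r in Ioi (0 : ℝ), ENNReal.ofReal (r ^ (Module.finrank ℝ F - 1)) *
      ∫⁻ ω, g (r • (ω : F)) ∂μ.toSphere := by
  have hmeas : Measurable fun z : Metric.sphere (0 : F) 1 × ℝ => g (z.2 • (z.1 : F)) :=
    hg.comp (by fun_prop)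
  have hmeas' : Measurable fun z : Metric.sphere (0 : F) 1 × Ioi (0 : ℝ) =>
      g ((z.2 : ℝ) • (z.1 : F)) :=
    hg.comp (by fun_prop)
  calc ∫⁻ x, g x ∂μ = ∫⁻ x : ({(0)}ᶜ : Set F), g x ∂(μ.comap (↑)) := by
        rw [lintegral_subtype_comap (measurableSet_singleton _).compl, restrict_compl_singleton]
    _ = ∫⁻ z, g ((z.2 : ℝ) • (z.1 : F)) ∂μ.toSphere.prod (.volumeIoiPow (Module.finrank ℝ F - 1)) := by
        rw [← μ.measurePreserving_homeomorphUnitSphereProd.lintegral_comp hmeas']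
        refine lintegral_congr fun x => ?_
        rw [homeomorphUnitSphereProd_smul]
    _ = ∫⁻ r : Ioi (0 : ℝ), ∫⁻ ω, g ((r : ℝ) • (ω : F)) ∂μ.toSphere
          ∂(.volumeIoiPow (Module.finrank ℝ F - 1)) := lintegral_prod_symm' _ hmeas'
    _ = _ := by
        have h1 : Measurable fun r : ℝ => ∫⁻ ω, g (r • (ω : F)) ∂μ.toSphere :=
          hmeas.lintegral_prod_left'
        have h2 := lintegral_withDensity_eq_lintegral_mul
          (Measure.comap (Subtype.val : Ioi (0 : ℝ) → ℝ) volume)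
          (f := fun r : Ioi (0 : ℝ) => ENNReal.ofReal ((r : ℝ) ^ (Module.finrank ℝ F - 1)))
          (by fun_prop) (h1.comp measurable_subtype_coe)
        refine (Eq.trans ?_ h2).trans ?_
        · rfl
        exact lintegral_subtype_comap measurableSet_Ioi (fun r : ℝ =>
          ENNReal.ofReal (r ^ (Module.finrank ℝ F - 1)) * ∫⁻ ω, g (r • (ω : F)) ∂μ.toSphere)

/-- Polar coordinates for the Bochner integral. -/
theorem integral_eq_integral_sphere {g : F → ℝ} (hg : Integrable g μ) :
    ∫ x, g x ∂μ = ∫ r in Ioi (0 : ℝ), r ^ (Module.finrank ℝ F - 1) *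
      ∫ ω, g (r • (ω : F)) ∂μ.toSphere := by
  have hinteg : Integrable (fun z : Metric.sphere (0 : F) 1 × Ioi (0 : ℝ) => g ((z.2 : ℝ) • (z.1 : F)))
      (μ.toSphere.prod (.volumeIoiPow (Module.finrank ℝ F - 1))) := by
    rw [← μ.measurePreserving_homeomorphUnitSphereProd.integrable_comp_emb
      (Homeomorph.measurableEmbedding _)]
    have : Integrable (fun x : ({(0)}ᶜ : Set F) => g x) (μ.comap (↑)) := by
      have := (integrableOn_iff_comap_subtypeVal (μ := μ) (f := g)
        (measurableSet_singleton (0 : F)).compl).1 hg.integrableOn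
      exact this
    refine this.congr (Eventually.of_forall fun x => ?_)
    simp only [Function.comp_def, homeomorphUnitSphereProd_smul]
  calc ∫ x, g x ∂μ = ∫ x : ({(0)}ᶜ : Set F), g x ∂(μ.comap (↑)) := by
        rw [integral_subtype_comap (measurableSet_singleton _).compl fun x => g x,
          restrict_compl_singleton]
    _ = ∫ z, g ((z.2 : ℝ) • (z.1 : F)) ∂μ.toSphere.prod (.volumeIoiPow (Module.finrank ℝ F - 1)) := by
        rw [← μ.measurePreserving_homeomorphUnitSphereProd.integral_comp
          (Homeomorph.measurableEmbedding _)]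
        refine integral_congr_ae (Eventually.of_forall fun x => ?_)
        simp only [homeomorphUnitSphereProd_smul]
    _ = ∫ r : Ioi (0 : ℝ), ∫ ω, g ((r : ℝ) • (ω : F)) ∂μ.toSphere
          ∂(.volumeIoiPow (Module.finrank ℝ F - 1)) := integral_prod_symm _ hinteg
    _ = _ := by
        simp only [Measure.volumeIoiPow, ENNReal.ofReal]
        rw [integral_withDensity_eq_integral_smul
          ((measurable_subtype_coe.pow_const _).real_toNNReal),
          integral_subtype_comap measurableSet_Ioi fun a : ℝ =>
            Real.toNNReal (a ^ (Module.finrank ℝ F - 1)) • ∫ ω, g (a • (ω : F)) ∂μ.toSphere]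
        refine setIntegral_congr_fun measurableSet_Ioi fun r hr => ?_
        simp only [NNReal.smul_def, Real.coe_toNNReal _ (pow_nonneg (le_of_lt hr) _), smul_eq_mul]

/-- A property holding almost everywhere holds almost everywhere on almost every sphere. -/
theorem ae_ae_sphere_of_ae {P : F → Prop} (hP : ∀ᵐ x ∂μ, P x) :
    ∀ᵐ r ∂(volume : Measure ℝ), 0 < r → ∀ᵐ ω : Metric.sphere (0 : F) 1 ∂μ.toSphere, P (r • (ω : F)) := by
  obtain ⟨N, hN1, hN2, hN3⟩ := exists_measurable_superset_of_null (ae_iff.1 hP)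
  have h1 : ∫⁻ x, N.indicator 1 x ∂μ = 0 := by
    rw [lintegral_indicator_one hN2, hN3]
  rw [lintegral_eq_lintegral_sphere μ (measurable_one.indicator hN2)] at h1
  have hmeas : Measurable fun z : Metric.sphere (0 : F) 1 × ℝ =>
      N.indicator (1 : F → ENNReal) (z.2 • (z.1 : F)) :=
    (measurable_one.indicator hN2).comp (by fun_prop)
  rw [lintegral_eq_zero_iff (by
    exact (by fun_prop : Measurable fun r : ℝ => ENNReal.ofReal (r ^ (Module.finrank ℝ F - 1))).mul
      hmeas.lintegral_prod_left'), EventuallyEq, ae_restrict_iff' measurableSet_Ioi] at h1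
  filter_upwards [h1] with r h2 hr
  have h3 := h2 hr
  have h4 : ENNReal.ofReal (r ^ (Module.finrank ℝ F - 1)) ≠ 0 := by
    simpa using pow_pos hr _
  have h5 : ∫⁻ ω, N.indicator 1 (r • (ω : F)) ∂μ.toSphere = 0 := by
    simpa [h4] using h3
  have hm : Measurable fun ω : Metric.sphere (0 : F) 1 =>
      N.indicator (1 : F → ENNReal) (r • (ω : F)) :=
    (measurable_one.indicator hN2).comp (by fun_prop)
  filter_upwards [(lintegral_eq_zero_iff hm).1 h5] with ω hω
  by_contra hcon
  have := hN1 hcon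
  simp [this] at hω

end Polar

theorem hasDerivAt_integral_of_continuous_deriv {K : Type*} [TopologicalSpace K] [CompactSpace K]
    [MeasurableSpace K] [BorelSpace K] [SecondCountableTopology K]
    (σ : Measure K) [IsFiniteMeasure σ] {A A' : ℝ → K → ℝ}
    (hA : Continuous (Function.uncurry A)) (hA' : Continuous (Function.uncurry A'))
    (h : ∀ r ω, HasDerivAt (fun r => A r ω) (A' r ω) r) (r : ℝ) :
    HasDerivAt (fun r => ∫ ω, A r ω ∂σ) (∫ ω, A' r ω ∂σ) r := by
  have hc : ∀ r, Continuous (A r) := fun r => hA.comp (Continuous.prodMk_right r)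
  have hc' : ∀ r, Continuous (A' r) := fun r => hA'.comp (Continuous.prodMk_right r)
  obtain ⟨M, hM⟩ := ((isCompact_Icc (a := r - 1) (b := r + 1)).prod
    (isCompact_univ (X := K))).exists_bound_of_continuousOn hA'.continuousOn
  refine (hasDerivAt_integral_of_dominated_loc_of_deriv_le (F := A) (F' := A')
    (bound := fun _ => M) (Icc_mem_nhds (by linarith : r - 1 < r) (by linarith : r < r + 1))
    (Eventually.of_forall fun x => (hc x).aestronglyMeasurable) ?_
    (hc' r).aestronglyMeasurable ?_ (integrable_const M) ?_).2
  · exact (hc r).integrable_of_hasCompactSupport (HasCompactSupport.of_compactSpace _)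
  · exact Eventually.of_forall fun ω x hx => hM (x, ω) ⟨hx, mem_univ _⟩
  · exact Eventually.of_forall fun ω x _ => h x ω

theorem continuous_integral_of_continuous {K : Type*} [TopologicalSpace K] [CompactSpace K]
    [MeasurableSpace K] [BorelSpace K] [SecondCountableTopology K]
    (σ : Measure K) [IsFiniteMeasure σ] {A : ℝ → K → ℝ}
    (hA : Continuous (Function.uncurry A)) : Continuous fun r => ∫ ω, A r ω ∂σ := by
  simpa using continuous_parametric_integral_of_continuous (μ := σ) (s := univ) hA isCompact_univ

section Divergence

variable {n : ℕ}

/-- The divergence theorem on spheres, in differentiated form. -/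
theorem hasDerivAt_sphere_flux (hn : 2 ≤ n)
    {X : Fin n → EuclideanSpace ℝ (Fin n) → ℝ} (hX : ∀ j, ContDiff ℝ (⊤ : ℕ∞) (X j)) {r : ℝ}
    (hr : 0 < r) :
    HasDerivAt (fun r : ℝ => r ^ (n - 1) * ∫ ω : Metric.sphere (0 : EuclideanSpace ℝ (Fin n)) 1,
        ∑ j, X j (r • ω.1) * ω.1 j ∂(volume.toSphere))
      (r ^ (n - 1) * ∫ ω : Metric.sphere (0 : EuclideanSpace ℝ (Fin n)) 1,
        ∑ j, fderiv ℝ (X j) (r • ω.1) (EuclideanSpace.single j 1) ∂(volume.toSphere)) r := by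
  have : Nonempty (Fin n) := ⟨⟨0, by omega⟩⟩
  set S := Metric.sphere (0 : EuclideanSpace ℝ (Fin n)) 1
  set σ : Measure S := volume.toSphere with hσ
  set G : ℝ → ℝ := fun r => ∫ ω : S, ∑ j, X j (r • ω.1) * ω.1 j ∂σ with hG
  set G' : ℝ → ℝ := fun r => ∫ ω : S, ∑ j, fderiv ℝ (X j) (r • ω.1) ω.1 * ω.1 j ∂σ with hG'
  set B : ℝ → ℝ := fun r => ∫ ω : S, ∑ j, fderiv ℝ (X j) (r • ω.1) (EuclideanSpace.single j 1) ∂σ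
    with hB
  have hXc : ∀ j, Continuous (X j) := fun j => (hX j).continuous
  have hXd : ∀ j, Continuous (fderiv ℝ (X j)) := fun j => (hX j).continuous_fderiv (by simp)
  have hGd : ∀ r, HasDerivAt G (G' r) r := by
    refine hasDerivAt_integral_of_continuous_deriv σ ?_ ?_ fun r ω => ?_
    · have := hXc; unfold Function.uncurry; fun_prop
    · have := hXd; unfold Function.uncurry; fun_prop
    · refine HasDerivAt.fun_sum fun j _ => HasDerivAt.mul_const ?_ _
      have h1 : HasFDerivAt (X j) (fderiv ℝ (X j) (r • ω.1)) (r • ω.1) :=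
        ((hX j).differentiable (by simp) _).hasFDerivAt
      have h2 : HasDerivAt (fun r : ℝ => r • ω.1) ω.1 r := by
        simpa using (hasDerivAt_id r).smul_const ω.1
      exact h1.comp_hasDerivAt r h2
  have hG'c : Continuous G' := by
    refine continuous_integral_of_continuous σ ?_
    have := hXd; unfold Function.uncurry; fun_prop
  have hBc : Continuous B := by
    refine continuous_integral_of_continuous σ ?_
    have := hXd; unfold Function.uncurry; fun_prop
  have hGc : Continuous G := continuous_iff_continuousAt.2 fun r => (hGd r).continuousAt
  set N : ℝ → ℝ := fun r => (n - 1 : ℕ) * r ^ (n - 1 - 1) * G r + r ^ (n - 1) * G' r with hN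
  have hND : ∀ r, HasDerivAt (fun r => r ^ (n - 1) * G r) (N r) r := fun r =>
    (hasDerivAt_pow (n - 1) r).mul (hGd r)
  have hNc : Continuous N := by rw [hN]; fun_prop
  set D : ℝ → ℝ := fun r => N r - r ^ (n - 1) * B r with hD
  have hDc : Continuous D := by rw [hD]; fun_prop
  suffices h0 : ∀ᵐ r ∂(volume : Measure ℝ), r ∈ Ioi (0 : ℝ) → D r = 0 by
    have hz : D r = 0 := by
      have h1 : D =ᵐ[volume.restrict (Ioi (0 : ℝ))] fun _ => 0 :=
        (ae_restrict_iff' measurableSet_Ioi).2 h0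
      have := Measure.eqOn_open_of_ae_eq h1 isOpen_Ioi hDc.continuousOn continuousOn_const
      exact this hr
    have h3 : N r = r ^ (n - 1) * B r := by simp only [hD] at hz; linarith
    have h2 := hND r
    rw [h3] at h2
    exact h2
  refine isOpen_Ioi.ae_eq_zero_of_integral_contDiff_smul_eq_zero
    (hDc.locallyIntegrable.locallyIntegrableOn _) fun φ hφ hφc hφs => ?_
  have hφ0 : ∀ r ≤ 0, φ r = 0 := fun r hr => by
    by_contra hne
    exact absurd (hφs (subset_tsupport φ hne)) (not_lt.2 hr)
  have hdφs : tsupport (deriv φ) ⊆ Ioi 0 := tsupport_deriv_subset.trans hφs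
  have hdφ0 : ∀ r ≤ 0, deriv φ r = 0 := fun r hr => by
    by_contra hne
    exact absurd (hdφs (subset_tsupport _ hne)) (not_lt.2 hr)
  have hdφc : Continuous (deriv φ) := hφ.continuous_deriv (by simp)
  have hφd : ∀ r, HasDerivAt φ (deriv φ r) r := fun r =>
    (hφ.differentiable (by simp) r).hasDerivAt
  set Φ : EuclideanSpace ℝ (Fin n) → ℝ := fun x => φ ‖x‖ with hΦ
  have hΦs : ContDiff ℝ 1 Φ := by
    rw [contDiff_iff_contDiffAt]
    intro x
    rcases eq_or_ne x 0 with rfl | hx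
    · have h1 : φ =ᶠ[𝓝 0] fun _ => 0 := notMem_tsupport_iff_eventuallyEq.1 fun h =>
        lt_irrefl (0 : ℝ) (hφs h)
      have h2 : Φ =ᶠ[𝓝 0] fun _ => 0 := by
        have h3 : Tendsto (fun x : EuclideanSpace ℝ (Fin n) => ‖x‖) (𝓝 0) (𝓝 0) :=
          tendsto_norm_zero
        exact h3.eventually h1
      exact contDiffAt_const.congr_of_eventuallyEq h2
    · exact ((hφ.of_le (by exact_mod_cast le_top)).contDiffAt).comp x (contDiffAt_norm ℝ hx)
  have hΦd : Continuous (fderiv ℝ Φ) := hΦs.continuous_fderiv (by simp)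
  have hΦcs : HasCompactSupport Φ := by
    obtain ⟨M, hM⟩ := hφc.isBounded.subset_closedBall 0
    refine HasCompactSupport.intro (isCompact_closedBall (0 : EuclideanSpace ℝ (Fin n)) M)
      fun x hx => ?_
    by_contra hne
    have := hM (subset_tsupport φ hne)
    rw [Metric.mem_closedBall, dist_zero_right, norm_norm] at this
    exact hx (by simpa using this)
  have hΦf : ∀ r, 0 < r → ∀ (ω : S) j, fderiv ℝ Φ (r • ω.1) (EuclideanSpace.single j 1) =
      deriv φ r * ω.1 j := by
    intro r hr ω j
    have hω : ‖ω.1‖ = 1 := by simp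
    have hne : r • ω.1 ≠ 0 := by
      intro h0
      have := congrArg norm h0
      rw [norm_smul, hω, norm_zero, mul_one, norm_eq_zero] at this
      exact hr.ne' this
    have hnr : ‖r • ω.1‖ = r := by rw [norm_smul, hω, mul_one, Real.norm_of_nonneg hr.le]
    have h1 : HasFDerivAt (fun x : EuclideanSpace ℝ (Fin n) => ‖x‖) _ (r • ω.1) :=
      ((contDiffAt_norm (n := 1) ℝ hne).differentiableAt one_ne_zero).hasFDerivAt
    have h2 : HasDerivAt φ (deriv φ r) ‖r • ω.1‖ := by rw [hnr]; exact hφd r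
    have h3 : HasFDerivAt Φ _ (r • ω.1) := h2.comp_hasFDerivAt _ h1
    rw [h3.fderiv]
    have h4 : fderiv ℝ (fun x : EuclideanSpace ℝ (Fin n) => ‖x‖) (r • ω.1)
        (EuclideanSpace.single j 1) = ω.1 j := by
      have h5 := h1.pow 2
      have h6 := congrArg (fun L => L (EuclideanSpace.single j (1 : ℝ)))
        (h5.unique (hasStrictFDerivAt_norm_sq (r • ω.1)).hasFDerivAt)
      simp [hnr, EuclideanSpace.inner_single_right] at h6
      exact mul_left_cancel₀ (mul_pos two_pos hr).ne' (by linarith)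
    simp [h4]
  have hinteg : ∀ {g k : EuclideanSpace ℝ (Fin n) → ℝ}, Continuous g → Continuous k →
      HasCompactSupport k → Integrable (fun x => g x * k x) := fun hg hk hc =>
    (hg.mul hk).integrable_of_hasCompactSupport hc.mul_left
  have hΦdj : ∀ j : Fin n, Continuous fun x => fderiv ℝ Φ x (EuclideanSpace.single j 1) :=
    fun j => by fun_prop
  have hΦcj : ∀ j : Fin n, HasCompactSupport fun x => fderiv ℝ Φ x (EuclideanSpace.single j 1) :=
    fun j => hΦcs.fderiv_apply ℝ _
  have hXdj : ∀ i j : Fin n, Continuous fun x => fderiv ℝ (X i) x (EuclideanSpace.single j 1) :=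
    fun i j => by have := hXd i; fun_prop
  have hibp : ∀ j, ∫ x, X j x * fderiv ℝ Φ x (EuclideanSpace.single j 1) =
      - ∫ x, fderiv ℝ (X j) x (EuclideanSpace.single j 1) * Φ x := fun j =>
    integral_mul_fderiv_eq_neg_fderiv_mul_of_integrable
      (hinteg (hXdj j j) hΦs.continuous hΦcs) (hinteg (hXc j) (hΦdj j) (hΦcj j))
      (hinteg (hXc j) hΦs.continuous hΦcs)
      (fun x _ => (hX j).differentiable (by simp) x) fun x _ => hΦs.differentiable (by simp) x
  have hsum : ∫ x, ∑ j, X j x * fderiv ℝ Φ x (EuclideanSpace.single j 1) =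
      - ∫ x, ∑ j, fderiv ℝ (X j) x (EuclideanSpace.single j 1) * Φ x := by
    rw [integral_finsetSum _ fun j _ => hinteg (hXc j) (hΦdj j) (hΦcj j),
      integral_finsetSum _ fun j _ => hinteg (hXdj j j) hΦs.continuous hΦcs,
      ← Finset.sum_neg_distrib]
    exact Finset.sum_congr rfl fun j _ => hibp j
  rw [integral_eq_integral_sphere volume (integrable_finsetSum _ fun j _ =>
      hinteg (hXc j) (hΦdj j) (hΦcj j)),
    integral_eq_integral_sphere volume (integrable_finsetSum _ fun j _ =>
      hinteg (hXdj j j) hΦs.continuous hΦcs), finrank_euclideanSpace_fin] at hsum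
  have hL : ∫ r in Ioi (0 : ℝ), r ^ (n - 1) * (∫ ω : S, ∑ j, X j (r • ω.1) *
      fderiv ℝ Φ (r • ω.1) (EuclideanSpace.single j 1) ∂σ) =
      ∫ r in Ioi (0 : ℝ), deriv φ r * (r ^ (n - 1) * G r) := by
    refine setIntegral_congr_fun measurableSet_Ioi fun r hr => ?_
    have : ∀ ω : S, ∑ j, X j (r • ω.1) * fderiv ℝ Φ (r • ω.1) (EuclideanSpace.single j 1) =
        deriv φ r * ∑ j, X j (r • ω.1) * ω.1 j := fun ω => by
      rw [Finset.mul_sum]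
      exact Finset.sum_congr rfl fun j _ => by rw [hΦf r hr ω j]; ring
    simp only [this, integral_const_mul]
    ring
  have hRr : ∫ r in Ioi (0 : ℝ), r ^ (n - 1) * (∫ ω : S, ∑ j,
      fderiv ℝ (X j) (r • ω.1) (EuclideanSpace.single j 1) * Φ (r • ω.1) ∂σ) =
      ∫ r in Ioi (0 : ℝ), φ r * (r ^ (n - 1) * B r) := by
    refine setIntegral_congr_fun measurableSet_Ioi fun r hr => ?_
    have : ∀ ω : S, ∑ j, fderiv ℝ (X j) (r • ω.1) (EuclideanSpace.single j 1) * Φ (r • ω.1) =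
        φ r * ∑ j, fderiv ℝ (X j) (r • ω.1) (EuclideanSpace.single j 1) := fun ω => by
      have hω : ‖ω.1‖ = 1 := by simp
      rw [Finset.mul_sum]
      refine Finset.sum_congr rfl fun j _ => ?_
      simp only [hΦ, norm_smul, hω, mul_one, Real.norm_of_nonneg (le_of_lt hr)]
      ring
    simp only [this, integral_const_mul]
    ring
  have hsum2 : ∫ r in Ioi (0 : ℝ), deriv φ r * (r ^ (n - 1) * G r) =
      - ∫ r in Ioi (0 : ℝ), φ r * (r ^ (n - 1) * B r) := by
    rw [← hL, ← hRr]; exact hsum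
  have hext : ∀ (f k : ℝ → ℝ), (∀ r ≤ 0, f r = 0) →
      ∫ r in Ioi (0 : ℝ), f r * k r = ∫ r, f r * k r := fun f k h0 =>
    setIntegral_eq_integral_of_forall_compl_eq_zero fun r hr => by
      rw [h0 r (not_lt.1 hr), zero_mul]
  rw [hext _ _ hdφ0, hext _ _ hφ0] at hsum2
  have hi : ∀ {f k : ℝ → ℝ}, Continuous f → Continuous k → HasCompactSupport f →
      Integrable fun r => f r * k r := fun hf hk hc =>
    (hf.mul hk).integrable_of_hasCompactSupport hc.mul_right
  have hMc : Continuous fun r => r ^ (n - 1) * G r := by fun_prop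
  have hBc' : Continuous fun r => r ^ (n - 1) * B r := by fun_prop
  have hparts : ∫ r, φ r * N r = - ∫ r, deriv φ r * (r ^ (n - 1) * G r) :=
    integral_mul_deriv_eq_deriv_mul_of_integrable (fun r _ => hφd r) (fun r _ => hND r)
      (hi hφ.continuous hNc hφc) (hi hdφc hMc hφc.deriv) (hi hφ.continuous hMc hφc)
  calc ∫ r, φ r • D r = ∫ r, (φ r * N r - φ r * (r ^ (n - 1) * B r)) := by
        simp only [hD, smul_eq_mul, mul_sub]
    _ = 0 := by
        rw [integral_sub (hi hφ.continuous hNc hφc) (hi hφ.continuous hBc' hφc), hparts, hsum2]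
        ring

end Divergence

section SphericalModes

variable {n : ℕ}

/-- The Laplacian of a real-valued function on `ℝⁿ`, as a sum of iterated partial derivatives. -/
noncomputable def realLapl (u : EuclideanSpace ℝ (Fin n) → ℝ) (x : EuclideanSpace ℝ (Fin n)) : ℝ :=
  ∑ j, fderiv ℝ (fun y => fderiv ℝ u y (EuclideanSpace.single j 1)) x (EuclideanSpace.single j 1)

/-- Smooth harmonic functions on `ℝⁿ` which are homogeneous of degree `l`. -/
structure IsSolidHarmonic (l : ℕ) (Y : EuclideanSpace ℝ (Fin n) → ℝ) : Prop where
  contDiff : ContDiff ℝ (⊤ : ℕ∞) Y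
  smul : ∀ (r : ℝ) x, Y (r • x) = r ^ l * Y x
  harmonic : ∀ x, realLapl Y x = 0

/-- The coefficient of `g` restricted to the sphere of radius `r` along `Y`. -/
noncomputable def sphereCoeff (g Y : EuclideanSpace ℝ (Fin n) → ℝ) (r : ℝ) : ℝ :=
  ∫ ω : Metric.sphere (0 : EuclideanSpace ℝ (Fin n)) 1, g (r • ω.1) * Y ω.1 ∂(volume.toSphere)

theorem IsSolidHarmonic.fderiv_self {l : ℕ} {Y : EuclideanSpace ℝ (Fin n) → ℝ}
    (hY : IsSolidHarmonic l Y) (x : EuclideanSpace ℝ (Fin n)) : fderiv ℝ Y x x = l * Y x := by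
  have h1 : HasFDerivAt Y (fderiv ℝ Y x) ((1 : ℝ) • x) := by
    rw [one_smul]; exact (hY.contDiff.differentiable (by simp) _).hasFDerivAt
  have h2 : HasDerivAt (fun r : ℝ => r • x) x 1 := by
    simpa using (hasDerivAt_id (1 : ℝ)).smul_const x
  have h3 : HasDerivAt (fun r : ℝ => Y (r • x)) (fderiv ℝ Y x x) 1 := h1.comp_hasDerivAt _ h2
  have h4 : HasDerivAt (fun r : ℝ => Y (r • x)) (l * Y x) 1 := by
    have := (hasDerivAt_pow l (1 : ℝ)).mul_const (Y x)
    simp only [one_pow, mul_one] at this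
    simpa only [hY.smul] using this
  exact h3.unique h4

theorem fderiv_eq_sum_single {F : Type*} [NormedAddCommGroup F] [NormedSpace ℝ F]
    (L : EuclideanSpace ℝ (Fin n) →L[ℝ] F) (x : EuclideanSpace ℝ (Fin n)) :
    ∑ j, x j • L (EuclideanSpace.single j 1) = L x := by
  conv_rhs => rw [← (EuclideanSpace.basisFun (Fin n) ℝ).sum_repr x]
  simp

/-- The coefficients of a smooth function along a solid harmonic solve the radial equation. -/
theorem exists_sphereCoeff_ode (hn : 2 ≤ n) {l : ℕ} {u Y : EuclideanSpace ℝ (Fin n) → ℝ}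
    (hY : IsSolidHarmonic l Y) (hu : ContDiff ℝ (⊤ : ℕ∞) u) :
    ∃ v₁ v₂ : ℝ → ℝ, (∀ r, HasDerivAt (sphereCoeff u Y) (v₁ r) r) ∧
      (∀ r, HasDerivAt v₁ (v₂ r) r) ∧ Continuous v₂ ∧
      ∀ r, 0 < r → r ^ 2 * v₂ r + (n - 1) * r * v₁ r - l * (l + n - 2) * sphereCoeff u Y r =
        r ^ 2 * sphereCoeff (realLapl u) Y r := by
  set S := Metric.sphere (0 : EuclideanSpace ℝ (Fin n)) 1
  set σ : Measure S := volume.toSphere with hσ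
  have hY0 : Continuous Y := hY.contDiff.continuous
  have hu0 : Continuous u := hu.continuous
  have hu' : ContDiff ℝ (⊤ : ℕ∞) (fderiv ℝ u) := hu.fderiv_right (by simp)
  have hu1 : Continuous (fderiv ℝ u) := hu'.continuous
  have hu2 : Continuous (fderiv ℝ (fderiv ℝ u)) := hu'.continuous_fderiv (by simp)
  have hsm : ∀ (r : ℝ) (ω : S), HasDerivAt (fun r : ℝ => r • ω.1) ω.1 r := fun r ω => by
    simpa using (hasDerivAt_id r).smul_const ω.1
  set v₁ : ℝ → ℝ := fun r => ∫ ω : S, fderiv ℝ u (r • ω.1) ω.1 * Y ω.1 ∂σ with hv₁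
  set v₂ : ℝ → ℝ := fun r => ∫ ω : S, fderiv ℝ (fderiv ℝ u) (r • ω.1) ω.1 ω.1 * Y ω.1 ∂σ with hv₂
  have hd1 : ∀ r, HasDerivAt (sphereCoeff u Y) (v₁ r) r := by
    refine hasDerivAt_integral_of_continuous_deriv σ ?_ ?_ fun r ω => ?_
    · unfold Function.uncurry; fun_prop
    · unfold Function.uncurry; fun_prop
    · exact (((hu.differentiable (by simp) _).hasFDerivAt).comp_hasDerivAt r (hsm r ω)).mul_const _
  have hd2 : ∀ r, HasDerivAt v₁ (v₂ r) r := by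
    refine hasDerivAt_integral_of_continuous_deriv σ ?_ ?_ fun r ω => ?_
    · unfold Function.uncurry; fun_prop
    · unfold Function.uncurry; fun_prop
    · refine HasDerivAt.mul_const ?_ _
      have h1 := ((hu'.differentiable (by simp) (r • ω.1)).hasFDerivAt).comp_hasDerivAt r (hsm r ω)
      simpa using h1.clm_apply (hasDerivAt_const r ω.1)
  have hc2 : Continuous v₂ := by
    refine continuous_integral_of_continuous σ ?_
    unfold Function.uncurry; fun_prop
  refine ⟨v₁, v₂, hd1, hd2, hc2, fun r hr => ?_⟩
  set X : Fin n → EuclideanSpace ℝ (Fin n) → ℝ := fun j x =>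
    Y x * fderiv ℝ u x (EuclideanSpace.single j 1) -
      u x * fderiv ℝ Y x (EuclideanSpace.single j 1) with hX
  have hY' : ContDiff ℝ (⊤ : ℕ∞) (fderiv ℝ Y) := hY.contDiff.fderiv_right (by simp)
  have huj : ∀ j : Fin n, ContDiff ℝ (⊤ : ℕ∞) fun x => fderiv ℝ u x (EuclideanSpace.single j 1) :=
    fun j => hu'.clm_apply contDiff_const
  have hYj : ∀ j : Fin n, ContDiff ℝ (⊤ : ℕ∞) fun x => fderiv ℝ Y x (EuclideanSpace.single j 1) :=
    fun j => hY'.clm_apply contDiff_const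
  have hXs : ∀ j, ContDiff ℝ (⊤ : ℕ∞) (X j) := fun j =>
    (hY.contDiff.mul (huj j)).sub (hu.mul (hYj j))
  have hdiv : ∀ x, ∑ j, fderiv ℝ (X j) x (EuclideanSpace.single j 1) = Y x * realLapl u x := by
    intro x
    have h1 : ∀ j, fderiv ℝ (X j) x (EuclideanSpace.single j 1) =
        Y x * fderiv ℝ (fun y => fderiv ℝ u y (EuclideanSpace.single j 1)) x
          (EuclideanSpace.single j 1) -
        u x * fderiv ℝ (fun y => fderiv ℝ Y y (EuclideanSpace.single j 1)) x
          (EuclideanSpace.single j 1) := by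
      intro j
      have a1 := (hY.contDiff.differentiable (by simp) x).hasFDerivAt
      have a2 := (hu.differentiable (by simp) x).hasFDerivAt
      have a3 := ((huj j).differentiable (by simp) x).hasFDerivAt
      have a4 := ((hYj j).differentiable (by simp) x).hasFDerivAt
      have a5 : HasFDerivAt (X j) _ x := (a1.mul a3).sub (a2.mul a4)
      rw [a5.fderiv]
      simp
      ring
    simp only [h1, Finset.sum_sub_distrib, ← Finset.mul_sum]
    have := hY.harmonic x
    simp only [realLapl] at this ⊢
    rw [this]; ring
  have hflux : ∀ r, 0 < r → r * (r ^ (n - 1) * ∫ ω : S, ∑ j, X j (r • ω.1) * ω.1 j ∂σ) =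
      r ^ (n - 1 + l) * (r * v₁ r - l * sphereCoeff u Y r) := by
    intro r hr
    have h1 : ∀ ω : S, ∑ j, X j (r • ω.1) * ω.1 j = r ^ l * (fderiv ℝ u (r • ω.1) ω.1 * Y ω.1) -
        r⁻¹ * (l * r ^ l) * (u (r • ω.1) * Y ω.1) := by
      intro ω
      have e1 : ∑ j, X j (r • ω.1) * ω.1 j = Y (r • ω.1) * fderiv ℝ u (r • ω.1) ω.1 -
          u (r • ω.1) * fderiv ℝ Y (r • ω.1) ω.1 := by
        rw [← fderiv_eq_sum_single (fderiv ℝ u (r • ω.1)) ω.1,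
          ← fderiv_eq_sum_single (fderiv ℝ Y (r • ω.1)) ω.1, Finset.mul_sum, Finset.mul_sum,
          ← Finset.sum_sub_distrib]
        refine Finset.sum_congr rfl fun j _ => ?_
        simp only [hX, smul_eq_mul]
        ring
      have e2 : fderiv ℝ Y (r • ω.1) ω.1 = r⁻¹ * (l * (r ^ l * Y ω.1)) := by
        rw [← hY.smul, ← hY.fderiv_self, map_smul, smul_eq_mul, inv_mul_cancel_left₀ hr.ne']
      rw [e1, e2, hY.smul]
      ring
    simp only [h1]
    rw [integral_sub, integral_const_mul, integral_const_mul]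
    · simp only [hv₁, sphereCoeff]
      rw [pow_add]
      field_simp
      rfl
    · exact (Continuous.integrable_of_hasCompactSupport (by fun_prop)
        (HasCompactSupport.of_compactSpace _))
    · exact (Continuous.integrable_of_hasCompactSupport (by fun_prop)
        (HasCompactSupport.of_compactSpace _))
  have hdF := hasDerivAt_sphere_flux hn hXs hr
  have hB : ∫ ω : S, ∑ j, fderiv ℝ (X j) (r • ω.1) (EuclideanSpace.single j 1) ∂σ =
      r ^ l * sphereCoeff (realLapl u) Y r := by
    simp only [hdiv, hY.smul, sphereCoeff]
    rw [← integral_const_mul]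
    refine integral_congr_ae (Eventually.of_forall fun ω => ?_)
    ring
  rw [hB] at hdF
  have hH1 := ((hasDerivAt_id r).mul hdF).congr_of_eventuallyEq
    (f₁ := fun r => r ^ (n - 1 + l) * (r * v₁ r - l * sphereCoeff u Y r))
    (by filter_upwards [Ioi_mem_nhds hr] with t ht using (hflux t ht).symm)
  have hH2 : HasDerivAt (fun r => r ^ (n - 1 + l) * (r * v₁ r - l * sphereCoeff u Y r))
      (((n - 1 + l : ℕ) : ℝ) * r ^ (n - 1 + l - 1) * (r * v₁ r - l * sphereCoeff u Y r) +
        r ^ (n - 1 + l) * (1 * v₁ r + r * v₂ r - l * v₁ r)) r := (hasDerivAt_pow (n - 1 + l) r).mul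
    (((hasDerivAt_id r).mul (hd2 r)).sub ((hd1 r).const_mul (l : ℝ)))
  have hH := hH1.unique hH2
  have hf := hflux r hr
  obtain ⟨k, rfl⟩ : ∃ k, n = k + 2 := ⟨n - 2, by omega⟩
  have e3 : k + 2 - 1 + l = k + l + 1 := by omega
  have e4 : k + 2 - 1 = k + 1 := by omega
  rw [e3, e4] at hf
  simp only [id, e4, one_mul, show k + 1 + l - 1 = k + l by omega] at hH
  apply mul_left_cancel₀ (pow_pos hr (k + l + 1)).ne'
  push_cast at hH ⊢
  linear_combination (exp := 1) (-r) * hH + hf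

end SphericalModes

section PolynomialHarmonics

variable {n : ℕ}

theorem IsSolidHarmonic.integral_mul_eq_zero (hn : 2 ≤ n) {k l : ℕ} (hkl : k ≠ l)
    {Z Y : EuclideanSpace ℝ (Fin n) → ℝ} (hZ : IsSolidHarmonic k Z) (hY : IsSolidHarmonic l Y) :
    ∫ ω : Metric.sphere (0 : EuclideanSpace ℝ (Fin n)) 1, Z ω.1 * Y ω.1 ∂(volume.toSphere) = 0 := by
  obtain ⟨v₁, v₂, h1, h2, -, hode⟩ := exists_sphereCoeff_ode hn hY hZ.contDiff
  set c := ∫ ω : Metric.sphere (0 : EuclideanSpace ℝ (Fin n)) 1, Z ω.1 * Y ω.1 ∂(volume.toSphere)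
  have hv : sphereCoeff Z Y = fun r => r ^ k * c := by
    funext r
    simp only [sphereCoeff, hZ.smul, mul_assoc, integral_const_mul, c]
  have hw : sphereCoeff (realLapl Z) Y = fun _ => 0 := by
    funext r
    simp [sphereCoeff, hZ.harmonic]
  have hv1 : v₁ = fun r => (k * r ^ (k - 1)) * c := by
    funext r
    have := h1 r
    rw [hv] at this
    exact this.unique ((hasDerivAt_pow k r).mul_const c)
  have hv2 : v₂ 1 = (k * (((k - 1 : ℕ) : ℝ) * 1 ^ (k - 1 - 1))) * c := by
    have := h2 1
    rw [hv1] at this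
    exact this.unique (((hasDerivAt_pow (k - 1) (1 : ℝ)).const_mul (k : ℝ)).mul_const c)
  have h := hode 1 one_pos
  rw [hv, hw, hv1, hv2] at h
  have hk : (k : ℝ) * ((k - 1 : ℕ) : ℝ) = k * (k - 1) := by
    rcases k with _ | k <;> simp
  simp only [one_pow, mul_one, one_mul, mul_zero, hk] at h
  have hz : ((k : ℝ) - l) * ((k + l + n - 2) * c) = 0 := by linear_combination h
  have hne : (k : ℝ) - l ≠ 0 := sub_ne_zero.2 (by exact_mod_cast hkl)
  have hpos : (0 : ℝ) < k + l + n - 2 := by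
    have : 1 ≤ k + l := by omega
    have h1 : (1 : ℝ) ≤ k + l := by exact_mod_cast this
    have h2 : (2 : ℝ) ≤ n := by exact_mod_cast hn
    linarith
  exact ((mul_eq_zero.1 ((mul_eq_zero.1 hz).resolve_left hne)).resolve_left hpos.ne')

open MvPolynomial in
theorem MvPolynomial.hasFDerivAt_eval_ofLp (P : MvPolynomial (Fin n) ℝ)
    (x : EuclideanSpace ℝ (Fin n)) :
    HasFDerivAt (fun x : EuclideanSpace ℝ (Fin n) => eval x.ofLp P)
      (∑ j, eval x.ofLp (pderiv j P) • (EuclideanSpace.proj j : _ →L[ℝ] ℝ)) x := by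
  induction P using MvPolynomial.induction_on with
  | C a => simpa using hasFDerivAt_const a x
  | add p q hp hq =>
    simp only [map_add, add_smul, Finset.sum_add_distrib]
    exact hp.add hq
  | mul_X p i hp =>
    have h1 : HasFDerivAt (fun x : EuclideanSpace ℝ (Fin n) => x i)
      (EuclideanSpace.proj i : EuclideanSpace ℝ (Fin n) →L[ℝ] ℝ) x :=
      (EuclideanSpace.proj i : EuclideanSpace ℝ (Fin n) →L[ℝ] ℝ).hasFDerivAt
    have h2 := hp.mul h1
    simp only [map_mul, eval_X]
    refine h2.congr_fderiv ?_
    ext v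
    simp [Derivation.leibniz, pderiv_X, Finset.sum_add_distrib, Finset.mul_sum, Pi.single_apply,
      add_mul, mul_assoc, ite_mul, apply_ite]

open MvPolynomial

/-- The formal Laplacian on polynomials. -/
noncomputable def polyLapl (n : ℕ) : MvPolynomial (Fin n) ℝ →ₗ[ℝ] MvPolynomial (Fin n) ℝ :=
  ∑ j, (pderiv j).toLinearMap ∘ₗ (pderiv j).toLinearMap

theorem polyLapl_apply (P : MvPolynomial (Fin n) ℝ) :
    polyLapl n P = ∑ j, pderiv j (pderiv j P) := by
  simp [polyLapl]

/-- Homogeneous harmonic polynomials of degree `k`. -/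
noncomputable def harmonicSubmodule (n k : ℕ) : Submodule ℝ (MvPolynomial (Fin n) ℝ) :=
  homogeneousSubmodule (Fin n) ℝ k ⊓ LinearMap.ker (polyLapl n)

theorem fderiv_eval_single (P : MvPolynomial (Fin n) ℝ) (x : EuclideanSpace ℝ (Fin n)) (j : Fin n) :
    fderiv ℝ (fun x : EuclideanSpace ℝ (Fin n) => eval x.ofLp P) x (EuclideanSpace.single j 1) =
      eval x.ofLp (pderiv j P) := by
  rw [(P.hasFDerivAt_eval_ofLp x).fderiv]
  simp

theorem contDiff_eval_ofLp (P : MvPolynomial (Fin n) ℝ) :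
    ContDiff ℝ (⊤ : ℕ∞) fun x : EuclideanSpace ℝ (Fin n) => eval x.ofLp P := by
  induction P using MvPolynomial.induction_on with
  | C a => simpa using contDiff_const
  | add p q hp hq => simpa using hp.add hq
  | mul_X p i hp =>
    simp only [map_mul, eval_X]
    exact hp.mul (EuclideanSpace.proj i : EuclideanSpace ℝ (Fin n) →L[ℝ] ℝ).contDiff

theorem isSolidHarmonic_eval {k : ℕ} {P : MvPolynomial (Fin n) ℝ} (hP : P ∈ harmonicSubmodule n k) :
    IsSolidHarmonic k fun x : EuclideanSpace ℝ (Fin n) => eval x.ofLp P where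
  contDiff := contDiff_eval_ofLp P
  smul r x := by
    rw [eval_eq', eval_eq', Finset.mul_sum]
    refine Finset.sum_congr rfl fun d hd => ?_
    have h1 : d.degree = k := by
      by_contra h
      exact mem_support_iff.1 hd (((mem_homogeneousSubmodule _ _).1 hP.1).coeff_eq_zero h)
    simp only [PiLp.smul_apply, smul_eq_mul, mul_pow, Finset.prod_mul_distrib,
      Finset.prod_pow_eq_pow_sum]
    rw [← Finsupp.degree_eq_sum, h1]
    ring
  harmonic x := by
    have h := LinearMap.mem_ker.1 hP.2
    rw [polyLapl_apply] at h
    simp only [realLapl, fderiv_eval_single]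
    rw [← map_sum, h, map_zero]

/-- The squared norm, as a polynomial. -/
noncomputable def polyNormSq (n : ℕ) : MvPolynomial (Fin n) ℝ := ∑ j, X j ^ 2

theorem polyNormSq_isHomogeneous : (polyNormSq n).IsHomogeneous 2 :=
  IsHomogeneous.sum _ _ _ fun j _ => by simpa using (isHomogeneous_X ℝ j).pow 2

theorem polyLapl_polyNormSq_mul {d : ℕ} {Q : MvPolynomial (Fin n) ℝ} (hQ : Q.IsHomogeneous d) :
    polyLapl n (polyNormSq n * Q) = C (2 * n + 4 * d : ℝ) * Q + polyNormSq n * polyLapl n Q := by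
  have h1 : ∀ j, pderiv j (polyNormSq n) = 2 * X j := fun j => by
    simp [polyNormSq, Derivation.leibniz_pow, pderiv_X, Pi.single_apply]
  have h2 : ∀ j, pderiv j (pderiv j (polyNormSq n * Q)) =
      2 * Q + 4 * (X j * pderiv j Q) + polyNormSq n * pderiv j (pderiv j Q) := fun j => by
    have h3 : pderiv j (2 : MvPolynomial (Fin n) ℝ) = 0 := by
      rw [← map_ofNat (C : ℝ →+* MvPolynomial (Fin n) ℝ) 2]
      exact pderiv_C
    simp only [Derivation.leibniz, h1, map_add, smul_eq_mul, pderiv_X_self, h3]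
    ring
  have h4 := hQ.sum_X_mul_pderiv
  simp only [polyLapl_apply, h2, Finset.sum_add_distrib, ← Finset.mul_sum, h4]
  have h5 : (C (2 * n + 4 * d : ℝ) : MvPolynomial (Fin n) ℝ) = 2 * n + 4 * d := by
    simp only [map_add, map_mul, map_ofNat, map_natCast]
  rw [h5]
  simp
  ring

theorem exists_polyLapl_polyNormSq_pow_mul (hn : 0 < n) {i : ℕ} {H : MvPolynomial (Fin n) ℝ}
    (hH : H ∈ harmonicSubmodule n i) (j : ℕ) :
    ∃ c : ℝ, 0 < c ∧ polyLapl n (polyNormSq n ^ (j + 1) * H) = C c * (polyNormSq n ^ j * H) := by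
  have hn' : (0 : ℝ) < n := by exact_mod_cast hn
  induction j with
  | zero =>
    refine ⟨2 * n + 4 * i, by positivity, ?_⟩
    have := LinearMap.mem_ker.1 hH.2
    simp [polyLapl_polyNormSq_mul ((mem_homogeneousSubmodule _ _).1 hH.1), this]
  | succ j ih =>
    obtain ⟨c, hc, h⟩ := ih
    have hd : (polyNormSq n ^ (j + 1) * H).IsHomogeneous (2 * (j + 1) + i) :=
      (polyNormSq_isHomogeneous.pow _).mul ((mem_homogeneousSubmodule _ _).1 hH.1)
    refine ⟨2 * n + 4 * (2 * (j + 1) + i : ℕ) + c, by positivity, ?_⟩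
    rw [pow_succ', mul_assoc, polyLapl_polyNormSq_mul hd, h, C_add (a := 2 * (n : ℝ) + 4 * (2 * (j + 1) + i : ℕ))]
    ring

/-- Span of the products `|x|^(2j) H` of total degree `k` with `H` harmonic. -/
noncomputable def fischerSubmodule (n k : ℕ) : Submodule ℝ (MvPolynomial (Fin n) ℝ) :=
  Submodule.span ℝ {P | ∃ j i H, 2 * j + i = k ∧ H ∈ harmonicSubmodule n i ∧ P = polyNormSq n ^ j * H}

theorem homogeneousSubmodule_le_fischerSubmodule (hn : 0 < n) (k : ℕ) :
    homogeneousSubmodule (Fin n) ℝ k ≤ fischerSubmodule n k := by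
  have hhom : ∀ k, fischerSubmodule n k ≤ homogeneousSubmodule (Fin n) ℝ k := fun k =>
    Submodule.span_le.2 <| by
      rintro _ ⟨j, i, H, rfl, hH, rfl⟩
      exact (polyNormSq_isHomogeneous.pow _).mul ((mem_homogeneousSubmodule _ _).1 hH.1)
  have hharm : ∀ k, harmonicSubmodule n k ≤ fischerSubmodule n k := fun k H hH =>
    Submodule.subset_span ⟨0, k, H, by simp, hH, by simp⟩
  have hsurj : ∀ k, fischerSubmodule n k ≤ (fischerSubmodule n (k + 2)).map (polyLapl n) :=
    fun k => Submodule.span_le.2 <| by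
      rintro _ ⟨j, i, H, rfl, hH, rfl⟩
      obtain ⟨c, hc, h⟩ := exists_polyLapl_polyNormSq_pow_mul hn hH j
      refine ⟨c⁻¹ • (polyNormSq n ^ (j + 1) * H), Submodule.smul_mem _ _
        (Submodule.subset_span ⟨j + 1, i, H, by ring, hH, rfl⟩), ?_⟩
      rw [map_smul, h, smul_eq_C_mul, ← mul_assoc, ← C_mul, inv_mul_cancel₀ hc.ne', C_1, one_mul]
  induction k using Nat.strong_induction_on with
  | _ k ih =>
    intro P hP
    have hP' := (mem_homogeneousSubmodule _ _).1 hP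
    rcases lt_or_ge k 2 with hk | hk
    · refine hharm k ⟨hP, LinearMap.mem_ker.2 ?_⟩
      rw [polyLapl_apply]
      refine Finset.sum_eq_zero fun j _ => ?_
      have h1 : (pderiv j P).IsHomogeneous 0 := by
        have := hP'.pderiv (i := j)
        rwa [show k - 1 = 0 by omega] at this
      rw [(totalDegree_eq_zero_iff_eq_C (p := pderiv j P)).1 (by
        simpa using h1.totalDegree_le), pderiv_C]
    · obtain ⟨m, rfl⟩ := Nat.exists_eq_add_of_le' hk
      have h1 : polyLapl n P ∈ homogeneousSubmodule (Fin n) ℝ m := by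
        rw [polyLapl_apply]
        refine Submodule.sum_mem _ fun j _ => ?_
        simpa using (hP'.pderiv (i := j)).pderiv (i := j)
      obtain ⟨P', hP1, hP2⟩ := hsurj m (ih m (by omega) h1)
      have h2 : P - P' ∈ harmonicSubmodule n (m + 2) :=
        ⟨Submodule.sub_mem _ hP (hhom _ hP1), by simp [hP2]⟩
      simpa using Submodule.add_mem _ (hharm _ h2) hP1

end PolynomialHarmonics

/-- Finite-dimensional pairwise orthogonal subspaces with dense span carry a joint Hilbert basis. -/
theorem exists_hasSum_inner_sq {M H : Type*} [AddCommGroup M] [Module ℝ M]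
    [NormedAddCommGroup H] [InnerProductSpace ℝ H] [CompleteSpace H] (L : M →ₗ[ℝ] H)
    (A : ℕ → Submodule ℝ M) (hfin : ∀ k, FiniteDimensional ℝ (A k))
    (horth : ∀ k l, k ≠ l → ∀ P ∈ A k, ∀ Q ∈ A l, inner ℝ (L P) (L Q) = 0)
    (hdense : (⨆ k, (A k).map L).topologicalClosure = ⊤) :
    ∃ (ι : Type) (_ : Countable ι) (deg : ι → ℕ) (P : ι → M), (∀ a, P a ∈ A (deg a)) ∧
      ∀ G : H, HasSum (fun a => (inner ℝ G (L (P a))) ^ 2) (inner ℝ G G) := by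
  set W : ℕ → Submodule ℝ H := fun k => (A k).map L with hW
  have hfd : ∀ k, FiniteDimensional ℝ (W k) := fun k => Module.Finite.map _ _
  have horth' : OrthogonalFamily ℝ (fun k => W k) fun k => (W k).subtypeₗᵢ := by
    rintro k l hkl ⟨_, P, hP, rfl⟩ ⟨_, Q, hQ, rfl⟩
    exact horth k l hkl P hP Q hQ
  set b : (Σ k, Fin (Module.finrank ℝ (W k))) → H :=
    fun a => (stdOrthonormalBasis ℝ (W a.1) a.2 : W a.1) with hb
  have hon : Orthonormal ℝ b :=
    horth'.orthonormal_sigma_orthonormal fun k => (stdOrthonormalBasis ℝ (W k)).orthonormal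
  have hspan : ⊤ ≤ (Submodule.span ℝ (range b)).topologicalClosure := by
    rw [← hdense]
    refine Submodule.topologicalClosure_mono (iSup_le fun k x hx => ?_)
    have h2 := congrArg Subtype.val ((stdOrthonormalBasis ℝ (W k)).sum_repr ⟨x, hx⟩)
    simp only [Submodule.coe_sum, Submodule.coe_smul] at h2
    rw [← h2]
    exact Submodule.sum_mem _ fun i _ => Submodule.smul_mem _ _
      (Submodule.subset_span ⟨⟨k, i⟩, rfl⟩)
  have hex : ∀ a : Σ k, Fin (Module.finrank ℝ (W k)), ∃ P ∈ A a.1, L P = b a := fun a =>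
    (stdOrthonormalBasis ℝ (W a.1) a.2).2
  choose P hP hPb using hex
  refine ⟨_, inferInstance, fun a => a.1, P, hP, fun G => ?_⟩
  have h := (HilbertBasis.mk hon hspan).hasSum_inner_mul_inner G G
  simp only [HilbertBasis.coe_mk] at h
  convert! h using 2 with a
  rw [real_inner_comm G (b a), hPb, pow_two]

section SphereBasis

open MvPolynomial

variable {n : ℕ}

/-- Restriction of polynomials to the unit sphere, as continuous functions. -/
noncomputable def sphereEval (n : ℕ) :
    MvPolynomial (Fin n) ℝ →ₐ[ℝ] C(Metric.sphere (0 : EuclideanSpace ℝ (Fin n)) 1, ℝ) :=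
  aeval fun i => ⟨fun ω => ω.1 i, by fun_prop⟩

theorem sphereEval_apply (P : MvPolynomial (Fin n) ℝ)
    (ω : Metric.sphere (0 : EuclideanSpace ℝ (Fin n)) 1) :
    sphereEval n P ω = eval ω.1.ofLp P := by
  induction P using MvPolynomial.induction_on with
  | C a => simp [sphereEval]
  | add p q hp hq => simp [hp, hq]
  | mul_X p i hp => simp [hp]; simp [sphereEval]

theorem sphereEval_polyNormSq : sphereEval n (polyNormSq n) = 1 := by
  ext ω
  have h : ‖ω.1‖ ^ 2 = 1 := by simp
  rw [EuclideanSpace.norm_sq_eq] at h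
  simpa [sphereEval_apply, polyNormSq] using h

/-- Restriction of polynomials to the unit sphere, as square integrable functions. -/
noncomputable def sphereLp (n : ℕ) : MvPolynomial (Fin n) ℝ →ₗ[ℝ]
    Lp ℝ 2 (volume : Measure (EuclideanSpace ℝ (Fin n))).toSphere :=
  (ContinuousMap.toLp (E := ℝ) 2 (volume : Measure (EuclideanSpace ℝ (Fin n))).toSphere
    ℝ).toLinearMap ∘ₗ (sphereEval n).toLinearMap

theorem sphereLp_mem_iSup (hn : 0 < n) (P : MvPolynomial (Fin n) ℝ) :
    sphereLp n P ∈ ⨆ k, (harmonicSubmodule n k).map (sphereLp n) := by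
  rw [← sum_homogeneousComponent P, map_sum]
  refine Submodule.sum_mem _ fun k _ => ?_
  have h1 := homogeneousSubmodule_le_fischerSubmodule hn k (homogeneousComponent_mem k P)
  have h2 : fischerSubmodule n k ≤
      (⨆ k, (harmonicSubmodule n k).map (sphereLp n)).comap (sphereLp n) :=
    Submodule.span_le.2 <| by
      rintro _ ⟨j, i, H, rfl, hH, rfl⟩
      have h3 : sphereLp n (polyNormSq n ^ j * H) = sphereLp n H := by
        simp [sphereLp, sphereEval_polyNormSq]
      change sphereLp n _ ∈ ⨆ k, (harmonicSubmodule n k).map (sphereLp n)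
      rw [h3]
      exact Submodule.mem_iSup_of_mem i (Submodule.mem_map_of_mem hH)
  exact h2 h1

theorem topologicalClosure_iSup_harmonic (hn : 0 < n) :
    (⨆ k, (harmonicSubmodule n k).map (sphereLp n)).topologicalClosure = ⊤ := by
  have h1 : DenseRange (sphereEval n) := by
    have h2 : (sphereEval n).range.topologicalClosure = ⊤ := by
      refine ContinuousMap.subalgebra_topologicalClosure_eq_top_of_separatesPoints _ ?_
      intro x y hxy
      by_contra! h
      refine hxy (Subtype.ext (PiLp.ext fun i => ?_))
      have := h (sphereEval n (X i)) ⟨_, ⟨X i, rfl⟩, rfl⟩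
      simpa [sphereEval_apply] using this
    rw [DenseRange, dense_iff_closure_eq]
    have h3 := congrArg (fun A : Subalgebra ℝ _ =>
      (A : Set C(Metric.sphere (0 : EuclideanSpace ℝ (Fin n)) 1, ℝ))) h2
    simpa using h3
  have h4 : DenseRange (sphereLp n) :=
    (ContinuousMap.toLp_denseRange ℝ (volume : Measure (EuclideanSpace ℝ (Fin n))).toSphere ℝ
      (p := 2) (by simp)).comp h1 (ContinuousLinearMap.continuous _)
  rw [← top_le_iff]
  intro x _
  exact closure_mono (range_subset_iff.2 (sphereLp_mem_iSup hn)) (h4 x)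

theorem inner_sphereLp (P Q : MvPolynomial (Fin n) ℝ) :
    inner ℝ (sphereLp n P) (sphereLp n Q) =
      ∫ ω : Metric.sphere (0 : EuclideanSpace ℝ (Fin n)) 1,
        eval ω.1.ofLp P * eval ω.1.ofLp Q ∂(volume.toSphere) := by
  refine (ContinuousMap.inner_toLp _ _ _).trans ?_
  simp [sphereEval_apply, mul_comm]

/-- Parseval's identity on the unit sphere for an orthonormal basis of solid harmonics. -/
theorem exists_harmonic_parseval (hn : 2 ≤ n) :
    ∃ (ι : Type) (_ : Countable ι) (deg : ι → ℕ) (Y : ι → EuclideanSpace ℝ (Fin n) → ℝ),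
      (∀ i, IsSolidHarmonic (deg i) (Y i)) ∧
      ∀ g : Metric.sphere (0 : EuclideanSpace ℝ (Fin n)) 1 → ℝ, Continuous g →
        HasSum (fun i => (∫ ω, g ω * Y i ω.1 ∂(volume.toSphere)) ^ 2)
          (∫ ω, g ω ^ 2 ∂(volume.toSphere)) := by
  obtain ⟨ι, hι, deg, P, hP, hsum⟩ := exists_hasSum_inner_sq (sphereLp n) (harmonicSubmodule n)
    (fun k => by
      have h1 : FiniteDimensional ℝ (homogeneousSubmodule (Fin n) ℝ k) :=
        Module.Finite.iff_fg.2 (homogeneousSubmodule_fg (Fin n) ℝ k)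
      exact Submodule.finiteDimensional_of_le inf_le_left)
    (fun k l hkl P hP Q hQ => by
      rw [inner_sphereLp]
      exact (isSolidHarmonic_eval hP).integral_mul_eq_zero hn hkl (isSolidHarmonic_eval hQ))
    (topologicalClosure_iSup_harmonic (by omega))
  refine ⟨ι, hι, deg, fun a x => eval x.ofLp (P a), fun a => isSolidHarmonic_eval (hP a),
    fun g hg => ?_⟩
  have h := hsum (ContinuousMap.toLp (E := ℝ) 2
    (volume : Measure (EuclideanSpace ℝ (Fin n))).toSphere ℝ ⟨g, hg⟩)
  have h1 : ∀ f : C(Metric.sphere (0 : EuclideanSpace ℝ (Fin n)) 1, ℝ),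
      inner ℝ (ContinuousMap.toLp (E := ℝ) 2
        (volume : Measure (EuclideanSpace ℝ (Fin n))).toSphere ℝ ⟨g, hg⟩)
      (ContinuousMap.toLp (E := ℝ) 2
        (volume : Measure (EuclideanSpace ℝ (Fin n))).toSphere ℝ f) =
      ∫ ω, g ω * f ω ∂(volume.toSphere) := fun f => by
    refine (ContinuousMap.inner_toLp _ _ _).trans ?_
    simp [mul_comm]
  have h2 : ∀ Q, sphereLp n Q = ContinuousMap.toLp (E := ℝ) 2
        (volume : Measure (EuclideanSpace ℝ (Fin n))).toSphere ℝ (sphereEval n Q) := fun Q => rfl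
  simp only [h2, h1, sphereEval_apply, ContinuousMap.coe_mk] at h
  simpa only [pow_two] using h

end SphereBasis

section ModeReduction

variable {n : ℕ}

theorem hasDerivAt_rpow_mul {ν r v v' : ℝ} {f : ℝ → ℝ} (hr : 0 < r) (hf : HasDerivAt f v' r)
    (hv : f r = v) : HasDerivAt (fun r => r ^ ν * f r) (r ^ ν * (v' + ν * v / r)) r := by
  have h := (Real.hasDerivAt_rpow_const (p := ν) (Or.inl hr.ne')).mul hf
  refine h.congr_deriv ?_
  rw [hv, Real.rpow_sub_one hr.ne']
  field_simp
  ring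

/-- Second-order radial equation for `r ^ ((n - 1) / 2)` times a coefficient. -/
theorem exists_radial_ode (hn : 2 ≤ n) {l : ℕ} {u Y : EuclideanSpace ℝ (Fin n) → ℝ} {T' T : ℝ}
    (hY : IsSolidHarmonic l Y) (hu : ContDiff ℝ (⊤ : ℕ∞) u) (hT' : 0 < T') (hT : T' < T)
    (husupp : ∀ x, T' ≤ ‖x‖ → u x = 0) {ν κ : ℝ} (hν : ν = (n - 1) / 2)
    (hκ : κ = l * (l + n - 2) + ν * (ν - 1)) :
    ∃ v₁ p₂ : ℝ → ℝ, Continuous (sphereCoeff u Y) ∧ Continuous v₁ ∧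
      (∀ r, 0 < r → HasDerivAt (fun r => r ^ ν * sphereCoeff u Y r)
        (r ^ ν * (v₁ r + ν * sphereCoeff u Y r / r)) r) ∧
      (∀ r, 0 < r → HasDerivAt (fun r => r ^ ν * (v₁ r + ν * sphereCoeff u Y r / r)) (p₂ r) r) ∧
      ContinuousOn p₂ (Ioi 0) ∧
      (∀ r, 0 < r → p₂ r = κ / r ^ 2 * (r ^ ν * sphereCoeff u Y r) +
        r ^ ν * sphereCoeff (realLapl u) Y r) ∧
      sphereCoeff u Y T = 0 ∧ v₁ T = 0 := by
  obtain ⟨v₁, v₂, h1, h2, hc2, hode⟩ := exists_sphereCoeff_ode hn hY hu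
  set v := sphereCoeff u Y with hv
  have hc : Continuous v := continuous_iff_continuousAt.2 fun r => (h1 r).continuousAt
  have hc1 : Continuous v₁ := continuous_iff_continuousAt.2 fun r => (h2 r).continuousAt
  have hz : ∀ r, T' < r → v r = 0 := fun r hr => by
    have : ∀ ω : Metric.sphere (0 : EuclideanSpace ℝ (Fin n)) 1, u (r • ω.1) = 0 := fun ω =>
      husupp _ (by simp [norm_smul, abs_of_pos (hT'.trans hr), hr.le])
    simp [hv, sphereCoeff, this]
  refine ⟨v₁, fun r => r ^ ν * (v₂ r + 2 * ν * v₁ r / r + ν * (ν - 1) * v r / r ^ 2), hc, hc1,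
    fun r hr => hasDerivAt_rpow_mul hr (h1 r) rfl, fun r hr => ?_, ?_, fun r hr => ?_, hz T hT, ?_⟩
  · have h3 : HasDerivAt (fun r => v₁ r + ν * v r / r)
        (v₂ r + (ν * v₁ r * r - ν * v r * 1) / r ^ 2) r :=
      (h2 r).add (((h1 r).const_mul ν).div (hasDerivAt_id r) hr.ne')
    refine (hasDerivAt_rpow_mul (ν := ν) hr h3 rfl).congr_deriv ?_
    field_simp
    ring
  · refine ContinuousOn.mul (fun r hr => (Real.continuousAt_rpow_const r ν
      (Or.inl (ne_of_gt hr))).continuousWithinAt) ?_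
    refine (hc2.continuousOn.add ((by fun_prop : ContinuousOn (fun r => 2 * ν * v₁ r) _).div
      continuousOn_id fun r hr => ne_of_gt hr)).add
      ((by fun_prop : ContinuousOn (fun r => ν * (ν - 1) * v r) _).div
      (by fun_prop) fun r hr => pow_ne_zero 2 (ne_of_gt hr))
  · have h3 := hode r hr
    have h4 : (n : ℝ) - 1 = 2 * ν := by rw [hν]; ring
    rw [h4] at h3
    have h5 : sphereCoeff (realLapl u) Y r =
        (r ^ 2 * v₂ r + 2 * ν * r * v₁ r - l * (l + n - 2) * v r) / r ^ 2 := by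
      rw [h3]; field_simp
    simp only [h5, hκ]
    field_simp
    ring
  · have h3 : v =ᶠ[𝓝 T] fun _ => 0 := by
      filter_upwards [Ioi_mem_nhds hT] with r hr using hz r hr
    exact (h1 T).unique ((hasDerivAt_const T (0 : ℝ)).congr_of_eventuallyEq h3)

theorem tendsto_zero_of_continuous_mul_pow {k : ℕ} (hk : k ≠ 0) {f g : ℝ → ℝ} (hf : Continuous f)
    (hg : ∀ r, 0 < r → g r = r ^ k * f r) : Tendsto g (𝓝[>] 0) (𝓝 0) := by
  have h1 : Continuous fun r => r ^ k * f r := by fun_prop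
  have h2 : Tendsto (fun r => r ^ k * f r) (𝓝[>] 0) (𝓝 0) := by
    simpa [hk] using (h1.tendsto 0).mono_left nhdsWithin_le_nhds
  refine h2.congr' ?_
  filter_upwards [self_mem_nhdsWithin] with r hr using (hg r hr).symm

theorem continuous_realLapl {u : EuclideanSpace ℝ (Fin n) → ℝ} (hu : ContDiff ℝ (⊤ : ℕ∞) u) :
    Continuous (realLapl u) := by
  refine continuous_finsetSum _ fun j _ => ?_
  have h1 : ContDiff ℝ (⊤ : ℕ∞) (fderiv ℝ u) := hu.fderiv_right (by simp)
  have h2 : ContDiff ℝ (⊤ : ℕ∞) fun y => fderiv ℝ u y (EuclideanSpace.single j 1) :=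
    h1.clm_apply contDiff_const
  exact (h2.continuous_fderiv (by simp)).clm_apply continuous_const

theorem integrable_sphereCoeff {g Y : EuclideanSpace ℝ (Fin n) → ℝ} (hg : Continuous g)
    (hY : Continuous Y) (r : ℝ) :
    Integrable (fun ω : Metric.sphere (0 : EuclideanSpace ℝ (Fin n)) 1 => g (r • ω.1) * Y ω.1)
      (volume : Measure (EuclideanSpace ℝ (Fin n))).toSphere :=
  Continuous.integrable_of_hasCompactSupport (by fun_prop) (HasCompactSupport.of_compactSpace _)

theorem sphereCoeff_combination {g₁ g₂ g₃ Y : EuclideanSpace ℝ (Fin n) → ℝ} (h1 : Continuous g₁)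
    (h2 : Continuous g₂) (h3 : Continuous g₃) (hY : Continuous Y) (a b c r : ℝ) :
    sphereCoeff (fun x => a * g₁ x + b * g₂ x + c * g₃ x) Y r =
      a * sphereCoeff g₁ Y r + b * sphereCoeff g₂ Y r + c * sphereCoeff g₃ Y r := by
  have i1 := (integrable_sphereCoeff h1 hY r).const_mul a
  have i2 := (integrable_sphereCoeff h2 hY r).const_mul b
  have i3 := (integrable_sphereCoeff h3 hY r).const_mul c
  simp only [sphereCoeff]
  rw [← integral_const_mul, ← integral_const_mul, ← integral_const_mul, ← integral_add i1 i2,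
    ← integral_add (f := fun ω => a * (g₁ (r • ω.1) * Y ω.1) + b * (g₂ (r • ω.1) * Y ω.1))
      (i1.add i2) i3]
  refine integral_congr_ae (Eventually.of_forall fun ω => ?_)
  ring

/-- The coefficients of a solution form a radial mode. -/
theorem exists_isRadialMode (hn : 2 ≤ n) {l : ℕ} {u₁ u₂ Y : EuclideanSpace ℝ (Fin n) → ℝ}
    {V : ℝ → ℝ} {R T' T h ε E : ℝ} (hY : IsSolidHarmonic l Y) (hu₁ : ContDiff ℝ (⊤ : ℕ∞) u₁)
    (hu₂ : ContDiff ℝ (⊤ : ℕ∞) u₂) (hT' : 0 < T') (hT : T' < T)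
    (hs₁ : ∀ x, T' ≤ ‖x‖ → u₁ x = 0) (hs₂ : ∀ x, T' ≤ ‖x‖ → u₂ x = 0)
    (he₁ : ∀ᵐ x, ‖x‖ < R →
      -h ^ 2 * realLapl u₁ x + (V ‖x‖ - E) * u₁ x + ε * u₂ x = 0)
    (he₂ : ∀ᵐ x, ‖x‖ < R →
      -h ^ 2 * realLapl u₂ x + (V ‖x‖ - E) * u₂ x + (-ε) * u₁ x = 0) :
    ∃ (m : ℝ) (p q p₁ q₁ p₂ q₂ : ℝ → ℝ), IsRadialMode V R T h ε E m p q p₁ q₁ p₂ q₂ ∧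
      -h ^ 2 / 4 ≤ m ∧ ∀ r, 0 < r →
        p r ^ 2 = r ^ (n - 1) * sphereCoeff u₁ Y r ^ 2 ∧
        q r ^ 2 = r ^ (n - 1) * sphereCoeff u₂ Y r ^ 2 ∧
        radialSource h ε E m p q p₂ r ^ 2 = r ^ (n - 1) *
          sphereCoeff (fun x => -h ^ 2 * realLapl u₁ x + -E * u₁ x + ε * u₂ x) Y r ^ 2 ∧
        radialSource h (-ε) E m q p q₂ r ^ 2 = r ^ (n - 1) *
          sphereCoeff (fun x => -h ^ 2 * realLapl u₂ x + -E * u₂ x + -ε * u₁ x) Y r ^ 2 := by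
  obtain ⟨ν, hν⟩ : ∃ ν : ℝ, ν = (n - 1) / 2 := ⟨_, rfl⟩
  obtain ⟨κ, hκ⟩ : ∃ κ : ℝ, κ = l * (l + n - 2) + ν * (ν - 1) := ⟨_, rfl⟩
  obtain ⟨v₁, p₂, hv, hv₁, hp, hp1, hp2, hpe, hvT, hv₁T⟩ :=
    exists_radial_ode hn hY hu₁ hT' hT hs₁ hν hκ
  obtain ⟨z₁, q₂, hz, hz₁, hq, hq1, hq2, hqe, hzT, hz₁T⟩ :=
    exists_radial_ode hn hY hu₂ hT' hT hs₂ hν hκ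
  have hn1 : n - 1 ≠ 0 := by omega
  have hYc := hY.contDiff.continuous
  have hsq : ∀ r : ℝ, 0 < r → r ^ ν * r ^ ν = r ^ (n - 1) := fun r hr => by
    rw [← Real.rpow_add hr, ← Real.rpow_natCast]
    congr 1
    rw [hν, Nat.cast_sub (by omega)]
    push_cast
    ring
  have hae : ∀ {a b : EuclideanSpace ℝ (Fin n) → ℝ} {δ : ℝ}, ContDiff ℝ (⊤ : ℕ∞) a →
      ContDiff ℝ (⊤ : ℕ∞) b →
      (∀ᵐ x, ‖x‖ < R → -h ^ 2 * realLapl a x + (V ‖x‖ - E) * a x + δ * b x = 0) →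
      ∀ᵐ r ∂(volume : Measure ℝ), 0 < r → r < R → -h ^ 2 * sphereCoeff (realLapl a) Y r +
        (V r - E) * sphereCoeff a Y r + δ * sphereCoeff b Y r = 0 := by
    intro a b δ ha hb hab
    have : Nonempty (Fin n) := ⟨⟨0, by omega⟩⟩
    filter_upwards [ae_ae_sphere_of_ae volume hab] with r hr h0 hR
    rw [← sphereCoeff_combination (continuous_realLapl ha) ha.continuous hb.continuous hYc]
    simp only [sphereCoeff]
    refine integral_eq_zero_of_ae ?_
    filter_upwards [hr h0] with ω hω
    have hnorm : ‖r • ω.1‖ = r := by simp [norm_smul, abs_of_pos h0]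
    rw [hnorm] at hω
    change (_ + _ + _) * Y ω.1 = 0
    rw [hω hR, zero_mul]
  refine ⟨h ^ 2 * κ, fun r => r ^ ν * sphereCoeff u₁ Y r, fun r => r ^ ν * sphereCoeff u₂ Y r,
    _, _, p₂, q₂, ⟨hp, hq, hp1, hq1, hp2, hq2, by simp [hvT], by simp [hzT],
    by simp [hvT, hv₁T], by simp [hzT, hz₁T], ?_, ?_, ?_, ?_, ?_⟩, ?_, fun r hr => ⟨?_, ?_, ?_, ?_⟩⟩
  · refine tendsto_zero_of_continuous_mul_pow hn1
      (f := fun r => z₁ r * sphereCoeff u₁ Y r - v₁ r * sphereCoeff u₂ Y r) (by fun_prop)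
      fun r hr => ?_
    rw [← hsq r hr]
    ring
  · refine tendsto_zero_of_continuous_mul_pow hn1
      (f := fun r => r ^ 2 * (v₁ r * sphereCoeff u₁ Y r + z₁ r * sphereCoeff u₂ Y r) +
        ν * r * (sphereCoeff u₁ Y r ^ 2 + sphereCoeff u₂ Y r ^ 2)) (by fun_prop)
      fun r hr => ?_
    rw [← hsq r hr]
    field_simp
    ring
  · refine tendsto_zero_of_continuous_mul_pow hn1
      (f := fun r => r * (sphereCoeff u₁ Y r ^ 2 + sphereCoeff u₂ Y r ^ 2)) (by fun_prop)
      fun r hr => ?_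
    rw [← hsq r hr]
    ring
  · filter_upwards [hae hu₁ hu₂ he₁] with r h1 h0 hR
    rw [hpe r h0]
    linear_combination (-r ^ ν) * h1 h0 hR
  · filter_upwards [hae hu₂ hu₁ he₂] with r h1 h0 hR
    rw [hqe r h0]
    linear_combination (-r ^ ν) * h1 h0 hR
  · have h1 : -1 / 4 ≤ κ := by
      have h2 : (2 : ℝ) ≤ n := by exact_mod_cast hn
      have h3 : (0 : ℝ) ≤ l * (l + n - 2) :=
        mul_nonneg (by positivity) (by linarith [(Nat.cast_nonneg l : (0 : ℝ) ≤ l)])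
      rw [hκ]
      nlinarith [sq_nonneg (ν - 1 / 2)]
    nlinarith [sq_nonneg h, mul_le_mul_of_nonneg_left h1 (sq_nonneg h)]
  · rw [← hsq r hr]; ring
  · rw [← hsq r hr]; ring
  · rw [sphereCoeff_combination (continuous_realLapl hu₁) hu₁.continuous hu₂.continuous hYc,
      ← hsq r hr, radialSource, hpe r hr]
    ring
  · rw [sphereCoeff_combination (continuous_realLapl hu₂) hu₂.continuous hu₁.continuous hYc,
      ← hsq r hr, radialSource, hqe r hr]
    ring

end ModeReduction

section Summation

variable {n : ℕ}

theorem ae_norm_of_ae (hn : 0 < n) {P : ℝ → Prop} (hP : ∀ᵐ r ∂(volume : Measure ℝ), P r) :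
    ∀ᵐ x : EuclideanSpace ℝ (Fin n), P ‖x‖ := by
  have : Nonempty (Fin n) := ⟨⟨0, hn⟩⟩
  obtain ⟨N, hN1, hN2, hN3⟩ := exists_measurable_superset_of_null (ae_iff.1 hP)
  have hm : Measurable fun x : EuclideanSpace ℝ (Fin n) => N.indicator (1 : ℝ → ENNReal) ‖x‖ :=
    (measurable_one.indicator hN2).comp measurable_norm
  have h1 : ∫⁻ x : EuclideanSpace ℝ (Fin n), N.indicator (1 : ℝ → ENNReal) ‖x‖ = 0 := by
    rw [lintegral_eq_lintegral_sphere volume hm]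
    refine (lintegral_congr_ae ?_).trans lintegral_zero
    have h2 : ∀ᵐ r ∂(volume : Measure ℝ), r ∉ N := measure_eq_zero_iff_ae_notMem.1 hN3
    filter_upwards [ae_restrict_mem measurableSet_Ioi, ae_restrict_of_ae h2] with r hr hrN
    have h3 : ∀ ω : Metric.sphere (0 : EuclideanSpace ℝ (Fin n)) 1,
        N.indicator (1 : ℝ → ENNReal) ‖r • ω.1‖ = 0 := fun ω => by
      simp [norm_smul, abs_of_pos (mem_Ioi.1 hr), hrN]
    simp [h3]
  rw [lintegral_eq_zero_iff hm] at h1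
  filter_upwards [h1] with x hx
  by_contra h
  simp [indicator_of_mem (hN1 h)] at hx

theorem continuous_sphereCoeff {g Y : EuclideanSpace ℝ (Fin n) → ℝ} (hg : Continuous g)
    (hY : Continuous Y) : Continuous (sphereCoeff g Y) := by
  refine continuous_integral_of_continuous (volume : Measure (EuclideanSpace ℝ (Fin n))).toSphere ?_
  unfold Function.uncurry
  fun_prop

/-- Weighted square integrals outside a ball as sums over spherical modes. -/
theorem lintegral_exterior_eq_tsum (hn : 0 < n) {ι : Type} [Countable ι]
    {Y : ι → EuclideanSpace ℝ (Fin n) → ℝ} (hYc : ∀ i, Continuous (Y i))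
    (hY : ∀ g : Metric.sphere (0 : EuclideanSpace ℝ (Fin n)) 1 → ℝ, Continuous g →
        HasSum (fun i => (∫ ω, g ω * Y i ω.1 ∂(volume.toSphere)) ^ 2)
          (∫ ω, g ω ^ 2 ∂(volume.toSphere)))
    {a b : EuclideanSpace ℝ (Fin n) → ℝ} (ha : Continuous a) (hb : Continuous b) {R : ℝ}
    (hR : 0 < R) {w : ℝ → ℝ} (hw : Measurable w) (hw0 : ∀ r, 0 < r → 0 ≤ w r) :
    ∫⁻ x in {x : EuclideanSpace ℝ (Fin n) | R ≤ ‖x‖},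
        ENNReal.ofReal (w ‖x‖ * (a x ^ 2 + b x ^ 2)) =
      ∑' i, ∫⁻ r in Ici R, ENNReal.ofReal (w r *
        (r ^ (n - 1) * sphereCoeff a (Y i) r ^ 2 + r ^ (n - 1) * sphereCoeff b (Y i) r ^ 2)) := by
  have : Nonempty (Fin n) := ⟨⟨0, hn⟩⟩
  have hmeas : MeasurableSet {x : EuclideanSpace ℝ (Fin n) | R ≤ ‖x‖} :=
    measurableSet_le measurable_const measurable_norm
  have hca : ∀ i, Continuous (sphereCoeff a (Y i)) := fun i => continuous_sphereCoeff ha (hYc i)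
  have hcb : ∀ i, Continuous (sphereCoeff b (Y i)) := fun i => continuous_sphereCoeff hb (hYc i)
  have hgm : Measurable fun x : EuclideanSpace ℝ (Fin n) =>
      ENNReal.ofReal (w ‖x‖ * (a x ^ 2 + b x ^ 2)) := by
    have := ha.measurable
    have := hb.measurable
    have := hw.comp (measurable_norm (α := EuclideanSpace ℝ (Fin n)))
    fun_prop
  rw [← lintegral_indicator hmeas, lintegral_eq_lintegral_sphere volume (hgm.indicator hmeas),
    finrank_euclideanSpace_fin, ← lintegral_tsum]
  · rw [← lintegral_indicator measurableSet_Ioi, ← lintegral_indicator measurableSet_Ici]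
    refine lintegral_congr fun r => ?_
    rcases lt_or_ge r R with hr | hr
    · rw [indicator_of_notMem (s := Ici R) (by simpa using hr)]
      by_cases h0 : 0 < r
      · rw [indicator_of_mem (s := Ioi 0) h0]
        have h1 : ∀ ω : Metric.sphere (0 : EuclideanSpace ℝ (Fin n)) 1,
            r • ω.1 ∉ {x : EuclideanSpace ℝ (Fin n) | R ≤ ‖x‖} := fun ω => by
          simpa [norm_smul, abs_of_pos h0] using hr
        simp [indicator_of_notMem (h1 _)]
      · rw [indicator_of_notMem (s := Ioi 0) h0]
    · have h0 : 0 < r := hR.trans_le hr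
      rw [indicator_of_mem (s := Ioi 0) h0, indicator_of_mem (s := Ici R) hr]
      have hnr : ∀ ω : Metric.sphere (0 : EuclideanSpace ℝ (Fin n)) 1, ‖r • ω.1‖ = r := fun ω => by
        simp [norm_smul, abs_of_pos h0]
      have h1 : ∀ ω : Metric.sphere (0 : EuclideanSpace ℝ (Fin n)) 1,
          r • ω.1 ∈ {x : EuclideanSpace ℝ (Fin n) | R ≤ ‖x‖} := fun ω => by
        simpa [hnr] using hr
      simp only [indicator_of_mem (h1 _), hnr]
      have hsa := hY (fun ω => a (r • ω.1)) (by fun_prop)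
      have hsb := hY (fun ω => b (r • ω.1)) (by fun_prop)
      have hs := (hsa.add hsb).mul_left (r ^ (n - 1) * w r)
      have hn0 : 0 ≤ r ^ (n - 1) * w r := mul_nonneg (by positivity) (hw0 r h0)
      have hcont : ∀ c : EuclideanSpace ℝ (Fin n) → ℝ, Continuous c → Integrable
          (fun ω : Metric.sphere (0 : EuclideanSpace ℝ (Fin n)) 1 => c (r • ω.1) ^ 2)
          (volume : Measure (EuclideanSpace ℝ (Fin n))).toSphere := fun c hc =>
        Continuous.integrable_of_hasCompactSupport (by fun_prop) (HasCompactSupport.of_compactSpace _)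
      have hl : ∫⁻ ω : Metric.sphere (0 : EuclideanSpace ℝ (Fin n)) 1,
          ENNReal.ofReal (w r * (a (r • ω.1) ^ 2 + b (r • ω.1) ^ 2)) ∂(volume.toSphere) =
          ENNReal.ofReal (∫ ω : Metric.sphere (0 : EuclideanSpace ℝ (Fin n)) 1,
            w r * (a (r • ω.1) ^ 2 + b (r • ω.1) ^ 2) ∂(volume.toSphere)) := by
        rw [ofReal_integral_eq_lintegral_ofReal]
        · exact ((hcont a ha).add (hcont b hb)).const_mul _
        · exact Eventually.of_forall fun ω => mul_nonneg (hw0 r h0) (by positivity)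
      rw [hl, integral_const_mul, integral_add (hcont a ha) (hcont b hb),
        ← ENNReal.ofReal_mul (by positivity), ← mul_assoc, ← hs.tsum_eq,
        ENNReal.ofReal_tsum_of_nonneg _ hs.summable]
      · refine tsum_congr fun i => ?_
        congr 1
        simp only [sphereCoeff]
        ring
      · intro i
        positivity
  · intro i
    have := (hca i).measurable
    have := (hcb i).measurable
    exact Measurable.aemeasurable (by fun_prop)

end Summation

section Assembly

theorem lintegral_mode_bound {V : ℝ → ℝ} {R T s K h ε E m : ℝ} {p q p₁ q₁ p₂ q₂ : ℝ → ℝ}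
    (hmode : IsRadialMode V R T h ε E m p q p₁ q₁ p₂ q₂) (hR : 0 < R) (hRT : R ≤ T) (hK : 0 ≤ K)
    (hb : ∫ r in R..T, r ^ (-(2 * s)) * (p r ^ 2 + q r ^ 2) ≤
      K * ∫ r in R..T, r ^ (2 * s) *
        (radialSource h ε E m p q p₂ r ^ 2 + radialSource h (-ε) E m q p q₂ r ^ 2)) :
    ∫⁻ r in Ioc R T, ENNReal.ofReal (r ^ (-(2 * s)) * (p r ^ 2 + q r ^ 2)) ≤
      ENNReal.ofReal K * ∫⁻ r in Ioc R T, ENNReal.ofReal (r ^ (2 * s) *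
        (radialSource h ε E m p q p₂ r ^ 2 + radialSource h (-ε) E m q p q₂ r ^ 2)) := by
  have hpow : ∀ a : ℝ, ContinuousOn (fun r : ℝ => r ^ a) (Icc R T) := fun a =>
    continuousOn_id.rpow_const fun r hr => Or.inl (hR.trans_le hr.1).ne'
  have hsub : Icc R T ⊆ Ioi 0 := fun r hr => hR.trans_le hr.1
  have key : ∀ (a : ℝ) (f g : ℝ → ℝ), ContinuousOn f (Ioi 0) → ContinuousOn g (Ioi 0) →
      ∫⁻ r in Ioc R T, ENNReal.ofReal (r ^ a * (f r ^ 2 + g r ^ 2)) =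
        ENNReal.ofReal (∫ r in R..T, r ^ a * (f r ^ 2 + g r ^ 2)) := by
    intro a f g hf hg
    rw [intervalIntegral.integral_of_le hRT, ofReal_integral_eq_lintegral_ofReal]
    · exact (((hpow a).mul (((hf.mono hsub).pow 2).add ((hg.mono hsub).pow 2))).integrableOn_Icc).mono_set
        Ioc_subset_Icc_self
    · filter_upwards [ae_restrict_mem measurableSet_Ioc] with r hr
      have : 0 < r := hR.trans hr.1
      show 0 ≤ r ^ a * (f r ^ 2 + g r ^ 2)
      positivity
  rw [key _ p q hmode.cp hmode.cq,
    key _ _ _ hmode.continuousOn_source_re hmode.continuousOn_source_im, ← ENNReal.ofReal_mul hK]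
  exact ENNReal.ofReal_le_ofReal hb

theorem exists_real_exterior_bound {n : ℕ} (hn : 2 ≤ n) {Emin Emax R s : ℝ} {V : ℝ → ℝ}
    (hEmin : 0 < Emin) (hE : Emin ≤ Emax) (hs1 : 1 / 2 < s) (hs2 : s ≤ 1)
    (hVbdd : ∃ Cv : ℝ, ∀ᵐ r ∂(volume.restrict (Ioi (0 : ℝ))), |V r| ≤ Cv)
    (hVsupp : HasCompactSupport V) (hR0 : 0 < R0 V)
    (hR : sSup ((fun E => R1 V E) '' Icc Emin Emax) < R) :
    0 < R ∧ (∀ᵐ r ∂(volume : Measure ℝ), 0 < r → R < r → V r = 0) ∧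
    ∃ C > (0 : ℝ), ∃ h₀ > (0 : ℝ), ∀ (h ε E T' : ℝ) (u₁ u₂ : EuclideanSpace ℝ (Fin n) → ℝ),
      h ∈ Ioc 0 h₀ → 0 < ε → E ∈ Icc Emin Emax → 0 < T' →
      ContDiff ℝ (⊤ : ℕ∞) u₁ → ContDiff ℝ (⊤ : ℕ∞) u₂ →
      (∀ x, T' ≤ ‖x‖ → u₁ x = 0) → (∀ x, T' ≤ ‖x‖ → u₂ x = 0) →
      (∀ᵐ x, ‖x‖ < R → -h ^ 2 * realLapl u₁ x + (V ‖x‖ - E) * u₁ x + ε * u₂ x = 0) →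
      (∀ᵐ x, ‖x‖ < R → -h ^ 2 * realLapl u₂ x + (V ‖x‖ - E) * u₂ x + -ε * u₁ x = 0) →
      ∫⁻ x in {x : EuclideanSpace ℝ (Fin n) | R ≤ ‖x‖},
        ENNReal.ofReal (‖x‖ ^ (-(2 * s)) * (u₁ x ^ 2 + u₂ x ^ 2)) ≤
      ENNReal.ofReal (C / h ^ 2) * ∫⁻ x in {x : EuclideanSpace ℝ (Fin n) | R ≤ ‖x‖},
        ENNReal.ofReal (‖x‖ ^ (2 * s) *
          ((-h ^ 2 * realLapl u₁ x + -E * u₁ x + ε * u₂ x) ^ 2 +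
            (-h ^ 2 * realLapl u₂ x + -E * u₂ x + -ε * u₁ x) ^ 2)) := by
  obtain ⟨hRpos, hV0, C, hC, h₀, hh₀, hmain⟩ :=
    exists_mode_bound hEmin hE hs1 hs2 hVbdd hVsupp hR0 hR
  refine ⟨hRpos, hV0, C, hC, h₀, hh₀, ?_⟩
  intro h ε E T' u₁ u₂ hh hε hEE hT' hu₁ hu₂ hz₁ hz₂ he₁ he₂
  obtain ⟨ι, _, deg, Y, hY, hpars⟩ := exists_harmonic_parseval hn
  have hYc : ∀ i, Continuous (Y i) := fun i => (hY i).contDiff.continuous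
  have hl₁ := continuous_realLapl hu₁
  have hl₂ := continuous_realLapl hu₂
  have hc₁ := hu₁.continuous
  have hc₂ := hu₂.continuous
  have hm : ∀ a : ℝ, Measurable fun r : ℝ => r ^ a := fun a => by fun_prop
  have hp0 : ∀ a r : ℝ, 0 < r → 0 ≤ r ^ a := fun a r hr => by positivity
  rw [lintegral_exterior_eq_tsum (by omega) hYc hpars hc₁ hc₂ hRpos (hm _) (hp0 _),
    lintegral_exterior_eq_tsum (by omega) hYc hpars (by fun_prop) (by fun_prop) hRpos (hm _)
      (hp0 _), ← ENNReal.tsum_mul_left]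
  refine ENNReal.tsum_le_tsum fun i => ?_
  have hT'T : T' < max T' R + 1 := by linarith [le_max_left T' R]
  have hRT : R ≤ max T' R + 1 := by linarith [le_max_right T' R]
  set T := max T' R + 1
  obtain ⟨m, p, q, p₁, q₁, p₂, q₂, hmode, hmh, hpq⟩ :=
    exists_isRadialMode hn (hY i) hu₁ hu₂ hT' hT'T hz₁ hz₂ he₁ he₂
  have hb := lintegral_mode_bound hmode hRpos hRT (by have := hh.1; positivity)
    (hmain T h ε E m p q p₁ q₁ p₂ q₂ hmode hh hε hEE hmh hRT)
  have hzero : ∀ u : EuclideanSpace ℝ (Fin n) → ℝ, (∀ x, T' ≤ ‖x‖ → u x = 0) →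
      ∀ r, T' < r → sphereCoeff u (Y i) r = 0 := fun u hz r hr => by
    have : ∀ ω : Metric.sphere (0 : EuclideanSpace ℝ (Fin n)) 1, u (r • ω.1) = 0 := fun ω =>
      hz _ (by simp [norm_smul, abs_of_pos (hT'.trans hr), hr.le])
    simp [sphereCoeff, this]
  calc ∫⁻ r in Ici R, ENNReal.ofReal (r ^ (-(2 * s)) *
        (r ^ (n - 1) * sphereCoeff u₁ (Y i) r ^ 2 + r ^ (n - 1) * sphereCoeff u₂ (Y i) r ^ 2))
      = ∫⁻ r in Ioc R T, ENNReal.ofReal (r ^ (-(2 * s)) * (p r ^ 2 + q r ^ 2)) := by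
        rw [setLIntegral_congr Ioi_ae_eq_Ici.symm, ← lintegral_indicator measurableSet_Ioi,
          ← lintegral_indicator measurableSet_Ioc]
        refine lintegral_congr fun r => ?_
        by_cases hr : r ∈ Ioi R
        · have hr0 : 0 < r := hRpos.trans hr
          rw [indicator_of_mem hr, ← (hpq r hr0).1, ← (hpq r hr0).2.1]
          by_cases hrT : r ≤ T
          · rw [indicator_of_mem (show r ∈ Ioc R T from ⟨hr, hrT⟩)]
          · rw [indicator_of_notMem fun h' => hrT h'.2, (hpq r hr0).1, (hpq r hr0).2.1,
              hzero u₁ hz₁ r (hT'T.trans (not_le.1 hrT)),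
              hzero u₂ hz₂ r (hT'T.trans (not_le.1 hrT))]
            simp
        · rw [indicator_of_notMem hr, indicator_of_notMem fun h' => hr h'.1]
    _ ≤ _ := hb
    _ ≤ _ := by
        refine mul_le_mul_right ?_ _
        refine le_trans (le_of_eq ?_) (lintegral_mono_set (fun r (hr : r ∈ Ioc R T) => hr.1.le))
        refine setLIntegral_congr_fun measurableSet_Ioc fun r hr => ?_
        have hr0 : 0 < r := hRpos.trans hr.1
        rw [(hpq r hr0).2.2.1, (hpq r hr0).2.2.2]

theorem clm_lapl {n : ℕ} {u : EuclideanSpace ℝ (Fin n) → ℂ} (hu : ContDiff ℝ (⊤ : ℕ∞) u)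
    (L : ℂ →L[ℝ] ℝ) (x : EuclideanSpace ℝ (Fin n)) :
    L (lapl u x) = realLapl (fun x => L (u x)) x := by
  have h1 : Differentiable ℝ u := hu.differentiable (by simp)
  have h2 : Differentiable ℝ (fderiv ℝ u) :=
    (hu.fderiv_right (m := (⊤ : ℕ∞)) (by simp)).differentiable (by simp)
  have h3 : ∀ y v, fderiv ℝ (fun x => L (u x)) y v = L (fderiv ℝ u y v) := fun y v => by
    exact congrArg (fun A => A v) (L.hasFDerivAt.comp y (h1 y).hasFDerivAt).fderiv
  simp only [lapl, realLapl, map_sum, h3]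
  refine Finset.sum_congr rfl fun j _ => ?_
  have h4 : HasFDerivAt (fun y => fderiv ℝ u y (EuclideanSpace.single j 1))
      ((fderiv ℝ (fderiv ℝ u) x).flip (EuclideanSpace.single j 1)) x := by
    simpa using (h2 x).hasFDerivAt.clm_apply
      (hasFDerivAt_const (EuclideanSpace.single j (1 : ℝ)) x)
  rw [iteratedFDeriv_two_apply]
  exact (congrArg (fun A => A (EuclideanSpace.single j 1)) (L.hasFDerivAt.comp x h4).fderiv).symm

theorem jbr_sq (s t : ℝ) : jbr s t ^ 2 = (1 + t ^ 2) ^ s := by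
  rw [jbr, ← Real.rpow_natCast, ← Real.rpow_mul (by positivity)]
  norm_num

theorem rpow_le_jbr_sq {s t : ℝ} (hs : 0 ≤ s) (ht : 0 < t) : t ^ (2 * s) ≤ jbr s t ^ 2 := by
  rw [jbr_sq, Real.rpow_mul ht.le, Real.rpow_two]
  exact Real.rpow_le_rpow (by positivity) (by linarith) hs

theorem jbr_neg_sq_le {s t : ℝ} (hs : 0 ≤ s) (ht : 0 < t) :
    jbr (-s) t ^ 2 ≤ t ^ (-(2 * s)) := by
  have h := rpow_le_jbr_sq hs ht
  rw [jbr_sq] at h ⊢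
  rw [Real.rpow_neg (by positivity), Real.rpow_neg ht.le]
  exact inv_anti₀ (by positivity) h

theorem eLpNorm_jbr_mul {n : ℕ} (s : ℝ) (g : EuclideanSpace ℝ (Fin n) → ℂ)
    (μ : Measure (EuclideanSpace ℝ (Fin n))) :
    eLpNorm (fun x => (jbr s ‖x‖ : ℂ) * g x) 2 μ =
      (∫⁻ x, ENNReal.ofReal (jbr s ‖x‖ ^ 2 * ((g x).re ^ 2 + (g x).im ^ 2)) ∂μ) ^ (1 / 2 : ℝ) := by
  rw [eLpNorm_eq_lintegral_rpow_enorm_toReal (by norm_num) (by norm_num)]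
  simp only [ENNReal.toReal_ofNat]
  congr 1
  refine lintegral_congr fun x => ?_
  rw [← ofReal_norm, ENNReal.ofReal_rpow_of_nonneg (norm_nonneg _) (by norm_num)]
  congr 1
  rw [Real.rpow_two, norm_mul, mul_pow, Complex.norm_real, Real.norm_eq_abs, sq_abs,
    ← Complex.normSq_eq_norm_sq, Complex.normSq_apply]
  ring

end Assembly

end ResolventEstimates

/-- A priori-estimate form of the exterior weighted resolvent bound
`‖⟨x⟩^{-s} 𝟙_{≥R} (-h²Δ + V(|x|) - E - iε)⁻¹ 𝟙_{≥R} ⟨x⟩^{-s}‖ ≤ C/h`. -/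
theorem exterior_weighted_resolvent_bound
    (n : ℕ) (hn : 2 ≤ n) (Emin Emax : ℝ) (hEmin : 0 < Emin) (hE : Emin ≤ Emax)
    (s : ℝ) (hs1 : 1 / 2 < s) (hs2 : s ≤ 1)
    (V : ℝ → ℝ) (hVmeas : Measurable V)
    (hVbdd : ∃ Cv : ℝ, ∀ᵐ r ∂(volume.restrict (Ioi (0 : ℝ))), |V r| ≤ Cv)
    (hVsupp : HasCompactSupport V) (hR0 : 0 < R0 V)
    (R : ℝ) (hR : sSup ((fun E => R1 V E) '' Icc Emin Emax) < R) :
    ∃ C > (0 : ℝ), ∃ h₀ > (0 : ℝ), ∀ ε > (0 : ℝ), ∀ h ∈ Ioc (0 : ℝ) h₀,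
      ∀ E ∈ Icc Emin Emax,
      ∀ u : EuclideanSpace ℝ (Fin n) → ℂ, ContDiff ℝ (⊤ : ℕ∞) u → HasCompactSupport u →
      ∀ f : EuclideanSpace ℝ (Fin n) → ℂ,
        (f = fun x => -(h : ℂ) ^ 2 * lapl u x + (V ‖x‖ : ℂ) * u x
          - ((E : ℂ) + ε * Complex.I) * u x) →
        (∀ᵐ x ∂(volume : Measure (EuclideanSpace ℝ (Fin n))), ‖x‖ < R → f x = 0) →
        eLpNorm (fun x => (jbr (-s) ‖x‖ : ℂ) * u x) 2
            (volume.restrict {x : EuclideanSpace ℝ (Fin n) | R ≤ ‖x‖}) ≤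
          ENNReal.ofReal (C / h) * eLpNorm (fun x => (jbr s ‖x‖ : ℂ) * f x) 2 volume := by
  obtain ⟨hRpos, hV0, C, hC, h₀, hh₀, hmain⟩ :=
    exists_real_exterior_bound hn hEmin hE hs1 hs2 hVbdd hVsupp hR0 hR
  refine ⟨√C, Real.sqrt_pos.2 hC, h₀, hh₀, ?_⟩
  intro ε hε h hh E hEE u hu husupp f hf hf0
  have hs0 : 0 ≤ s := by linarith
  have hh0 : 0 < h := hh.1
  obtain ⟨T', hT', hz⟩ : ∃ T' > (0 : ℝ), ∀ x, T' ≤ ‖x‖ → u x = 0 := by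
    obtain ⟨T', hT'⟩ := husupp.isCompact.isBounded.subset_closedBall 0
    refine ⟨max T' 0 + 1, by positivity, fun x hx => ?_⟩
    by_contra h0
    have := hT' (subset_tsupport u h0)
    rw [mem_closedBall_zero_iff] at this
    linarith [le_max_left T' 0]
  have hre : ∀ x, (f x).re = -h ^ 2 * realLapl (fun x => (u x).re) x +
      (V ‖x‖ - E) * (u x).re + ε * (u x).im := fun x => by
    have := clm_lapl hu Complex.reCLM x
    simp only [Complex.reCLM_apply] at this
    rw [← this, hf]
    simp [← Complex.ofReal_pow]
    ring
  have him : ∀ x, (f x).im = -h ^ 2 * realLapl (fun x => (u x).im) x +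
      (V ‖x‖ - E) * (u x).im + -ε * (u x).re := fun x => by
    have := clm_lapl hu Complex.imCLM x
    simp only [Complex.imCLM_apply] at this
    rw [← this, hf]
    simp [← Complex.ofReal_pow]
    ring
  have hb := hmain h ε E T' (fun x => (u x).re) (fun x => (u x).im) hh hε hEE hT'
    (Complex.reCLM.contDiff.comp hu) (Complex.imCLM.contDiff.comp hu)
    (fun x hx => by simp [hz x hx]) (fun x hx => by simp [hz x hx])
    (hf0.mono fun x hx hxR => by rw [← hre, hx hxR, Complex.zero_re])
    (hf0.mono fun x hx hxR => by rw [← him, hx hxR, Complex.zero_im])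
  have hmeas : MeasurableSet {x : EuclideanSpace ℝ (Fin n) | R ≤ ‖x‖} :=
    measurableSet_le measurable_const measurable_norm
  have hVR : ∀ᵐ x : EuclideanSpace ℝ (Fin n), R ≤ ‖x‖ → V ‖x‖ = 0 := by
    refine ae_norm_of_ae (P := fun r => R ≤ r → V r = 0) (by omega) ?_
    filter_upwards [hV0, compl_mem_ae_iff.2 (measure_singleton R)] with r hr hrR hle
    exact hr (hRpos.trans_le hle) (lt_of_le_of_ne hle fun h' => hrR h'.symm)
  have hleft : ∫⁻ x in {x : EuclideanSpace ℝ (Fin n) | R ≤ ‖x‖},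
      ENNReal.ofReal (jbr (-s) ‖x‖ ^ 2 * ((u x).re ^ 2 + (u x).im ^ 2)) ≤
      ∫⁻ x in {x : EuclideanSpace ℝ (Fin n) | R ≤ ‖x‖},
        ENNReal.ofReal (‖x‖ ^ (-(2 * s)) * ((u x).re ^ 2 + (u x).im ^ 2)) := by
    refine setLIntegral_mono' hmeas fun x hx => ENNReal.ofReal_le_ofReal ?_
    exact mul_le_mul_of_nonneg_right (jbr_neg_sq_le hs0 (hRpos.trans_le hx)) (by positivity)
  have hright : ∫⁻ x in {x : EuclideanSpace ℝ (Fin n) | R ≤ ‖x‖},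
      ENNReal.ofReal (‖x‖ ^ (2 * s) *
        ((-h ^ 2 * realLapl (fun x => (u x).re) x + -E * (u x).re + ε * (u x).im) ^ 2 +
          (-h ^ 2 * realLapl (fun x => (u x).im) x + -E * (u x).im + -ε * (u x).re) ^ 2)) ≤
      ∫⁻ x : EuclideanSpace ℝ (Fin n),
        ENNReal.ofReal (jbr s ‖x‖ ^ 2 * ((f x).re ^ 2 + (f x).im ^ 2)) := by
    refine le_trans (lintegral_mono_ae ?_) (setLIntegral_le_lintegral _ _)
    filter_upwards [ae_restrict_mem hmeas, ae_restrict_of_ae hVR] with x hx hV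
    rw [hre, him, hV hx, zero_sub]
    exact ENNReal.ofReal_le_ofReal
      (mul_le_mul_of_nonneg_right (rpow_le_jbr_sq hs0 (hRpos.trans_le hx)) (by positivity))
  have hconst : ENNReal.ofReal (√C / h) = ENNReal.ofReal (C / h ^ 2) ^ (1 / 2 : ℝ) := by
    rw [ENNReal.ofReal_rpow_of_nonneg (by positivity) (by norm_num), ← Real.sqrt_eq_rpow,
      Real.sqrt_div hC.le, Real.sqrt_sq hh0.le]
  rw [eLpNorm_jbr_mul, eLpNorm_jbr_mul, hconst, ← ENNReal.mul_rpow_of_nonneg _ _ (by norm_num)]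
  exact ENNReal.rpow_le_rpow (hleft.trans (hb.trans (mul_le_mul_right hright _))) (by norm_num)
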